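/- Let X ⊂ ℙ³ be a smooth cubic surface and let a ≥ 1 be an integer. Then the Minimal Resolution Conjecture holds for general sets of z points on X for each of the values z = m(a) = (3/2)a(a−1) + a, z = n(a) = (3/2)a(a−1) + 2a, z = o(a) = (3/2)a(a−1) + a + 1 and z = p(a) = (3/2)a(a−1) + 2a + 1; that is, for a general set Z of z such points, choosing r with P_X(r−1) ≤ z < P_X(r), one has b_{i+1,r−1}(Z)·b_{i,r}(Z) = 0 for all i. -/

import Mathlib

/-!
Common definitions for formalizing "The minimal resolution conjecture for points
on the cubic surface" (arXiv:math/0611137).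

We work with `R = k[x₀,x₁,x₂,x₃]`, closed points of `ℙ³` modeled by
`Projectivization k (Fin 4 → k)`, saturated ideals of sets of points as vanishing
ideals, genericity expressed by a nonempty basic open subset of the configuration
space, and graded minimal free resolutions expressed by explicit homogeneous
matrices whose entries have zero constant term (no nonzero scalar entries).
-/

open MvPolynomial

noncomputable section

/-- The polynomial ring `R = k[x₀,x₁,x₂,x₃]` in four variables over `k`. -/
abbrev R4 (k : Type) [Field k] : Type := MvPolynomial (Fin 4) k

/-- The (closed) points of the projective space `ℙ³` over `k`. -/
abbrev P3 (k : Type) [Field k] : Type := Projectivization k (Fin 4 → k)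

variable (k : Type) [Field k]

/-- A polynomial vanishes at a projective point if it vanishes at every
representative vector of that point. -/
def VanishesAt (f : R4 k) (p : P3 k) : Prop :=
  ∀ (v : Fin 4 → k) (hv : v ≠ 0), Projectivization.mk k v hv = p → eval v f = 0

/-- The saturated homogeneous ideal `I_Z ⊆ R` of a set `Z` of (reduced) points of
`ℙ³`: all polynomials vanishing at every point of `Z`. -/
def pointsIdeal (Zs : Set (P3 k)) : Ideal (R4 k) where
  carrier := {f | ∀ p ∈ Zs, VanishesAt k f p}
  zero_mem' := by
    intro p _ v hv _
    simp
  add_mem' := by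
    intro a b ha hb p hp v hv hmk
    have h1 := ha p hp v hv hmk
    have h2 := hb p hp v hv hmk
    simp [h1, h2]
  smul_mem' := by
    intro c a ha p hp v hv hmk
    have h1 := ha p hp v hv hmk
    simp [smul_eq_mul, h1]

/-- An ideal of `R` is homogeneous if it is generated by homogeneous elements. -/
def IsHomogIdeal (I : Ideal (R4 k)) : Prop :=
  ∃ G : Set (R4 k), (∀ g ∈ G, ∃ d : ℕ, g.IsHomogeneous d) ∧ I = Ideal.span G

/-- Saturation of an ideal with respect to the irrelevant maximal ideal
`(x₀,…,x₃)`. -/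
def satIdeal (I : Ideal (R4 k)) : Ideal (R4 k) where
  carrier := {g | ∀ i : Fin 4, ∃ N : ℕ, (X i : R4 k) ^ N * g ∈ I}
  zero_mem' := by
    intro i
    exact ⟨0, by simp⟩
  add_mem' := by
    intro a b ha hb i
    obtain ⟨N, hN⟩ := ha i
    obtain ⟨M, hM⟩ := hb i
    refine ⟨N + M, ?_⟩
    have h1 : (X i : R4 k) ^ (N + M) * (a + b)
        = X i ^ M * (X i ^ N * a) + X i ^ N * (X i ^ M * b) := by ring
    rw [h1]
    exact Ideal.add_mem _ (Ideal.mul_mem_left _ _ hN) (Ideal.mul_mem_left _ _ hM)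
  smul_mem' := by
    intro c a ha i
    obtain ⟨N, hN⟩ := ha i
    refine ⟨N, ?_⟩
    have h1 : (X i : R4 k) ^ N * (c • a) = c * (X i ^ N * a) := by
      rw [smul_eq_mul]; ring
    rw [h1]
    exact Ideal.mul_mem_left _ _ hN

/-- The colon ideal `(I : J) = {r | r·J ⊆ I}`. -/
def icolon (I J : Ideal (R4 k)) : Ideal (R4 k) where
  carrier := {r | ∀ x ∈ J, r * x ∈ I}
  zero_mem' := by
    intro x hx
    rw [zero_mul]; exact I.zero_mem
  add_mem' := by
    intro a b ha hb x hx
    rw [add_mul]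
    exact Ideal.add_mem _ (ha x hx) (hb x hx)
  smul_mem' := by
    intro c a ha x hx
    rw [smul_eq_mul, mul_assoc]
    exact Ideal.mul_mem_left _ _ (ha x hx)

/-- A smooth cubic surface `X ⊂ ℙ³`: an irreducible homogeneous cubic form with
no singular zero (Jacobian criterion). -/
structure SmoothCubicSurface (k : Type) [Field k] : Type where
  f : MvPolynomial (Fin 4) k
  homog : f.IsHomogeneous 3
  irred : Irreducible f
  smooth : ∀ v : Fin 4 → k, v ≠ 0 → eval v f = 0 →
    ∃ i : Fin 4, eval v (pderiv i f) ≠ 0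

/-- A configuration of `t` distinct points lying on `X`. -/
def ConfigOn (S : SmoothCubicSurface k) {t : ℕ} (Z : Fin t → P3 k) : Prop :=
  Function.Injective Z ∧ ∀ i, VanishesAt k S.f (Z i)

/-- A configuration avoids the (closed locus of the) polynomial `g` on the
product of the affine cones: some choice of representatives does not annihilate `g`. -/
def Avoids {t : ℕ} (g : MvPolynomial (Fin t × Fin 4) k) (Z : Fin t → P3 k) : Prop :=
  ∃ v : Fin t → Fin 4 → k,
    (∀ i, ∃ hv : v i ≠ 0, Projectivization.mk k (v i) hv = Z i) ∧
    eval (fun q : Fin t × Fin 4 => v q.1 q.2) g ≠ 0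

/-- `P` holds for a *general* set of `t` points on `X`: it holds on a nonempty
(basic) Zariski-open subset of the family of all sets of `t` points of `X`. -/
def GeneralPointsSatisfy (S : SmoothCubicSurface k) (t : ℕ)
    (P : (Fin t → P3 k) → Prop) : Prop :=
  ∃ g : MvPolynomial (Fin t × Fin 4) k,
    (∃ Z : Fin t → P3 k, ConfigOn k S Z ∧ Avoids k g Z) ∧
    (∀ Z : Fin t → P3 k, ConfigOn k S Z → Avoids k g Z → P Z)

/-- An admissible entry of a matrix in a graded **minimal** free resolution,
mapping a generator of degree `d` into a generator of degree `e`: the entry is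
homogeneous of degree `d - e`, and it is not a nonzero scalar (zero constant
coefficient). -/
def EntryOk (d e : ℕ) (q : R4 k) : Prop :=
  (q = 0 ∨ ∃ c : ℕ, d = e + c ∧ q.IsHomogeneous c) ∧ coeff 0 q = 0

/-- Integer-degree version of `EntryOk` (for modules with generators of
arbitrary integer degrees). -/
def EntryOkZ (d e : ℤ) (q : R4 k) : Prop :=
  (q = 0 ∨ ∃ c : ℕ, d = e + (c : ℤ) ∧ q.IsHomogeneous c) ∧ coeff 0 q = 0

/-- The body of a graded minimal free resolution of length 2 over `R` of the
`R`-module `I/J`: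
`0 → ⊕ R(-d2 i) --M2--> ⊕ R(-d1 j) --g--> I/J → 0`.
The generators `g j ∈ I` are homogeneous of degree `d1 j` and generate `I` mod `J`;
`M2` is a homogeneous matrix with no nonzero scalar entries whose rows generate the
kernel, and which is injective. -/
def Res2Body (J I : Ideal (R4 k)) {n1 n2 : ℕ}
    (d1 : Fin n1 → ℕ) (d2 : Fin n2 → ℕ)
    (g : Fin n1 → R4 k) (M2 : Fin n2 → Fin n1 → R4 k) : Prop :=
  (∀ j, g j ∈ I ∧ (g j).IsHomogeneous (d1 j)) ∧
  (∀ x ∈ I, ∃ w : Fin n1 → R4 k, x - ∑ j, w j * g j ∈ J) ∧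
  (∀ i j, EntryOk k (d2 i) (d1 j) (M2 i j)) ∧
  (∀ w : Fin n1 → R4 k,
    ((∑ j, w j * g j) ∈ J) ↔ ∃ u : Fin n2 → R4 k, ∀ j, w j = ∑ i, u i * M2 i j) ∧
  (∀ u : Fin n2 → R4 k, (∀ j, (∑ i, u i * M2 i j) = 0) → u = 0)

/-- `I/J` has a graded minimal free resolution
`0 → ⊕ R(-d2 i) → ⊕ R(-d1 j) → I/J → 0` over `R`. -/
def HasMinFreeRes2 (J I : Ideal (R4 k)) {n1 n2 : ℕ}
    (d1 : Fin n1 → ℕ) (d2 : Fin n2 → ℕ) : Prop :=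
  ∃ (g : Fin n1 → R4 k) (M2 : Fin n2 → Fin n1 → R4 k), Res2Body k J I d1 d2 g M2

/-- The body of a graded minimal free resolution of length 3 over `R` of the
`R`-module `I/J`:
`0 → ⊕ R(-d3 l) --M3--> ⊕ R(-d2 i) --M2--> ⊕ R(-d1 j) --g--> I/J → 0`. -/
def Res3Body (J I : Ideal (R4 k)) {n1 n2 n3 : ℕ}
    (d1 : Fin n1 → ℕ) (d2 : Fin n2 → ℕ) (d3 : Fin n3 → ℕ)
    (g : Fin n1 → R4 k) (M2 : Fin n2 → Fin n1 → R4 k)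
    (M3 : Fin n3 → Fin n2 → R4 k) : Prop :=
  (∀ j, g j ∈ I ∧ (g j).IsHomogeneous (d1 j)) ∧
  (∀ x ∈ I, ∃ w : Fin n1 → R4 k, x - ∑ j, w j * g j ∈ J) ∧
  (∀ i j, EntryOk k (d2 i) (d1 j) (M2 i j)) ∧
  (∀ i j, EntryOk k (d3 i) (d2 j) (M3 i j)) ∧
  (∀ w : Fin n1 → R4 k,
    ((∑ j, w j * g j) ∈ J) ↔ ∃ u : Fin n2 → R4 k, ∀ j, w j = ∑ i, u i * M2 i j) ∧
  (∀ u : Fin n2 → R4 k,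
    (∀ j, (∑ i, u i * M2 i j) = 0) ↔ ∃ t : Fin n3 → R4 k, ∀ i, u i = ∑ l, t l * M3 l i) ∧
  (∀ t : Fin n3 → R4 k, (∀ i, (∑ l, t l * M3 l i) = 0) → t = 0)

/-- `I/J` has a graded minimal free resolution
`0 → ⊕ R(-d3 l) → ⊕ R(-d2 i) → ⊕ R(-d1 j) → I/J → 0` over `R`.
Taking `J = ⊥` this is a resolution of the ideal `I ⊆ R`; taking `J = (f)` it is a
resolution of `I/(f) ⊆ R_X = R/(f)`; taking `J = I_C` a resolution of `I/I_C`. -/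
def HasMinFreeRes3 (J I : Ideal (R4 k)) {n1 n2 n3 : ℕ}
    (d1 : Fin n1 → ℕ) (d2 : Fin n2 → ℕ) (d3 : Fin n3 → ℕ) : Prop :=
  ∃ (g : Fin n1 → R4 k) (M2 : Fin n2 → Fin n1 → R4 k) (M3 : Fin n3 → Fin n2 → R4 k),
    Res3Body k J I d1 d2 d3 g M2 M3

/-- The Betti numbers read off from a minimal free resolution
`0 → F₃ → F₂ → F₁ → I_Z → 0` of the ideal of `Z` (so that
`F_i = ⊕_j R(-i-j)^{b_{i,j}}` in the resolution of `R/I_Z`, with `F₀ = R`). -/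
def bettiCount {n1 n2 n3 : ℕ} (d1 : Fin n1 → ℕ) (d2 : Fin n2 → ℕ) (d3 : Fin n3 → ℕ)
    (i j : ℕ) : ℕ :=
  if i = 0 then (if j = 0 then 1 else 0)
  else if i = 1 then (Finset.univ.filter fun l => d1 l = 1 + j).card
  else if i = 2 then (Finset.univ.filter fun l => d2 l = 2 + j).card
  else if i = 3 then (Finset.univ.filter fun l => d3 l = 3 + j).card
  else 0

/-- The Hilbert polynomial `P_X(t) = (3/2)t(t+1) + 1` of the cubic surface. -/
def PXcubic (t : ℕ) : ℕ := 3 * (t * (t + 1) / 2) + 1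

/-- The saturated homogeneous ideal of an integral curve lying on `X`. -/
def IsCurveIdealOn (S : SmoothCubicSurface k) (I : Ideal (R4 k)) : Prop :=
  IsHomogIdeal k I ∧ I.IsPrime ∧ S.f ∈ I ∧
    ringKrullDim (R4 k ⧸ I) = ((2 : ℕ∞) : WithBot ℕ∞)

/-- The Jacobian criterion at a point of the cone: some 2×2 minor of the Jacobian
matrix of elements of `I` is nonzero, i.e. the curve is smooth there. -/
def CurveSmoothAt (I : Ideal (R4 k)) (v : Fin 4 → k) : Prop :=
  ∃ g₁ ∈ I, ∃ g₂ ∈ I, ∃ i j : Fin 4,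
    eval v (pderiv i g₁) * eval v (pderiv j g₂)
      - eval v (pderiv j g₁) * eval v (pderiv i g₂) ≠ 0

/-- A smooth (integral) curve on `X`. -/
def IsSmoothCurveIdealOn (S : SmoothCubicSurface k) (I : Ideal (R4 k)) : Prop :=
  IsCurveIdealOn k S I ∧
  ∀ v : Fin 4 → k, v ≠ 0 → (∀ g ∈ I, eval v g = 0) → CurveSmoothAt k I v

/-- The coordinate ring `R/I` of a curve has depth 2 (a regular sequence of two
positive-degree homogeneous elements), i.e. the curve is arithmetically
Cohen–Macaulay. -/
def IsACMIdeal (I : Ideal (R4 k)) : Prop :=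
  ∃ r₁ r₂ : R4 k,
    (∃ d₁ : ℕ, 0 < d₁ ∧ r₁.IsHomogeneous d₁) ∧
    (∃ d₂ : ℕ, 0 < d₂ ∧ r₂.IsHomogeneous d₂) ∧
    (∀ x : R4 k, r₁ * x ∈ I → x ∈ I) ∧
    (∀ x : R4 k, r₂ * x ∈ I ⊔ Ideal.span {r₁} → x ∈ I ⊔ Ideal.span {r₁})

/-- The Hilbert function `t ↦ dim_k (R/I)_t`. -/
def hilbFn (I : Ideal (R4 k)) (t : ℕ) : ℕ :=
  Module.finrank k ↥(homogeneousSubmodule (Fin 4) k t) -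
    Module.finrank k ↥(homogeneousSubmodule (Fin 4) k t ⊓
      Submodule.restrictScalars k I)

/-- The subscheme with saturated ideal `I` has degree `d` and (arithmetic) genus `g`,
read off from the Hilbert polynomial `P(t) = d·t + 1 - g`. -/
def HasDegreeGenus (I : Ideal (R4 k)) (d : ℕ) (g : ℤ) : Prop :=
  ∃ N : ℕ, ∀ t : ℕ, N ≤ t → (hilbFn k I t : ℤ) = d * t + 1 - g

/-- Linear equivalence of divisors on `X`: the divisor with (divisorial) ideal `I`
is linearly equivalent to (divisor of `J`) + `a·H`, where `H` is the hyperplane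
class.  Concretely, there are homogeneous forms `q, p` with `deg p = deg q + a`,
nonzero on `X`, with `q·I = p·J` in `R_X = R/(f)`.  (Taking `J = ⊤` expresses
that the divisor of `I` is linearly equivalent to `aH`.) -/
def LinEquivOnX (S : SmoothCubicSurface k) (I J : Ideal (R4 k)) (a : ℤ) : Prop :=
  ∃ (mq mp : ℕ) (q p : R4 k), (mp : ℤ) = (mq : ℤ) + a ∧
    q.IsHomogeneous mq ∧ p.IsHomogeneous mp ∧
    q ∉ Ideal.span {S.f} ∧ p ∉ Ideal.span {S.f} ∧
    Ideal.span {q} * I ⊔ Ideal.span {S.f} = Ideal.span {p} * J ⊔ Ideal.span {S.f}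

/-- Linear equivalence, on the curve `C` with ideal `IC`, of the divisor with
ideal `IG` to `r·H_C` (`H_C` the hyperplane section of `C`): there are homogeneous
forms `q, p`, nonzero on `C`, with `deg p = deg q + r` and `q·I_{G,C} = (p)` in
`R/I_C`. -/
def DivOnCurveEquivH (IC IG : Ideal (R4 k)) (r : ℤ) : Prop :=
  ∃ (mq mp : ℕ) (q p : R4 k), (mp : ℤ) = (mq : ℤ) + r ∧
    q.IsHomogeneous mq ∧ p.IsHomogeneous mp ∧ q ∉ IC ∧ p ∉ IC ∧
    Ideal.span {q} * IG ⊔ IC = Ideal.span {p} ⊔ IC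

/-- The saturated homogeneous ideal of a zero-dimensional subscheme of `ℙ³`. -/
def IsZeroDimIdeal (I : Ideal (R4 k)) : Prop :=
  IsHomogIdeal k I ∧ satIdeal k I = I ∧
    ringKrullDim (R4 k ⧸ I) = ((1 : ℕ∞) : WithBot ℕ∞)

/-- An arithmetically Gorenstein zero-dimensional subscheme of `ℙ³`: its ideal has a
graded minimal free resolution of length 3 whose last free module has rank one. -/
def IsAGPointsIdeal (I : Ideal (R4 k)) : Prop :=
  IsZeroDimIdeal k I ∧
  ∃ (n1 n2 : ℕ) (d1 : Fin n1 → ℕ) (d2 : Fin n2 → ℕ) (s : ℕ),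
    HasMinFreeRes3 k ⊥ I d1 d2 (fun _ : Fin 1 => s)

/-- `V₁` and `V₂` are directly Gorenstein linked by the arithmetically Gorenstein
scheme with ideal `IG`: `I_G ⊆ I_{V₁} ∩ I_{V₂}`, `I_G : I_{V₁} = I_{V₂}` and
`I_G : I_{V₂} = I_{V₁}`. -/
def IsGLinked (IG I1 I2 : Ideal (R4 k)) : Prop :=
  IG ≤ I1 ⊓ I2 ∧ icolon k IG I1 = I2 ∧ icolon k IG I2 = I1

/-- The divisor `G` (with ideal `IG`) on the curve `C ⊂ X` (with ideal `IC`) is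
linearly equivalent to `m·H_C - K_C`.  By adjunction on the cubic surface
(`K_X = -H`) this says `G + C|_C ∼ (m+1)·H_C` on `C`, where `C|_C` is realized as
the scheme-theoretic intersection `C ∩ C'` with any curve `C' ∼ C`, `C' ≠ C`,
chosen disjoint from `G`. -/
def EquivHminusKC (S : SmoothCubicSurface k) (IC IG : Ideal (R4 k)) (m : ℤ) : Prop :=
  ∃ IC' : Ideal (R4 k), IsCurveIdealOn k S IC' ∧ IC' ≠ IC ∧
    LinEquivOnX k S IC' IC 0 ∧
    satIdeal k (satIdeal k (IC ⊔ IC') ⊔ IG) = ⊤ ∧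
    DivOnCurveEquivH k IC (IG ⊓ satIdeal k (IC ⊔ IC')) (m + 1)

/-- A line on `X`: a smooth integral curve of degree 1, genus 0 on `X`. -/
def IsLineOn (S : SmoothCubicSurface k) (I : Ideal (R4 k)) : Prop :=
  IsSmoothCurveIdealOn k S I ∧ HasDegreeGenus k I 1 0

/-- A smooth conic on `X`: a smooth integral curve of degree 2, genus 0 on `X`. -/
def IsConicOn (S : SmoothCubicSurface k) (I : Ideal (R4 k)) : Prop :=
  IsSmoothCurveIdealOn k S I ∧ HasDegreeGenus k I 2 0

/-- A twisted cubic on `X`: a smooth integral curve of degree 3, genus 0 on `X`. -/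
def IsTwistedCubicOn (S : SmoothCubicSurface k) (I : Ideal (R4 k)) : Prop :=
  IsSmoothCurveIdealOn k S I ∧ HasDegreeGenus k I 3 0

/-- The curve `C ⊂ X` moves in a linear system of (projective) dimension `dim`,
i.e. `h⁰(O_X(C)) = dim + 1`.  Global sections of `O_X(C)` are computed, for any
homogeneous `q ∈ I_C` of degree `s` not divisible by `f`, as the degree-`s` part of
the colon ideal `((q, f) : I_C)` modulo `(f)`. -/
def MovesInLinSysOfDim (S : SmoothCubicSurface k) (IC : Ideal (R4 k)) (dim : ℤ) : Prop :=
  ∀ (s : ℕ) (q : R4 k), q.IsHomogeneous s → q ∈ IC → q ∉ Ideal.span {S.f} →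
    (Module.finrank k ↥(homogeneousSubmodule (Fin 4) k s ⊓
        Submodule.restrictScalars k (icolon k (Ideal.span {q} ⊔ Ideal.span {S.f}) IC)) : ℤ)
      - (Module.finrank k ↥(homogeneousSubmodule (Fin 4) k s ⊓
        Submodule.restrictScalars k (icolon k (Ideal.span {q} ⊔ Ideal.span {S.f}) IC) ⊓
        Submodule.restrictScalars k (Ideal.span {S.f})) : ℤ) = dim + 1

/-- `I/(f₀)` is a maximal Cohen–Macaulay module over `R/(f₀)` (3-dimensional):
it admits a regular sequence of three positive-degree homogeneous elements. -/
def IsMCMQuotient (f0 : R4 k) (I : Ideal (R4 k)) : Prop :=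
  ∃ r₁ r₂ r₃ : R4 k,
    (∃ d : ℕ, 0 < d ∧ r₁.IsHomogeneous d) ∧
    (∃ d : ℕ, 0 < d ∧ r₂.IsHomogeneous d) ∧
    (∃ d : ℕ, 0 < d ∧ r₃.IsHomogeneous d) ∧
    (∀ x ∈ I, r₁ * x ∈ Ideal.span {f0} → x ∈ Ideal.span {f0}) ∧
    (∀ x ∈ I, r₂ * x ∈ Ideal.span {r₁} * I ⊔ Ideal.span {f0} →
      x ∈ Ideal.span {r₁} * I ⊔ Ideal.span {f0}) ∧
    (∀ x ∈ I, r₃ * x ∈ Ideal.span {r₁} * I ⊔ Ideal.span {r₂} * I ⊔ Ideal.span {f0} →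
      x ∈ Ideal.span {r₁} * I ⊔ Ideal.span {r₂} * I ⊔ Ideal.span {f0}) ∧
    (∃ x ∈ I, x ∉ Ideal.span {r₁} * I ⊔ Ideal.span {r₂} * I ⊔ Ideal.span {r₃} * I
      ⊔ Ideal.span {f0})

end

namespace MRC

section Basic

variable {k : Type} [Field k]

theorem sub_algHom_mem {σ : Type*} {I : Ideal (MvPolynomial σ k)}
    (θ : MvPolynomial σ k →ₐ[k] MvPolynomial σ k) (h : ∀ i, X i - θ (X i) ∈ I)
    (g : MvPolynomial σ k) : g - θ g ∈ I := by
  have : Ideal.Quotient.mkₐ k I = (Ideal.Quotient.mkₐ k I).comp θ := by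
    ext i
    simpa using (Ideal.Quotient.eq (I := I)).2 (h i)
  have h2 := DFunLike.congr_fun this g
  exact (Ideal.Quotient.eq (I := I)).1 (by simpa using h2)

theorem homogComp_mul {l : R4 k} {d : ℕ} (hl : l.IsHomogeneous d) (n : ℕ) (h : R4 k) :
    homogeneousComponent (n + d) (l * h) = l * homogeneousComponent n h := by
  let _ : GradedAlgebra (homogeneousSubmodule (Fin 4) k) := MvPolynomial.gradedAlgebra
  have := DirectSum.coe_decompose_mul_of_left_mem_of_le (homogeneousSubmodule (Fin 4) k) (a := l)
    (b := h) (n := n + d) (i := d) ((mem_homogeneousSubmodule d l).2 hl) (Nat.le_add_left _ _)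
  rw [Nat.add_sub_cancel] at this
  have e := fun (φ : R4 k) i => decomposition.decompose'_apply (σ := Fin 4) (R := k) φ i
  erw [e, e] at this
  exact this

theorem homogComp_mul_of_lt {l : R4 k} {d n : ℕ} (hl : l.IsHomogeneous d) (hn : n < d) (h : R4 k) :
    homogeneousComponent n (l * h) = 0 := by
  let _ : GradedAlgebra (homogeneousSubmodule (Fin 4) k) := MvPolynomial.gradedAlgebra
  have := DirectSum.coe_decompose_mul_of_left_mem_of_not_le (homogeneousSubmodule (Fin 4) k)
    (a := l) (b := h) (n := n) (i := d) ((mem_homogeneousSubmodule d l).2 hl) (not_le.2 hn)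
  have e := fun (φ : R4 k) i => decomposition.decompose'_apply (σ := Fin 4) (R := k) φ i
  erw [e] at this
  exact this

theorem homogComp_mem_span {s : Set (R4 k)} (hs : ∀ x ∈ s, ∃ d : ℕ, x.IsHomogeneous d) {p : R4 k}
    (hp : p ∈ Ideal.span s) (n : ℕ) : homogeneousComponent n p ∈ Ideal.span s := by
  let _ : GradedAlgebra (homogeneousSubmodule (Fin 4) k) := MvPolynomial.gradedAlgebra
  refine homogeneousComponent_mem_of_mem (Ideal.homogeneous_span _ _ fun x hx => ?_) hp n
  obtain ⟨d, hd⟩ := hs x hx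
  exact ⟨d, (mem_homogeneousSubmodule d x).2 hd⟩

theorem exists_eq_C_add (g : R4 k) :
    ∃ q : Fin 4 → R4 k, g = C (coeff 0 g) + ∑ i, X i * q i := by
  induction g using MvPolynomial.induction_on with
  | C a => exact ⟨0, by simp⟩
  | add p q hp hq =>
    obtain ⟨u, hu⟩ := hp
    obtain ⟨w, hw⟩ := hq
    refine ⟨u + w, ?_⟩
    conv_lhs => rw [hu, hw]
    simp only [coeff_add, C_add, Pi.add_apply, mul_add, Finset.sum_add_distrib]
    ring
  | mul_X p i _ =>
    refine ⟨Pi.single i p, ?_⟩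
    have : coeff 0 (p * X i) = 0 := by
      rw [← constantCoeff_eq, map_mul, constantCoeff_X, mul_zero]
    rw [this, Finset.sum_eq_single i (by intro j _ hj; simp [hj]) (by simp)]
    simp [mul_comm]

theorem homog_succ_decomp {n : ℕ} {g : R4 k} (hg : g.IsHomogeneous (n + 1)) :
    ∃ q : Fin 4 → R4 k, (∀ i, (q i).IsHomogeneous n) ∧ g = ∑ i, X i * q i := by
  obtain ⟨q, hq⟩ := exists_eq_C_add g
  refine ⟨fun i => homogeneousComponent n (q i), fun i => homogeneousComponent_isHomogeneous _ _,
    ?_⟩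
  have h1 := homogeneousComponent_eq_self hg
  rw [hq, map_add, map_sum] at h1
  rw [hq, ← h1]
  rw [homogeneousComponent_of_mem (m := n + 1) (n := 0) (isHomogeneous_C _ _)]
  simp only [Nat.succ_ne_zero, if_false, zero_add]
  exact Finset.sum_congr rfl fun i _ => homogComp_mul (isHomogeneous_X _ _) n (q i)

theorem homog_zero {g : R4 k} (hg : g.IsHomogeneous 0) : ∃ c : k, g = C c :=
  ⟨coeff 0 g, (totalDegree_eq_zero_iff_eq_C).1 ((totalDegree_zero_iff_isHomogeneous _).2 hg)⟩

theorem homog_one_form {g : R4 k} (hg : g.IsHomogeneous 1) :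
    ∃ c : Fin 4 → k, g = ∑ i, X i * C (c i) := by
  obtain ⟨q, hq, rfl⟩ := homog_succ_decomp (n := 0) hg
  choose c hc using fun i => homog_zero (hq i)
  exact ⟨c, by simp only [← hc]⟩

theorem homog_two_form {g : R4 k} (hg : g.IsHomogeneous 2) :
    ∃ c : Fin 4 → Fin 4 → k, g = ∑ i, ∑ j, X i * (X j * C (c i j)) := by
  obtain ⟨q, hq, rfl⟩ := homog_succ_decomp (n := 1) hg
  choose c hc using fun i => homog_one_form (hq i)
  exact ⟨c, by simp only [← Finset.mul_sum, ← hc]⟩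

theorem homog_three_form {g : R4 k} (hg : g.IsHomogeneous 3) :
    ∃ c : Fin 4 → Fin 4 → Fin 4 → k, g = ∑ i, ∑ j, ∑ l, X i * (X j * (X l * C (c i j l))) := by
  obtain ⟨q, hq, rfl⟩ := homog_succ_decomp (n := 2) hg
  choose c hc using fun i => homog_two_form (hq i)
  refine ⟨c, Finset.sum_congr rfl fun i _ => ?_⟩
  rw [hc i]
  simp only [Finset.mul_sum]

theorem eval_smul_homog {g : R4 k} {n : ℕ} (hg : g.IsHomogeneous n) (t : k) (v : Fin 4 → k) :
    eval (t • v) g = t ^ n * eval v g := by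
  induction n generalizing g with
  | zero => obtain ⟨c, rfl⟩ := homog_zero hg; simp
  | succ n ih =>
    obtain ⟨q, hq, rfl⟩ := homog_succ_decomp hg
    simp only [map_sum, map_mul, eval_X, ih (hq _), Pi.smul_apply, smul_eq_mul, Finset.mul_sum]
    exact Finset.sum_congr rfl fun i _ => by ring

theorem mul_homog_of_eq {f p g : R4 k} {d n : ℕ} (hf : f.IsHomogeneous d)
    (hg : g.IsHomogeneous (n + d)) (h : g = f * p) : ∃ q : R4 k, q.IsHomogeneous n ∧ g = f * q :=
  ⟨homogeneousComponent n p, homogeneousComponent_isHomogeneous _ _, by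
    rw [← homogComp_mul hf, ← h, homogeneousComponent_eq_self hg]⟩

theorem eq_zero_of_mul_homog {f p g : R4 k} {d n : ℕ} (hf : f.IsHomogeneous d)
    (hg : g.IsHomogeneous n) (hn : n < d) (h : g = f * p) : g = 0 := by
  rw [← homogeneousComponent_eq_self hg, h, homogComp_mul_of_lt hf hn]

theorem mem_span_homog {f g : R4 k} {d n : ℕ} (hf : f.IsHomogeneous d)
    (hg : g.IsHomogeneous (n + d)) (h : g ∈ Ideal.span {f}) :
    ∃ q : R4 k, q.IsHomogeneous n ∧ g = f * q := by
  obtain ⟨p, hp⟩ := Ideal.mem_span_singleton.1 h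
  exact mul_homog_of_eq hf hg hp

theorem eq_zero_of_mem_span_homog {f g : R4 k} {d n : ℕ} (hf : f.IsHomogeneous d)
    (hg : g.IsHomogeneous n) (hn : n < d) (h : g ∈ Ideal.span {f}) : g = 0 := by
  obtain ⟨p, hp⟩ := Ideal.mem_span_singleton.1 h
  exact eq_zero_of_mul_homog hf hg hn hp

theorem not_mem_span_of_lt {f g : R4 k} {d n : ℕ} (hf : f.IsHomogeneous d)
    (hg : g.IsHomogeneous n) (hn : n < d) (h0 : g ≠ 0) : g ∉ Ideal.span {f} :=
  fun h => h0 (eq_zero_of_mem_span_homog hf hg hn h)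

theorem prime_span {f : R4 k} (hf : Irreducible f) : (Ideal.span {f}).IsPrime :=
  (Ideal.span_singleton_prime hf.ne_zero).2 hf.prime

theorem exists_point [IsAlgClosed k] {f h : R4 k} (hf : Irreducible f) (hh : h ∉ Ideal.span {f}) :
    ∃ v : Fin 4 → k, eval v f = 0 ∧ eval v h ≠ 0 := by
  have := prime_span hf
  rw [← IsPrime.vanishingIdeal_zeroLocus (K := k) (Ideal.span {f}), mem_vanishingIdeal_iff] at hh
  push Not at hh
  obtain ⟨v, hv, hv2⟩ := hh
  refine ⟨v, ?_, by simpa [aeval_eq_eval] using hv2⟩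
  simpa [aeval_eq_eval] using mem_zeroLocus_iff.1 hv f (Ideal.mem_span_singleton_self f)

/-- Functions on a coordinate space given by a polynomial. -/
def PolyFun {σ : Type*} (F : (σ → k) → k) : Prop :=
  ∃ P : MvPolynomial σ k, ∀ x, eval x P = F x

namespace PolyFun

variable {σ : Type*} {F G : (σ → k) → k}

theorem const (c : k) : PolyFun (fun _ : σ → k => c) := ⟨C c, by simp⟩

theorem coord (i : σ) : PolyFun (fun x : σ → k => x i) := ⟨X i, by simp⟩

theorem add (hF : PolyFun F) (hG : PolyFun G) : PolyFun (fun x => F x + G x) := by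
  obtain ⟨P, hP⟩ := hF
  obtain ⟨Q, hQ⟩ := hG
  exact ⟨P + Q, by simp [hP, hQ]⟩

theorem mul (hF : PolyFun F) (hG : PolyFun G) : PolyFun (fun x => F x * G x) := by
  obtain ⟨P, hP⟩ := hF
  obtain ⟨Q, hQ⟩ := hG
  exact ⟨P * Q, by simp [hP, hQ]⟩

theorem sub (hF : PolyFun F) (hG : PolyFun G) : PolyFun (fun x => F x - G x) := by
  obtain ⟨P, hP⟩ := hF
  obtain ⟨Q, hQ⟩ := hG
  exact ⟨P - Q, by simp [hP, hQ]⟩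

theorem pow (hF : PolyFun F) (n : ℕ) : PolyFun (fun x => F x ^ n) := by
  obtain ⟨P, hP⟩ := hF
  exact ⟨P ^ n, by simp [hP]⟩

theorem sum {ι : Type*} (s : Finset ι) {F : ι → (σ → k) → k} (h : ∀ i, PolyFun (F i)) :
    PolyFun (fun x => ∑ i ∈ s, F i x) := by
  choose P hP using h
  exact ⟨∑ i ∈ s, P i, by simp [hP]⟩

theorem prod {ι : Type*} (s : Finset ι) {F : ι → (σ → k) → k} (h : ∀ i, PolyFun (F i)) :
    PolyFun (fun x => ∏ i ∈ s, F i x) := by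
  choose P hP using h
  exact ⟨∏ i ∈ s, P i, by simp [hP]⟩

theorem eval {τ : Type*} (g : MvPolynomial τ k) {u : (σ → k) → τ → k}
    (hu : ∀ i, PolyFun (fun x => u x i)) : PolyFun (fun x => MvPolynomial.eval (u x) g) := by
  choose P hP using hu
  refine ⟨aeval P g, fun x => ?_⟩
  change ∀ i x, MvPolynomial.eval x (P i) = u x i at hP
  change MvPolynomial.eval x (aeval P g) = MvPolynomial.eval (u x) g
  induction g using MvPolynomial.induction_on with
  | C a => simp
  | add p q hp hq => rw [map_add, map_add, hp, hq, map_add]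
  | mul_X p i hp => rw [map_mul, map_mul, hp, aeval_X, hP, map_mul, eval_X]

theorem det {n : ℕ} {M : (σ → k) → Matrix (Fin n) (Fin n) k}
    (h : ∀ i j, PolyFun (fun x => M x i j)) : PolyFun (fun x => (M x).det) := by
  simp only [Matrix.det_apply']
  exact sum _ fun p => mul (const _) (prod _ fun i => h _ _)

theorem exists_ne_zero [Infinite k] {ι : Type*} (s : Finset ι) {F : ι → (σ → k) → k}
    (h : ∀ i ∈ s, PolyFun (F i)) (h0 : ∀ i ∈ s, ∃ x, F i x ≠ 0) : ∃ x, ∀ i ∈ s, F i x ≠ 0 := by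
  classical
  choose! P hP using h
  have : ∏ i ∈ s, P i ≠ 0 := Finset.prod_ne_zero_iff.2 fun i hi h => by
    obtain ⟨x, hx⟩ := h0 i hi
    exact hx (by rw [← hP i hi, h, map_zero])
  obtain ⟨x, hx⟩ : ∃ x, MvPolynomial.eval x (∏ i ∈ s, P i) ≠ 0 := by
    by_contra! hx
    exact this (MvPolynomial.funext fun x => by rw [hx, map_zero])
  exact ⟨x, fun i hi => by
    rw [← hP i hi]; rw [eval_prod] at hx; exact Finset.prod_ne_zero_iff.1 hx i hi⟩

end PolyFun

end Basic

section Lines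

variable {k : Type} [Field k]

theorem eval_aeval' {σ τ : Type*} (x : σ → k) (P : τ → MvPolynomial σ k) (g : MvPolynomial τ k) :
    eval x (aeval P g) = eval (fun i => eval x (P i)) g := by
  induction g using MvPolynomial.induction_on with
  | C a => simp
  | add p q hp hq => rw [map_add, map_add, hp, hq, map_add]
  | mul_X p i hp => rw [map_mul, map_mul, hp, aeval_X, map_mul, eval_X]

/-- The mixed term of the restriction of a cubic form to the line through two points. -/
noncomputable def lineB (f : R4 k) (u w : Fin 4 → k) : k := ∑ i, w i * eval u (pderiv i f)

/-- The restriction of a cubic form to the line through two points. -/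
noncomputable def lineCubic (f : R4 k) (u w : Fin 4 → k) : Cubic k :=
  ⟨eval u f, lineB f u w, lineB f w u, eval w f⟩

theorem eval_line {f : R4 k} (hf : f.IsHomogeneous 3) (u w : Fin 4 → k) (s t : k) :
    eval (s • u + t • w) f = eval u f * s ^ 3 + lineB f u w * s ^ 2 * t
      + lineB f w u * s * t ^ 2 + eval w f * t ^ 3 := by
  classical
  obtain ⟨c, rfl⟩ := homog_three_form hf
  have key : ∀ (u w : Fin 4 → k) a b l (z : k),
      lineB (X a * (X b * (X l * C z))) u w = (w a * u b * u l + u a * w b * u l + u a * u b * w l) * z := by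
    intro u w a b l z
    simp only [lineB, Derivation.leibniz, pderiv_X, pderiv_C, smul_eq_mul, map_add, map_mul, eval_X,
      eval_C, mul_zero, zero_add, Pi.single_apply, mul_add, Finset.sum_add_distrib]
    simp only [apply_ite (eval u), map_one, map_zero, mul_ite, mul_one, mul_zero,
      Finset.sum_ite_eq, Finset.mem_univ, if_true]
    ring
  have hB : ∀ u w : Fin 4 → k, lineB (∑ i, ∑ j, ∑ l, X i * (X j * (X l * C (c i j l)))) u w
      = ∑ i, ∑ j, ∑ l, (w i * u j * u l + u i * w j * u l + u i * u j * w l) * c i j l := by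
    intro u w
    have hadd : ∀ p q : R4 k, lineB (p + q) u w = lineB p u w + lineB q u w := by
      intro p q; simp [lineB, mul_add, Finset.sum_add_distrib]
    let φ : R4 k →+ k := AddMonoidHom.mk' (fun p => lineB p u w) hadd
    have : ∀ p, lineB p u w = φ p := fun p => rfl
    rw [this]
    simp only [map_sum]
    simp only [← this, key]
  rw [hB, hB]
  simp only [map_sum, map_mul, eval_X, eval_C, Finset.sum_mul, ← Finset.sum_add_distrib]
  refine Finset.sum_congr rfl fun i _ => Finset.sum_congr rfl fun j _ =>
    Finset.sum_congr rfl fun l _ => ?_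
  simp only [Pi.add_apply, Pi.smul_apply, smul_eq_mul]
  ring

theorem exists_line_roots [IsAlgClosed k] {f : R4 k} (hf : f.IsHomogeneous 3) {u w : Fin 4 → k}
    (hu : eval u f ≠ 0) (hd : (lineCubic f u w).discr ≠ 0) :
    ∃ ρ : Fin 3 → k, Function.Injective ρ ∧
      ∀ s t, eval (s • u + t • w) f = eval u f * ∏ i, (s - ρ i * t) := by
  have ha : (lineCubic f u w).a ≠ 0 := hu
  obtain ⟨x, y, z, h3⟩ := (Cubic.splits_iff_roots_eq_three (φ := RingHom.id k) ha).1
    (IsAlgClosed.splits _)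
  obtain ⟨h1, h2, h4⟩ := (Cubic.discr_ne_zero_iff_roots_ne ha h3).1 hd
  refine ⟨![x, y, z], ?_, fun s t => ?_⟩
  · intro i j hij
    fin_cases i <;> fin_cases j <;> simp_all [eq_comm]
  · have hb := Cubic.b_eq_three_roots ha h3
    have hc := Cubic.c_eq_three_roots ha h3
    have hd := Cubic.d_eq_three_roots ha h3
    simp only [lineCubic, RingHom.id_apply] at hb hc hd
    rw [eval_line hf, hb, hc, hd]
    simp only [Fin.prod_univ_three, Matrix.cons_val]
    ring

theorem PolyFun.lineB {σ : Type*} (f : R4 k) {u w : (σ → k) → Fin 4 → k}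
    (hu : ∀ i, PolyFun fun x => u x i) (hw : ∀ i, PolyFun fun x => w x i) :
    PolyFun fun x => lineB f (u x) (w x) :=
  PolyFun.sum _ fun i => (hw i).mul (PolyFun.eval _ hu)

theorem PolyFun.lineDiscr {σ : Type*} (f : R4 k) {u w : (σ → k) → Fin 4 → k}
    (hu : ∀ i, PolyFun fun x => u x i) (hw : ∀ i, PolyFun fun x => w x i) :
    PolyFun fun x => (lineCubic f (u x) (w x)).discr := by
  have a := PolyFun.eval f hu
  have b := PolyFun.lineB f hu hw
  have c := PolyFun.lineB f hw hu
  have d := PolyFun.eval f hw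
  simp only [Cubic.discr, lineCubic]
  exact ((((b.pow 2).mul (c.pow 2)).sub (((const 4).mul a).mul (c.pow 3))).sub
    (((const 4).mul (b.pow 3)).mul d) |>.sub (((const 27).mul (a.pow 2)).mul (d.pow 2))).add
    (((((const 18).mul a).mul b).mul c).mul d)

theorem line_mem [Infinite k] {f g : R4 k} {I : Ideal (R4 k)} {u w : Fin 4 → k} {p q : Fin 4}
    (hpq : p ≠ q) {ρ : Fin 3 → k} (hρ : Function.Injective ρ) {c : k} (hc : c ≠ 0)
    (hf : ∀ s t, eval (s • u + t • w) f = c * ∏ i, (s - ρ i * t))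
    (hI : ∀ m, X m - (C (u m) * X p + C (w m) * X q) ∈ I)
    (hg : ∀ (i : Fin 3) (t : k), t ≠ 0 → eval (t • (ρ i • u + w)) g = 0) : g ∈ I ⊔ Ideal.span {f} := by
  set θ : R4 k →ₐ[k] R4 k := aeval fun m => C (u m) * X p + C (w m) * X q with hθ
  let α : k → R4 k →ₐ[k] R4 k := fun r => aeval (Function.update X p (C r * X q))
  have hαp : ∀ r, α r (X p) = C r * X q := fun r => by simp [α]
  have hαq : ∀ r, α r (X q) = X q := fun r => by simp [α, Function.update_of_ne hpq.symm]
  have hdiv : ∀ r h, α r h = 0 → ∃ h', h = (X p - C r * X q) * h' := by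
    intro r h hh
    have := sub_algHom_mem (I := Ideal.span {X p - C r * X q}) (α r) (fun i => ?_) h
    · rw [hh, sub_zero] at this
      exact Ideal.mem_span_singleton.1 this
    · by_cases hi : i = p
      · subst hi; rw [hαp]; exact Ideal.mem_span_singleton_self _
      · simp [α, Function.update_of_ne hi]
  have hX : ∀ r, α r (C r) = C r := fun r => by simp [α]
  have hcancel : ∀ r r' h, r ≠ r' → α r' ((X p - C r * X q) * h) = 0 → α r' h = 0 := by
    intro r r' h hne h0
    have e : α r' (X p - C r * X q) = C (r' - r) * X q := by
      rw [map_sub, map_mul, hαp, hαq]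
      have : α r' (C r) = C r := by simp [α]
      rw [this, C_sub]; ring
    rw [map_mul, e] at h0
    refine (mul_eq_zero.1 h0).resolve_left (mul_ne_zero ?_ (X_ne_zero q))
    rw [Ne, C_eq_zero, sub_eq_zero]
    exact hne.symm
  have hgα : ∀ i, α (ρ i) (θ g) = 0 := by
    intro i
    refine (mul_eq_zero.1 (?_ : X q * α (ρ i) (θ g) = 0)).resolve_left (X_ne_zero q)
    apply MvPolynomial.funext
    intro x
    rw [map_mul, eval_X, map_zero]
    by_cases hx : x q = 0
    · rw [hx, zero_mul]
    rw [eval_aeval', hθ, eval_aeval', mul_eq_zero]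
    right
    rw [← hg i (x q) hx]
    congr 2
    funext m
    simp [Function.update_of_ne hpq.symm]
    ring
  obtain ⟨g1, h1⟩ := hdiv _ _ (hgα 0)
  have h20 := hgα 1
  rw [h1] at h20
  obtain ⟨g2, h2⟩ := hdiv _ _ (hcancel _ _ _ (hρ.ne (by decide)) h20)
  have h30 := hgα 2
  rw [h1] at h30
  have h31 := hcancel _ _ _ (hρ.ne (by decide)) h30
  rw [h2] at h31
  obtain ⟨g3, h3⟩ := hdiv _ _ (hcancel _ _ _ (hρ.ne (by decide)) h31)
  have hθf : θ f = C c * ((X p - C (ρ 0) * X q) * (X p - C (ρ 1) * X q) * (X p - C (ρ 2) * X q)) := by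
    apply MvPolynomial.funext
    intro x
    rw [hθ, eval_aeval']
    have := hf (x p) (x q)
    rw [Fin.prod_univ_three] at this
    simp only [map_mul, map_sub, eval_X, eval_C, map_add]
    rw [← this]
    congr 2
    funext m
    simp [mul_comm]
  have hθg : θ g = C c⁻¹ * g3 * θ f := by
    rw [hθf, h1, h2, h3]
    have : (C c⁻¹ : R4 k) * C c = 1 := by rw [← C_mul, inv_mul_cancel₀ hc, C_1]
    linear_combination (-(X p - C (ρ 0) * X q) * ((X p - C (ρ 1) * X q) * ((X p - C (ρ 2) * X q) * g3))) * this
  have hsub : ∀ h, h - θ h ∈ I := sub_algHom_mem θ fun m => by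
    rw [hθ, aeval_X]; exact hI m
  have : g = (g - θ g) - C c⁻¹ * g3 * (f - θ f) + C c⁻¹ * g3 * f := by rw [hθg]; ring
  rw [this]
  exact Ideal.add_mem _ (Ideal.mem_sup_left (Ideal.sub_mem _ (hsub g) (Ideal.mul_mem_left _ _ (hsub f))))
    (Ideal.mem_sup_right (Ideal.mul_mem_left _ _ (Ideal.mem_span_singleton_self f)))

theorem regular_mod {f l m w A B : R4 k} (ψ : R4 k →ₐ[k] R4 k) (hψ : ∀ g, l ∣ g - ψ g)
    (hl : ψ l = 0) (hl0 : l ≠ 0) (hm : Prime m) (hψm : ψ m = m) (hmf : ¬ m ∣ ψ f)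
    (h : l * w = f * A + m * B) : ∃ A' B', w = f * A' + m * B' := by
  have h1 := congrArg ψ h
  rw [map_mul, hl, zero_mul, map_add, map_mul, map_mul, hψm] at h1
  obtain ⟨A', hA'⟩ : m ∣ ψ A := by
    refine (hm.dvd_or_dvd (a := ψ f) (b := ψ A) ⟨-ψ B, ?_⟩).resolve_left hmf
    linear_combination -h1
  have hB : ψ B = -(ψ f * A') := by
    refine mul_left_cancel₀ hm.ne_zero ?_
    rw [hA'] at h1
    linear_combination -h1
  obtain ⟨A1, hA1⟩ := hψ A
  obtain ⟨B1, hB1⟩ := hψ B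
  obtain ⟨f1, hf1⟩ := hψ f
  refine ⟨A1, f1 * A' + B1, mul_left_cancel₀ hl0 ?_⟩
  rw [h]
  linear_combination f * hA1 + m * hB1 + f * hA' + m * hB + m * A' * hf1

end Lines

section Good

variable {k : Type} [Field k]

/-- Every tuple of forms of degree `s` that satisfies the linear relations `L` modulo `J` and
vanishes on `S` has its entries in `J`. -/
def RelGood {ι κ : Type} (L : (ι → R4 k) →ₗ[R4 k] (κ → R4 k)) (J : Ideal (R4 k)) (s : ℕ)
    (S : Finset (Fin 4 → k)) : Prop :=
  ∀ g : ι → R4 k, (∀ e, (g e).IsHomogeneous s) → (∀ c, L g c ∈ J) →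
    (∀ v ∈ S, ∀ e, eval v (g e) = 0) → ∀ e, g e ∈ J

/-- The coordinate simplex is in general position with respect to the cubic form. -/
structure Frame (f : R4 k) : Prop where
  pt : ∀ i, eval (Pi.single i 1) f ≠ 0
  line : ∀ i j, i ≠ j → (lineCubic f (Pi.single i 1) (Pi.single j 1)).discr ≠ 0

/-- A finite set of nonzero vectors on the cone of the cubic. -/
def OnX (f : R4 k) (S : Finset (Fin 4 → k)) : Prop := ∀ v ∈ S, v ≠ 0 ∧ eval v f = 0

theorem map_mem_of_mem {ι κ : Type} [Fintype ι] (L : (ι → R4 k) →ₗ[R4 k] (κ → R4 k))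
    {J : Ideal (R4 k)} {g : ι → R4 k} (hg : ∀ e, g e ∈ J) (c : κ) : L g c ∈ J := by
  classical
  rw [LinearMap.pi_apply_eq_sum_univ L g, Finset.sum_apply]
  exact Ideal.sum_mem _ fun e _ => by
    rw [Pi.smul_apply, smul_eq_mul]; exact Ideal.mul_mem_right _ _ (hg e)

theorem prime_X4 (i : Fin 4) : Prime (X i : R4 k) := MvPolynomial.X_prime

theorem mem_J_of_mem {f h : R4 k} (hf : eval (Pi.single 2 1) f ≠ 0)
    (h0 : h ∈ Ideal.span {f, X 0}) (h1 : h ∈ Ideal.span {f, X 1}) :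
    h ∈ Ideal.span {f, X 0 * X 1} := by
  obtain ⟨A, B, hA⟩ := Ideal.mem_span_pair.1 h0
  obtain ⟨D, E, hD⟩ := Ideal.mem_span_pair.1 h1
  let ψ : R4 k →ₐ[k] R4 k := aeval (Function.update X 0 0)
  have e0 : ψ (X 0) = 0 := by simp [ψ]
  have e1 : ψ (X 1) = X 1 := by simp [ψ]
  have hψ : ∀ g, X 0 ∣ g - ψ g := fun g => Ideal.mem_span_singleton.1
    (sub_algHom_mem (I := Ideal.span {X 0}) ψ (fun i => by
      by_cases hi : i = 0
      · subst hi; rw [e0, sub_zero]; exact Ideal.mem_span_singleton_self _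
      · simp [ψ, Function.update_of_ne hi]) g)
  obtain ⟨A', B', hB⟩ := regular_mod (f := f) (A := D - A) (B := E) (w := B) ψ hψ e0 (X_ne_zero 0)
    (prime_X4 1) e1 (fun ⟨c, hc⟩ => hf (by
      have := congrArg (eval (Pi.single 2 1)) hc
      rw [eval_aeval', map_mul, eval_X] at this
      rw [Pi.single_eq_of_ne (by decide), zero_mul] at this
      refine Eq.trans ?_ this
      congr 2
      funext i
      by_cases hi : i = 0
      · subst hi; simp
      · simp [Function.update_of_ne hi])) (by linear_combination hA - hD)
  exact Ideal.mem_span_pair.2 ⟨A + X 0 * A', B', by rw [← hA, hB]; ring⟩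

/-- The plane `x₃ = b x₀ + a x₁ + d x₂`. -/
noncomputable def plane (a b d : k) : R4 k := X 3 - (C b * X 0 + C a * X 1 + C d * X 2)

theorem plane_homog (a b d : k) : (plane a b d).IsHomogeneous 1 := by
  refine (isHomogeneous_X _ _).sub (((?_ : IsHomogeneous _ 1).add ?_).add ?_) <;>
  exact isHomogeneous_C_mul_X _ _

theorem plane_regular {f h : R4 k} {a b d : k} (hf2 : eval (Pi.single 2 1) f ≠ 0)
    (hf : eval ![0, 0, 1, d] f ≠ 0) (h0 : plane a b d * h ∈ Ideal.span {f, X 0 * X 1}) :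
    h ∈ Ideal.span {f, X 0 * X 1} := by
  let ψ : R4 k →ₐ[k] R4 k := aeval (Function.update X 3 (C b * X 0 + C a * X 1 + C d * X 2))
  have e0 : ∀ i, i ≠ 3 → ψ (X i) = X i := fun i hi => by simp [ψ, Function.update_of_ne hi]
  have e3 : ψ (X 3) = C b * X 0 + C a * X 1 + C d * X 2 := by simp [ψ]
  have hψC : ∀ c, ψ (C c) = C c := fun c => by simp [ψ]
  have hψl : ψ (plane a b d) = 0 := by
    simp [plane, e3, e0, hψC]
  have hψ : ∀ g, plane a b d ∣ g - ψ g := fun g => Ideal.mem_span_singleton.1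
    (sub_algHom_mem (I := Ideal.span {plane a b d}) ψ (fun i => by
      by_cases hi : i = 3
      · subst hi; rw [e3]; exact Ideal.mem_span_singleton_self _
      · rw [e0 i hi, sub_self]; exact Ideal.zero_mem _) g)
  have hl0 : plane a b d ≠ 0 := fun h => by
    have := congrArg (eval ![0, 0, 0, 1]) h
    simp [plane] at this
  obtain ⟨A, B, hAB⟩ := Ideal.mem_span_pair.1 h0
  have key : ∀ m n : Fin 4, (m = 0 ∨ m = 1) → plane a b d * h = f * A + X m * (X n * B) →
      h ∈ Ideal.span {f, X m} := by
    intro m n hm hmn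
    have hm3 : m ≠ 3 := by rcases hm with rfl | rfl <;> decide
    obtain ⟨A', B', hB⟩ := regular_mod (f := f) ψ hψ hψl hl0 (prime_X4 m) (e0 m hm3)
      (fun ⟨c, hc⟩ => hf (by
        have := congrArg (eval ![0, 0, 1, d]) hc
        rw [eval_aeval', map_mul, eval_X] at this
        have hz : (![0, 0, 1, d] : Fin 4 → k) m = 0 := by rcases hm with rfl | rfl <;> rfl
        rw [hz, zero_mul] at this
        refine Eq.trans ?_ this
        congr 2
        funext i
        fin_cases i <;> simp [Function.update])) hmn
    exact Ideal.mem_span_pair.2 ⟨A', B', by rw [hB]; ring⟩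
  exact mem_J_of_mem hf2 (key 0 1 (.inl rfl) (by linear_combination -hAB))
    (key 1 0 (.inr rfl) (by linear_combination -hAB))

theorem cut_mem [Infinite k] {f g : R4 k} (hf : f.IsHomogeneous 3) {n : ℕ} (hg : g.IsHomogeneous n) {a b d c0 c1 : k}
    {ρ τ : Fin 3 → k} (hρ : Function.Injective ρ) (hτ : Function.Injective τ) (hc0 : c0 ≠ 0)
    (hc1 : c1 ≠ 0)
    (h0 : ∀ s t : k, eval (s • ![0, 1, 0, a] + t • ![0, 0, 1, d]) f = c0 * ∏ i, (s - ρ i * t))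
    (h1 : ∀ s t : k, eval (s • ![1, 0, 0, b] + t • ![0, 0, 1, d]) f = c1 * ∏ i, (s - τ i * t))
    (hd : eval ![0, 0, 1, d] f ≠ 0)
    (g0 : ∀ i, eval (ρ i • ![0, 1, 0, a] + ![0, 0, 1, d]) g = 0)
    (g1 : ∀ i, eval (τ i • ![1, 0, 0, b] + ![0, 0, 1, d]) g = 0) :
    ∃ A B h, g = f * A + X 0 * X 1 * B + plane a b d * h := by
  have m0 := line_mem (I := Ideal.span {X 0, plane a b d}) (g := g) (p := 1) (q := 2) (by decide)
    hρ hc0 h0 (fun m => by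
      rw [Ideal.mem_span_pair]
      fin_cases m
      · exact ⟨1, 0, by simp⟩
      · exact ⟨0, 0, by simp⟩
      · exact ⟨0, 0, by simp⟩
      · exact ⟨C b, 1, by simp [plane]; ring⟩)
    (fun i t _ => by rw [eval_smul_homog hg, g0, mul_zero])
  obtain ⟨y, hy, w, hw, rfl⟩ := Submodule.mem_sup.1 m0
  obtain ⟨B, h, rfl⟩ := Ideal.mem_span_pair.1 hy
  obtain ⟨A, rfl⟩ := Ideal.mem_span_singleton.1 hw
  have hτ0 : ∀ i, τ i ≠ 0 := fun i hi => hd (by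
    have := h1 0 1
    rw [zero_smul, zero_add, one_smul, Finset.prod_eq_zero (Finset.mem_univ i) (by rw [hi]; simp),
      mul_zero] at this
    exact this)
  have m1 := line_mem (I := Ideal.span {X 1, plane a b d}) (g := B) (p := 0) (q := 2) (by decide)
    hτ hc1 h1 (fun m => by
      rw [Ideal.mem_span_pair]
      fin_cases m
      · exact ⟨0, 0, by simp⟩
      · exact ⟨1, 0, by simp⟩
      · exact ⟨0, 0, by simp⟩
      · exact ⟨C a, 1, by simp [plane]; ring⟩)
    (fun i t ht => by
      have e1 := eval_smul_homog hg t (τ i • ![1, 0, 0, b] + ![0, 0, 1, d])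
      rw [g1, mul_zero] at e1
      have e2 : eval (τ i • ![1, 0, 0, b] + ![0, 0, 1, d]) f = 0 := by
        have := h1 (τ i) 1
        rw [one_smul, Finset.prod_eq_zero (Finset.mem_univ i) (by simp), mul_zero] at this
        exact this
      have e3 := eval_smul_homog hf t (τ i • ![1, 0, 0, b] + ![0, 0, 1, d])
      rw [e2, mul_zero] at e3
      simp only [map_add, map_mul, e3, zero_mul, add_zero, eval_X] at e1
      have e4 : eval (t • (τ i • ![1, 0, 0, b] + ![0, 0, 1, d])) (plane a b d) = 0 := by
        simp [plane]; ring
      rw [e4, mul_zero, add_zero] at e1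
      refine (mul_eq_zero.1 e1).resolve_right ?_
      simp [ht, hτ0 i])
  obtain ⟨y, hy', w', hw', rfl⟩ := Submodule.mem_sup.1 m1
  obtain ⟨B', h', rfl⟩ := Ideal.mem_span_pair.1 hy'
  obtain ⟨A', rfl⟩ := Ideal.mem_span_singleton.1 hw'
  exact ⟨A + A' * X 0, B', h + h' * X 0, by ring⟩

end Good

section Step

variable {k : Type} [Field k]

theorem coord_vec {α : Type} (c : Fin 4 → α) : ![c 0, c 1, c 2, c 3] = c := by
  funext i; fin_cases i <;> rfl

theorem exists_cut [IsAlgClosed k] {f : R4 k} (F : Frame f) (S : Finset (Fin 4 → k))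
    (hS : ∀ v ∈ S, v ≠ 0) : ∃ a b d : k, eval ![0, 1, 0, a] f ≠ 0 ∧ eval ![1, 0, 0, b] f ≠ 0 ∧
      eval ![0, 0, 1, d] f ≠ 0 ∧ (lineCubic f ![0, 1, 0, a] ![0, 0, 1, d]).discr ≠ 0 ∧
      (lineCubic f ![1, 0, 0, b] ![0, 0, 1, d]).discr ≠ 0 ∧ ∀ v ∈ S, eval v (plane a b d) ≠ 0 := by
  have := IsAlgClosed.instInfinite (K := k)
  let G : Fin 5 ⊕ (Fin 4 → k) → (Fin 3 → k) → k := Sum.elim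
    ![fun x => eval ![0, 1, 0, x 0] f, fun x => eval ![1, 0, 0, x 1] f,
      fun x => eval ![0, 0, 1, x 2] f, fun x => (lineCubic f ![0, 1, 0, x 0] ![0, 0, 1, x 2]).discr,
      fun x => (lineCubic f ![1, 0, 0, x 1] ![0, 0, 1, x 2]).discr]
    (fun v x => eval v (plane (x 0) (x 1) (x 2)))
  have p0 : ∀ i, PolyFun fun x : Fin 3 → k => (![0, 1, 0, x 0] : Fin 4 → k) i := by
    intro i; fin_cases i
    exacts [.const 0, .const 1, .const 0, .coord 0]
  have p1 : ∀ i, PolyFun fun x : Fin 3 → k => (![1, 0, 0, x 1] : Fin 4 → k) i := by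
    intro i; fin_cases i
    exacts [.const 1, .const 0, .const 0, .coord 1]
  have p2 : ∀ i, PolyFun fun x : Fin 3 → k => (![0, 0, 1, x 2] : Fin 4 → k) i := by
    intro i; fin_cases i
    exacts [.const 0, .const 0, .const 1, .coord 2]
  have e0 : (![0, 1, 0, 0] : Fin 4 → k) = Pi.single 1 1 := by funext i; fin_cases i <;> rfl
  have e1 : (![1, 0, 0, 0] : Fin 4 → k) = Pi.single 0 1 := by funext i; fin_cases i <;> rfl
  have e2 : (![0, 0, 1, 0] : Fin 4 → k) = Pi.single 2 1 := by funext i; fin_cases i <;> rfl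
  obtain ⟨x, hx⟩ := PolyFun.exists_ne_zero (Finset.univ.disjSum S) (F := G)
    (by
      rintro (i | v) _
      · fin_cases i
        exacts [.eval f p0, .eval f p1, .eval f p2, .lineDiscr f p0 p2, .lineDiscr f p1 p2]
      · simp only [G, Sum.elim_inr, plane, map_sub, map_add, map_mul, eval_C, eval_X]
        exact (PolyFun.const _).sub ((((PolyFun.coord 1).mul (.const _)).add
          ((PolyFun.coord 0).mul (.const _))).add ((PolyFun.coord 2).mul (.const _))))
    (by
      rintro (i | v) hi
      · refine ⟨0, ?_⟩
        fin_cases i <;> simp only [G, Sum.elim_inl, Matrix.cons_val, Fin.reduceFinMk, Fin.zero_eta,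
          Fin.mk_one, Pi.zero_apply, e0, e1, e2]
        exacts [F.pt _, F.pt _, F.pt _, F.line _ _ (by decide), F.line _ _ (by decide)]
      · have hv := hS v (Finset.inr_mem_disjSum.1 hi)
        simp only [G, Sum.elim_inr, plane, map_sub, map_add, map_mul, eval_C, eval_X]
        by_contra! h
        have h0 := h 0
        have h1 := h ![1, 0, 0]
        have h2 := h ![0, 1, 0]
        have h3 := h ![0, 0, 1]
        simp at h0 h1 h2 h3
        rw [h0] at h1 h2 h3
        refine hv ?_
        rw [← coord_vec v]
        simp_all)
  have := fun i => hx (Sum.inl i) (Finset.inl_mem_disjSum.2 (Finset.mem_univ _))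
  exact ⟨x 0, x 1, x 2, this 0, this 1, this 2, this 3, this 4,
    fun v hv => hx (Sum.inr v) (Finset.inr_mem_disjSum.2 hv)⟩

theorem span_pair_homog {f : R4 k} (hf : f.IsHomogeneous 3) {p : R4 k}
    (hp : p ∈ Ideal.span {f, X 0 * X 1}) (n : ℕ) :
    homogeneousComponent n p ∈ Ideal.span {f, X 0 * X 1} := by
  refine homogComp_mem_span ?_ hp n
  rintro x (rfl | rfl)
  exacts [⟨3, hf⟩, ⟨2, (isHomogeneous_X _ _).mul (isHomogeneous_X _ _)⟩]

theorem degree_step [IsAlgClosed k] {ι κ : Type} [Fintype ι]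
    {L : (ι → R4 k) →ₗ[R4 k] (κ → R4 k)} {f : R4 k} (hf : f.IsHomogeneous 3) (F : Frame f) {n : ℕ}
    {S : Finset (Fin 4 → k)} (hS : OnX f S)
    (hSD : ∀ v ∈ S, v 0 * v 1 = 0) (h : RelGood L (Ideal.span {f, X 0 * X 1}) n S) :
    ∃ S', S'.card ≤ S.card + 6 ∧ OnX f S' ∧ (∀ v ∈ S', v 0 * v 1 = 0) ∧
      RelGood L (Ideal.span {f, X 0 * X 1}) (n + 1) S' := by
  classical
  have := IsAlgClosed.instInfinite (K := k)
  obtain ⟨a, b, d, ha, hb, hd, hda, hdb, hl⟩ := exists_cut F S fun v hv => (hS v hv).1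
  obtain ⟨ρ, hρ, h0⟩ := exists_line_roots hf ha hda
  obtain ⟨τ, hτ, h1⟩ := exists_line_roots hf hb hdb
  let P : Fin 3 → Fin 4 → k := fun i => ρ i • ![0, 1, 0, a] + ![0, 0, 1, d]
  let Q : Fin 3 → Fin 4 → k := fun i => τ i • ![1, 0, 0, b] + ![0, 0, 1, d]
  refine ⟨S ∪ (Finset.univ.image P ∪ Finset.univ.image Q), ?_, ?_, ?_, ?_⟩
  · have e1 := Finset.card_union_le S (Finset.univ.image P ∪ Finset.univ.image Q)
    have e2 := Finset.card_union_le (Finset.univ.image P) (Finset.univ.image Q)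
    have e3 : (Finset.univ.image P).card ≤ 3 := Finset.card_image_le
    have e4 : (Finset.univ.image Q).card ≤ 3 := Finset.card_image_le
    omega
  · intro v hv
    simp only [Finset.mem_union, Finset.mem_image, Finset.mem_univ, true_and] at hv
    rcases hv with hv | ⟨i, rfl⟩ | ⟨i, rfl⟩
    · exact hS v hv
    · refine ⟨fun h => ?_, ?_⟩
      · have := congrFun h 2
        simp [P] at this
      · have := h0 (ρ i) 1
        rw [one_smul, Finset.prod_eq_zero (Finset.mem_univ i) (by simp), mul_zero] at this
        exact this
    · refine ⟨fun h => ?_, ?_⟩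
      · have := congrFun h 2
        simp [Q] at this
      · have := h1 (τ i) 1
        rw [one_smul, Finset.prod_eq_zero (Finset.mem_univ i) (by simp), mul_zero] at this
        exact this
  · intro v hv
    simp only [Finset.mem_union, Finset.mem_image, Finset.mem_univ, true_and] at hv
    rcases hv with hv | ⟨i, rfl⟩ | ⟨i, rfl⟩
    · exact hSD v hv
    · simp [P]
    · simp [Q]
  · intro g hg hL hgv
    simp only [Finset.mem_union, Finset.mem_image, Finset.mem_univ, true_and] at hgv
    have hcut : ∀ e, ∃ q : R4 k, q.IsHomogeneous n ∧
        g e - plane a b d * q ∈ Ideal.span {f, X 0 * X 1} := by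
      intro e
      obtain ⟨A, B, h, hh⟩ := cut_mem hf (hg e) hρ hτ ha hb h0 h1 hd
        (fun i => hgv _ (.inr (.inl ⟨i, rfl⟩)) e) (fun i => hgv _ (.inr (.inr ⟨i, rfl⟩)) e)
      refine ⟨homogeneousComponent n h, homogeneousComponent_isHomogeneous _ _, ?_⟩
      have e3 : g e - plane a b d * homogeneousComponent n h =
          homogeneousComponent (n + 1) (g e - plane a b d * h) := by
        rw [map_sub, homogeneousComponent_eq_self (hg e),
          homogComp_mul (plane_homog a b d)]
      rw [e3]
      refine span_pair_homog hf (Ideal.mem_span_pair.2 ⟨A, B, ?_⟩) _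
      rw [hh]; ring
    choose q hq hgq using hcut
    have hqJ := h q hq (fun c => ?_) (fun v hv e => ?_)
    · intro e
      have := Ideal.add_mem _ (hgq e) (Ideal.mul_mem_left _ (plane a b d) (hqJ e))
      rwa [sub_add_cancel] at this
    · refine plane_regular (a := a) (b := b) (F.pt 2) hd ?_
      have e1 := map_mem_of_mem L hgq c
      have e2 : (fun e => g e - plane a b d * q e) = g - plane a b d • q := rfl
      rw [e2, map_sub, map_smul] at e1
      have := Ideal.sub_mem _ (hL c) e1
      simpa using this
    · have e1 : eval v (g e - plane a b d * q e) = 0 := by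
        obtain ⟨A, B, hAB⟩ := Ideal.mem_span_pair.1 (hgq e)
        rw [← hAB, map_add, map_mul, map_mul, map_mul, (hS v hv).2, eval_X, eval_X, hSD v hv,
          mul_zero, mul_zero, add_zero]
      rw [map_sub, hgv v (.inl hv), zero_sub, neg_eq_zero, map_mul] at e1
      exact (mul_eq_zero.1 e1).resolve_left (hl v hv)

theorem degree_steps [IsAlgClosed k] {ι κ : Type} [Fintype ι]
    {L : (ι → R4 k) →ₗ[R4 k] (κ → R4 k)} {f : R4 k} (hf : f.IsHomogeneous 3) (F : Frame f) {n : ℕ}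
    {S : Finset (Fin 4 → k)} (hS : OnX f S) (hSD : ∀ v ∈ S, v 0 * v 1 = 0)
    (h : RelGood L (Ideal.span {f, X 0 * X 1}) n S) (m : ℕ) :
    ∃ S', S'.card ≤ S.card + 6 * m ∧ OnX f S' ∧ (∀ v ∈ S', v 0 * v 1 = 0) ∧
      RelGood L (Ideal.span {f, X 0 * X 1}) (n + m) S' := by
  induction m with
  | zero => exact ⟨S, le_rfl, hS, hSD, h⟩
  | succ m ih =>
    obtain ⟨S1, hc, h1, h2, h3⟩ := ih
    obtain ⟨S2, hc2, h4, h5, h6⟩ := degree_step hf F h1 h2 h3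
    exact ⟨S2, by omega, h4, h5, h6⟩

theorem quadric_step [IsAlgClosed k] {ι κ : Type} [Fintype ι]
    {L : (ι → R4 k) →ₗ[R4 k] (κ → R4 k)} {f : R4 k} (hf : f.IsHomogeneous 3) (hirr : Irreducible f)
    {n : ℕ} {S T : Finset (Fin 4 → k)} (hS : OnX f S) (hT : OnX f T)
    (hS01 : ∀ v ∈ S, v 0 * v 1 ≠ 0) (h : RelGood L (Ideal.span {f}) n S)
    (hJ : RelGood L (Ideal.span {f, X 0 * X 1}) (n + 2) T) :
    ∃ S', S'.card ≤ S.card + T.card ∧ OnX f S' ∧ RelGood L (Ideal.span {f}) (n + 2) S' := by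
  classical
  have hq : (X 0 * X 1 : R4 k).IsHomogeneous 2 := (isHomogeneous_X _ _).mul (isHomogeneous_X _ _)
  have hP := prime_span hirr
  refine ⟨S ∪ T, Finset.card_union_le _ _, fun v hv => ?_, fun g hg hL hv => ?_⟩
  · rcases Finset.mem_union.1 hv with hv | hv
    exacts [hS v hv, hT v hv]
  · have hle : Ideal.span {f} ≤ Ideal.span {f, X 0 * X 1} := Ideal.span_mono (by simp)
    have hgJ := hJ g hg (fun c => hle (hL c)) (fun v hvT => hv v (Finset.mem_union_right _ hvT))
    have hcut : ∀ e, ∃ q : R4 k, q.IsHomogeneous n ∧ g e - X 0 * X 1 * q ∈ Ideal.span {f} := by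
      intro e
      obtain ⟨A, B, hAB⟩ := Ideal.mem_span_pair.1 (hgJ e)
      refine ⟨homogeneousComponent n B, homogeneousComponent_isHomogeneous _ _, ?_⟩
      have e3 : g e - X 0 * X 1 * homogeneousComponent n B =
          homogeneousComponent (n + 2) (g e - X 0 * X 1 * B) := by
        rw [map_sub, homogeneousComponent_eq_self (hg e), homogComp_mul hq]
      rw [e3]
      refine homogComp_mem_span (by rintro x rfl; exact ⟨3, hf⟩) ?_ _
      rw [← hAB, Ideal.mem_span_singleton]
      exact ⟨A, by ring⟩
    choose q hq' hgq using hcut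
    have hqf := h q hq' (fun c => ?_) (fun v hvS e => ?_)
    · intro e
      have := Ideal.add_mem _ (hgq e) (Ideal.mul_mem_left _ (X 0 * X 1) (hqf e))
      rwa [sub_add_cancel] at this
    · have e1 := map_mem_of_mem L hgq c
      have e2 : (fun e => g e - X 0 * X 1 * q e) = g - (X 0 * X 1 : R4 k) • q := rfl
      rw [e2, map_sub, map_smul] at e1
      have := Ideal.sub_mem _ (hL c) e1
      refine (hP.mem_or_mem (x := X 0 * X 1) (by simpa using this)).resolve_left ?_
      exact not_mem_span_of_lt hf hq (by norm_num) (mul_ne_zero (X_ne_zero _) (X_ne_zero _))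
    · obtain ⟨A, hA⟩ := Ideal.mem_span_singleton.1 (hgq e)
      have e1 := congrArg (eval v) hA
      rw [map_sub, hv v (Finset.mem_union_left _ hvS), map_mul (eval v) f A, (hS v hvS).2, zero_mul,
        zero_sub, neg_eq_zero, map_mul, map_mul, eval_X, eval_X] at e1
      exact (mul_eq_zero.1 e1).resolve_left (hS01 v hvS)

end Step

section Transfer

variable {k : Type} [Field k]

/-- The linear change of coordinates `g ↦ g(E x)`. -/
noncomputable def linChange (E : Matrix (Fin 4) (Fin 4) k) : R4 k →ₐ[k] R4 k :=
  aeval fun i => ∑ j, C (E i j) * X j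

theorem linChange_X (E : Matrix (Fin 4) (Fin 4) k) (i : Fin 4) :
    linChange E (X i) = ∑ j, C (E i j) * X j := by simp [linChange]

theorem linChange_C (E : Matrix (Fin 4) (Fin 4) k) (c : k) : linChange E (C c) = C c := by
  simp [linChange]

theorem eval_linChange (E : Matrix (Fin 4) (Fin 4) k) (g : R4 k) (v : Fin 4 → k) :
    eval v (linChange E g) = eval (E.mulVec v) g := by
  rw [linChange, eval_aeval']
  congr 2
  funext i
  simp [Matrix.mulVec, dotProduct]

theorem linChange_linChange {E D : Matrix (Fin 4) (Fin 4) k} (h : D * E = 1) (g : R4 k) :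
    linChange E (linChange D g) = g := by
  have : (linChange E).comp (linChange D) = AlgHom.id k (R4 k) := by
    refine MvPolynomial.algHom_ext fun i => ?_
    rw [AlgHom.comp_apply, linChange_X, map_sum]
    simp only [map_mul, linChange_C, linChange_X, Finset.mul_sum]
    rw [Finset.sum_comm, Finset.sum_eq_single i]
    · simp only [← mul_assoc, ← C_mul, ← Finset.sum_mul, ← map_sum]
      rw [← Matrix.mul_apply, h]
      simp
    · intro j _ hj
      simp only [← mul_assoc, ← C_mul, ← Finset.sum_mul, ← map_sum]
      rw [← Matrix.mul_apply, h, Matrix.one_apply_ne' hj]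
      simp
    · simp
  exact DFunLike.congr_fun this g

theorem linChange_homog (E : Matrix (Fin 4) (Fin 4) k) {g : R4 k} {n : ℕ} (hg : g.IsHomogeneous n) :
    (linChange E g).IsHomogeneous n := by
  have := hg.aeval (n := 1) (fun i => ∑ j, C (E i j) * X j) fun i =>
    IsHomogeneous.sum _ _ _ fun j _ => isHomogeneous_C_mul_X _ _
  simpa [linChange] using this

theorem linChange_irreducible {E D : Matrix (Fin 4) (Fin 4) k} (h : D * E = 1) (h' : E * D = 1)
    {f : R4 k} (hf : Irreducible f) : Irreducible (linChange E f) :=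
  (MulEquiv.irreducible_iff (AlgEquiv.ofAlgHom (linChange E) (linChange D)
    (AlgHom.ext fun g => linChange_linChange h g) (AlgHom.ext fun g => linChange_linChange h' g))).2 hf

theorem lineB_linChange (E : Matrix (Fin 4) (Fin 4) k) (f : R4 k) (u w : Fin 4 → k) :
    lineB (linChange E f) u w = lineB f (E.mulVec u) (E.mulVec w) := by
  have hadd : ∀ (p q : R4 k) u w, lineB (p + q) u w = lineB p u w + lineB q u w := by
    intro p q u w; simp [lineB, mul_add, Finset.sum_add_distrib]
  have hmul : ∀ (p q : R4 k) u w, lineB (p * q) u w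
      = lineB p u w * eval u q + eval u p * lineB q u w := by
    intro p q u w
    simp only [lineB, Derivation.leibniz, smul_eq_mul, map_add, map_mul, Finset.sum_mul,
      Finset.mul_sum, ← Finset.sum_add_distrib]
    exact Finset.sum_congr rfl fun i _ => by ring
  have hC : ∀ (c : k) u w, lineB (C c) u w = 0 := by intro c u w; simp [lineB]
  have hX : ∀ (i : Fin 4) (u w : Fin 4 → k), lineB (X i) u w = w i := by
    intro i u w
    simp [lineB, pderiv_X, Pi.single_apply, apply_ite (eval u)]
  induction f using MvPolynomial.induction_on with
  | C c => rw [linChange_C, hC, hC]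
  | add p q hp hq => rw [map_add, hadd, hadd, hp, hq]
  | mul_X p i hp =>
    rw [map_mul, hmul, hmul, hp, eval_linChange, eval_linChange, hX, eval_X, linChange_X]
    congr 2
    have : ∀ s : Finset (Fin 4), lineB (∑ j ∈ s, C (E i j) * X j) u w = ∑ j ∈ s, E i j * w j := by
      intro s
      induction s using Finset.induction_on with
      | empty => simp [lineB]
      | insert a s ha ih => rw [Finset.sum_insert ha, Finset.sum_insert ha, hadd, ih, hmul, hC, hX]; simp
    exact this _

theorem lineCubic_linChange (E : Matrix (Fin 4) (Fin 4) k) (f : R4 k) (u w : Fin 4 → k) :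
    lineCubic (linChange E f) u w = lineCubic f (E.mulVec u) (E.mulVec w) := by
  simp only [lineCubic, lineB_linChange, eval_linChange]

theorem onX_linChange {E D : Matrix (Fin 4) (Fin 4) k} (h' : E * D = 1) [DecidableEq (Fin 4 → k)]
    {f : R4 k} {S : Finset (Fin 4 → k)} (hS : OnX f S) : OnX (linChange E f) (S.image D.mulVec) := by
  intro v hv
  obtain ⟨w, hw, rfl⟩ := Finset.mem_image.1 hv
  have e : E.mulVec (D.mulVec w) = w := by rw [Matrix.mulVec_mulVec, h', Matrix.one_mulVec]
  refine ⟨fun h => (hS w hw).1 ?_, ?_⟩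
  · rw [← e, h, Matrix.mulVec_zero]
  · rw [eval_linChange, e, (hS w hw).2]

/-- The linear form `∑ xᵢ gᵢ` on quadruples. -/
noncomputable def rowRel : (Fin 4 → R4 k) →ₗ[R4 k] (Unit → R4 k) :=
  LinearMap.pi fun _ => ∑ i, (X i : R4 k) • LinearMap.proj i

/-- The projection to an entry of a matrix of polynomials. -/
noncomputable def coordProj (p : Fin 4 × Fin 4) : (Fin 4 × Fin 4 → R4 k) →ₗ[R4 k] R4 k :=
  LinearMap.proj p

/-- The relations defining alternating matrices annihilated by the vector of variables. -/
noncomputable def altRel :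
    (Fin 4 × Fin 4 → R4 k) →ₗ[R4 k] (Fin 4 ⊕ Fin 4 ⊕ Fin 4 × Fin 4 → R4 k) :=
  LinearMap.pi (Sum.elim (fun i => ∑ j, (X j : R4 k) • coordProj (i, j))
    (Sum.elim (fun i => coordProj (i, i)) (fun p => coordProj (p.1, p.2) + coordProj (p.2, p.1))))

theorem rowRel_apply (g : Fin 4 → R4 k) (c : Unit) : rowRel g c = ∑ i, X i * g i := by
  simp [rowRel]

theorem altRel_row (g : Fin 4 × Fin 4 → R4 k) (i : Fin 4) :
    altRel g (.inl i) = ∑ j, X j * g (i, j) := by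
  simp [altRel, coordProj]

theorem altRel_diag (g : Fin 4 × Fin 4 → R4 k) (i : Fin 4) :
    altRel g (.inr (.inl i)) = g (i, i) := by
  simp [altRel, coordProj]

theorem altRel_add (g : Fin 4 × Fin 4 → R4 k) (i j : Fin 4) :
    altRel g (.inr (.inr (i, j))) = g (i, j) + g (j, i) := by
  simp [altRel, coordProj]

theorem linChange_mem {E D : Matrix (Fin 4) (Fin 4) k} {f g : R4 k}
    (hg : g ∈ Ideal.span {linChange E f}) : linChange D g ∈ Ideal.span {linChange D (linChange E f)} := by
  rw [Ideal.mem_span_singleton] at hg ⊢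
  exact map_dvd _ hg

/-- Relations stable under linear changes of coordinates. -/
def Transferable {ι κ : Type} (L : (ι → R4 k) →ₗ[R4 k] (κ → R4 k)) : Prop :=
  ∀ (E D : Matrix (Fin 4) (Fin 4) k), D * E = 1 → E * D = 1 → ∀ (f : R4 k) (s : ℕ)
    (S T : Finset (Fin 4 → k)), (∀ v ∈ S, D.mulVec v ∈ T) → RelGood L (Ideal.span {f}) s S →
    RelGood L (Ideal.span {linChange E f}) s T

theorem sum_inv {E D : Matrix (Fin 4) (Fin 4) k} (h : D * E = 1) (y : Fin 4 → R4 k) (m : Fin 4) :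
    ∑ i, C (E i m) * ∑ j, C (D j i) * y j = y m := by
  simp only [Finset.mul_sum]
  rw [Finset.sum_comm, Finset.sum_eq_single m]
  · simp only [← mul_assoc, ← C_mul, ← Finset.sum_mul, ← map_sum]
    have := congrFun (congrFun h m) m
    rw [Matrix.mul_apply] at this
    simp only [mul_comm (E _ m)]
    rw [this]; simp
  · intro j _ hj
    simp only [← mul_assoc, ← C_mul, ← Finset.sum_mul, ← map_sum]
    have := congrFun (congrFun h j) m
    rw [Matrix.mul_apply, Matrix.one_apply_ne hj] at this
    simp only [mul_comm (E _ m)]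
    rw [this]; simp
  · simp

theorem transferable_rowRel : Transferable (rowRel (k := k)) := by
  intro E D h h' f s S T hST hgood g hg hL hv
  have hL' := hL ()
  rw [rowRel_apply] at hL'
  have key := hgood (fun i => ∑ j, C (D j i) * linChange D (g j)) (fun i => ?_) (fun c => ?_)
    (fun v hvS i => ?_)
  · intro m
    have h1 : linChange D (g m) ∈ Ideal.span {f} := by
      rw [← sum_inv h (fun j => linChange D (g j)) m]
      exact Ideal.sum_mem _ fun i _ => Ideal.mul_mem_left _ _ (key i)
    rw [Ideal.mem_span_singleton] at h1 ⊢
    have := map_dvd (linChange E) h1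
    rwa [linChange_linChange h] at this
  · exact IsHomogeneous.sum _ _ _ fun j _ => by
      simpa using (isHomogeneous_C _ (D j i)).mul (linChange_homog D (hg j))
  · have h1 := linChange_mem (D := D) hL'
    rw [linChange_linChange h'] at h1
    rw [rowRel_apply]
    convert h1 using 1
    simp only [map_sum, map_mul, linChange_X, Finset.sum_mul, Finset.mul_sum]
    rw [Finset.sum_comm]
    exact Finset.sum_congr rfl fun i _ => Finset.sum_congr rfl fun j _ => by ring
  · simp only [map_sum, map_mul, eval_linChange, hv _ (hST v hvS), mul_zero, Finset.sum_const_zero]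

theorem alt_sum_mem {J : Ideal (R4 k)} (d : Fin 4 → R4 k) (e : Fin 4 → R4 k) {g : Fin 4 × Fin 4 → R4 k}
    (h1 : ∀ i j, g (i, j) + g (j, i) ∈ J) :
    ∑ i, ∑ j, d i * e j * g (i, j) + ∑ i, ∑ j, e i * d j * g (i, j) ∈ J := by
  have : ∑ i, ∑ j, e i * d j * g (i, j) = ∑ i, ∑ j, d i * e j * g (j, i) := by
    rw [Finset.sum_comm]
    exact Finset.sum_congr rfl fun i _ => Finset.sum_congr rfl fun j _ => by ring
  rw [this]
  simp only [← Finset.sum_add_distrib, ← mul_add]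
  exact Ideal.sum_mem _ fun i _ => Ideal.sum_mem _ fun j _ => Ideal.mul_mem_left _ _ (h1 i j)

theorem alt_sum_mem' {J : Ideal (R4 k)} (d : Fin 4 → R4 k) {g : Fin 4 × Fin 4 → R4 k}
    (h0 : ∀ i, g (i, i) ∈ J) (h1 : ∀ i j, g (i, j) + g (j, i) ∈ J) :
    ∑ i, ∑ j, d i * d j * g (i, j) ∈ J := by
  have : ∑ i, ∑ j, d i * d j * g (i, j) = ∑ i, d i * d i * g (i, i) +
      (d 0 * d 1 * (g (0, 1) + g (1, 0)) + d 0 * d 2 * (g (0, 2) + g (2, 0)) +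
      d 0 * d 3 * (g (0, 3) + g (3, 0)) + d 1 * d 2 * (g (1, 2) + g (2, 1)) +
      d 1 * d 3 * (g (1, 3) + g (3, 1)) + d 2 * d 3 * (g (2, 3) + g (3, 2))) := by
    simp only [Fin.sum_univ_four]; ring
  rw [this]
  refine Ideal.add_mem _ (Ideal.sum_mem _ fun i _ => Ideal.mul_mem_left _ _ (h0 i)) ?_
  refine Ideal.add_mem _ (Ideal.add_mem _ (Ideal.add_mem _ (Ideal.add_mem _ (Ideal.add_mem _ ?_ ?_) ?_)
    ?_) ?_) ?_ <;> exact Ideal.mul_mem_left _ _ (h1 _ _)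

theorem transferable_altRel : Transferable (altRel (k := k)) := by
  intro E D h h' f s S T hST hgood g hg hL hv
  have hr := fun i => hL (.inl i)
  have hd := fun i => hL (.inr (.inl i))
  have ha := fun i j => hL (.inr (.inr (i, j)))
  simp only [altRel_row, altRel_diag, altRel_add] at hr hd ha
  have hD : ∀ p, p ∈ Ideal.span {linChange E f} → linChange D p ∈ Ideal.span {f} := fun p hp => by
    have := linChange_mem (D := D) hp
    rwa [linChange_linChange h'] at this
  let y : Fin 4 × Fin 4 → R4 k := fun p => linChange D (g p)
  have hy0 : ∀ i, y (i, i) ∈ Ideal.span {f} := fun i => hD _ (hd i)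
  have hy1 : ∀ i j, y (i, j) + y (j, i) ∈ Ideal.span {f} := fun i j => by
    have := hD _ (ha i j)
    rwa [map_add] at this
  have key := hgood (fun p => ∑ i, ∑ j, C (D i p.1) * C (D j p.2) * y (i, j)) (fun p => ?_)
    (fun c => ?_) (fun v hvS p => ?_)
  · rintro ⟨a, b⟩
    have h1 : y (a, b) ∈ Ideal.span {f} := by
      have e1 := sum_inv h (fun i => y (i, b)) a
      have e2 := fun i => sum_inv h (fun j => y (i, j)) b
      rw [← e1]
      simp only [← e2]
      have : ∑ p, C (E p a) * ∑ i, C (D i p) * ∑ q, C (E q b) * ∑ j, C (D j q) * y (i, j)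
          = ∑ p, ∑ q, C (E p a) * C (E q b) * ∑ i, ∑ j, C (D i p) * C (D j q) * y (i, j) := by
        simp only [Finset.mul_sum]
        refine Finset.sum_congr rfl fun p _ => ?_
        rw [Finset.sum_comm]
        exact Finset.sum_congr rfl fun q _ => Finset.sum_congr rfl fun i _ =>
          Finset.sum_congr rfl fun j _ => by ring
      rw [this]
      exact Ideal.sum_mem _ fun p _ => Ideal.sum_mem _ fun q _ =>
        Ideal.mul_mem_left _ (C (E p a) * C (E q b)) (key (p, q))
    rw [Ideal.mem_span_singleton] at h1 ⊢
    have := map_dvd (linChange E) h1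
    rwa [linChange_linChange h] at this
  · exact IsHomogeneous.sum _ _ _ fun i _ => IsHomogeneous.sum _ _ _ fun j _ => by
      simpa using ((isHomogeneous_C _ (D i p.1)).mul (isHomogeneous_C _ (D j p.2))).mul
        (linChange_homog D (hg (i, j)))
  · rcases c with a | a | ⟨a, b⟩
    · rw [altRel_row]
      have : ∑ c, X c * ∑ i, ∑ j, C (D i a) * C (D j c) * y (i, j)
          = ∑ i, C (D i a) * linChange D (∑ j, X j * g (i, j)) := by
        simp only [map_sum, map_mul, linChange_X, Finset.sum_mul, Finset.mul_sum]
        rw [Finset.sum_comm]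
        refine Finset.sum_congr rfl fun i _ => ?_
        rw [Finset.sum_comm]
        exact Finset.sum_congr rfl fun j _ => Finset.sum_congr rfl fun c _ => by
          simp only [y]; ring
      rw [this]
      exact Ideal.sum_mem _ fun i _ => Ideal.mul_mem_left _ _ (hD _ (hr i))
    · rw [altRel_diag]
      exact alt_sum_mem' (fun i => C (D i a)) hy0 hy1
    · rw [altRel_add]
      exact alt_sum_mem (fun i => C (D i a)) (fun i => C (D i b)) hy1
  · simp only [y, map_sum, map_mul, eval_linChange, hv _ (hST v hvS), mul_zero,
      Finset.sum_const_zero]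

end Transfer

section Frames

variable {k : Type} [Field k]

/-- The linear form attached to a vector. -/
noncomputable def linForm (c : Fin 4 → k) : R4 k := ∑ i, C (c i) * X i

theorem linForm_homog (c : Fin 4 → k) : (linForm c).IsHomogeneous 1 :=
  IsHomogeneous.sum _ _ _ fun _ _ => isHomogeneous_C_mul_X _ _

theorem eval_linForm (c v : Fin 4 → k) : eval v (linForm c) = ∑ i, c i * v i := by
  simp [linForm]

theorem linForm_ne_zero {c : Fin 4 → k} {i : Fin 4} (hc : c i ≠ 0) : linForm c ≠ 0 := fun h => by
  have := congrArg (eval (Pi.single i 1)) h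
  rw [eval_linForm] at this
  simp [Pi.single_apply] at this
  exact hc this

theorem exists_discr_ne_zero [IsAlgClosed k] {f : R4 k} (hf : f.IsHomogeneous 3)
    (hirr : Irreducible f)
    (hsm : ∀ v : Fin 4 → k, v ≠ 0 → eval v f = 0 → ∃ i, eval v (pderiv i f) ≠ 0) :
    ∃ u w, (lineCubic f u w).discr ≠ 0 := by
  have := IsAlgClosed.instInfinite (K := k)
  obtain ⟨q, hq0, hq1⟩ := exists_point hirr
    (not_mem_span_of_lt hf (isHomogeneous_X k 0) (by norm_num) (X_ne_zero (0 : Fin 4)))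
  obtain ⟨i, hi⟩ := hsm q (fun h => hq1 (by simp [h])) hq0
  obtain ⟨p, hp0, hp1⟩ := exists_point hirr
    (not_mem_span_of_lt hf (linForm_homog fun i => eval q (pderiv i f)) (by norm_num)
      (linForm_ne_zero hi))
  rw [eval_linForm] at hp1
  obtain ⟨j, hj⟩ := hsm p (fun h => hp1 (by simp [h])) hp0
  let lam : R4 k := linForm fun i => eval p (pderiv i f)
  let B : R4 k := ∑ i, C (p i) * pderiv i f
  have hlam : lam ≠ 0 := linForm_ne_zero hj
  have hBh : B.IsHomogeneous 2 := IsHomogeneous.sum _ _ _ fun i _ => by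
    simpa using (isHomogeneous_C _ (p i)).mul (hf.pderiv (i := i))
  have hB : B ≠ 0 := fun h => hp1 (by
    have := congrArg (eval q) h
    simp only [B, map_sum, map_mul, eval_C, map_zero] at this
    simpa [mul_comm] using this)
  have hP : lam ^ 2 * (B ^ 2 - 4 * lam * f) ≠ 0 := by
    refine mul_ne_zero (pow_ne_zero _ hlam) fun h => ?_
    refine not_mem_span_of_lt hf hBh (by norm_num) hB ?_
    refine (prime_span hirr).mem_of_pow_mem 2 ?_
    rw [Ideal.mem_span_singleton]
    exact ⟨4 * lam, by linear_combination h⟩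
  obtain ⟨w, hw⟩ : ∃ w, eval w (lam ^ 2 * (B ^ 2 - 4 * lam * f)) ≠ 0 := by
    by_contra! hx
    exact hP (MvPolynomial.funext fun x => by rw [hx, map_zero])
  refine ⟨p, w, fun h => hw ?_⟩
  have e1 : eval w lam = lineB f p w := by
    rw [eval_linForm, lineB]; exact Finset.sum_congr rfl fun i _ => mul_comm _ _
  have e2 : eval w B = lineB f w p := by simp [B, lineB]
  have e3 : eval w (4 : R4 k) = 4 := map_ofNat _ _
  simp only [map_mul, map_pow, map_sub, e1, e2, e3]
  simp only [lineCubic, Cubic.discr, hp0] at h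
  linear_combination h

theorem exists_frame [IsAlgClosed k] {f : R4 k} (hf0 : f ≠ 0)
    (hd : ∃ u w, (lineCubic f u w).discr ≠ 0) (S : Finset (Fin 4 → k)) (hS : ∀ v ∈ S, v ≠ 0) :
    ∃ E D : Matrix (Fin 4) (Fin 4) k, E * D = 1 ∧ D * E = 1 ∧ Frame (linChange E f) ∧
      ∀ v ∈ S, ∀ i, D.mulVec v i ≠ 0 := by
  classical
  have := IsAlgClosed.instInfinite (K := k)
  obtain ⟨u, w, huw⟩ := hd
  obtain ⟨u0, hu0⟩ : ∃ u, eval u f ≠ 0 := by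
    by_contra! hx
    exact hf0 (MvPolynomial.funext fun x => by rw [hx, map_zero])
  let M : (Fin 4 × Fin 4 → k) → Matrix (Fin 4) (Fin 4) k := fun x => Matrix.of fun i j => x (i, j)
  have hM : ∀ i j, PolyFun fun x => M x i j := fun i j => PolyFun.coord (i, j)
  let G : Unit ⊕ Fin 4 ⊕ Fin 4 × Fin 4 ⊕ (Fin 4 → k) × Fin 4 → (Fin 4 × Fin 4 → k) → k :=
    Sum.elim (fun _ x => (M x).det) <| Sum.elim (fun j x => eval (fun i => M x i j) f) <|
      Sum.elim (fun p x => (lineCubic f (fun i => M x i p.1) (fun i => M x i p.2)).discr)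
        (fun p x => ((M x).updateCol p.2 p.1).det)
  obtain ⟨x, hx⟩ := PolyFun.exists_ne_zero (F := G) (Finset.univ.disjSum <| Finset.univ.disjSum <|
      (Finset.univ.filter fun p : Fin 4 × Fin 4 => p.1 ≠ p.2).disjSum (S ×ˢ Finset.univ))
    (by
      rintro (_ | j | p | p) _
      · exact PolyFun.det hM
      · exact PolyFun.eval f fun i => hM i j
      · exact PolyFun.lineDiscr f (fun i => hM i p.1) (fun i => hM i p.2)
      · refine PolyFun.det fun i j => ?_
        simp only [Matrix.updateCol_apply]
        split_ifs
        exacts [.const _, hM i j])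
    (by
      rintro (_ | j | p | p) hp
      · refine ⟨fun p => if p.1 = p.2 then 1 else 0, ?_⟩
        have : M (fun p => if p.1 = p.2 then 1 else 0) = 1 := by
          ext i j; simp [M, Matrix.one_apply]
        simp only [G, Sum.elim_inl, this, Matrix.det_one]
        exact one_ne_zero
      · exact ⟨fun p => u0 p.1, hu0⟩
      · have hne : p.1 ≠ p.2 := by simpa using hp
        refine ⟨fun q => if q.2 = p.1 then u q.1 else w q.1, ?_⟩
        simpa [G, M, hne.symm] using huw
      · have hv : p.1 ∈ S := by simpa using hp
        obtain ⟨m, hm⟩ := Function.ne_iff.1 (hS _ hv)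
        let P : Matrix (Fin 4) (Fin 4) k := (Equiv.swap p.2 m).toPEquiv.toMatrix
        refine ⟨fun q => P q.1 q.2, ?_⟩
        have hMP : M (fun q => P q.1 q.2) = P := by ext i j; rfl
        have hPP : P * P = 1 := by
          rw [← PEquiv.toMatrix_trans, ← Equiv.toPEquiv_trans]
          have : (Equiv.swap p.2 m).trans (Equiv.swap p.2 m) = Equiv.refl _ := by
            ext i; simp
          rw [this, Equiv.toPEquiv_refl, PEquiv.toMatrix_refl]
        have hdet : P.det ≠ 0 := fun h => by
          have := congrArg Matrix.det hPP
          rw [Matrix.det_mul, h, Matrix.det_one, zero_mul] at this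
          exact zero_ne_one this
        have e1 : (P.updateCol p.2 p.1).det = P.det * P.mulVec p.1 p.2 := by
          rw [← Matrix.cramer_apply, Matrix.cramer_eq_adjugate_mulVec]
          have : p.1 = P.mulVec (P.mulVec p.1) := by
            rw [Matrix.mulVec_mulVec, hPP, Matrix.one_mulVec]
          conv_lhs => rw [this, Matrix.mulVec_mulVec, Matrix.adjugate_mul]
          simp [Matrix.smul_mulVec]
        simp only [G, Sum.elim_inr, hMP, e1]
        refine mul_ne_zero hdet ?_
        rw [PEquiv.toMatrix_toPEquiv_mulVec]
        simpa using hm)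
  have hdet : (M x).det ≠ 0 := hx (.inl ()) (by simp)
  have hunit : IsUnit (M x).det := isUnit_iff_ne_zero.2 hdet
  have e := fun j => Matrix.mulVec_single_one (M x) j
  refine ⟨M x, (M x)⁻¹, Matrix.mul_nonsing_inv _ hunit, Matrix.nonsing_inv_mul _ hunit, ⟨?_, ?_⟩, ?_⟩
  · intro j
    rw [eval_linChange, e]
    exact hx (.inr (.inl j)) (by simp)
  · intro i j hij
    rw [lineCubic_linChange, e, e]
    exact hx (.inr (.inr (.inl (i, j)))) (by simpa using hij)
  · intro v hv i hi
    refine hx (.inr (.inr (.inr (v, i)))) (by simpa using hv) ?_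
    change ((M x).updateCol i v).det = 0
    rw [← Matrix.cramer_apply, Matrix.cramer_eq_adjugate_mulVec]
    rw [Matrix.inv_def, Matrix.smul_mulVec, Pi.smul_apply, smul_eq_mul] at hi
    refine (mul_eq_zero.1 hi).resolve_left ?_
    rw [Ring.inverse_eq_inv']
    exact inv_ne_zero hdet

end Frames

section Edges

variable {k : Type} [Field k]

/-- The point `s eᵢ + t eⱼ`. -/
def edgePt (i j : Fin 4) (s t : k) : Fin 4 → k := s • Pi.single i 1 + t • Pi.single j 1

theorem edgePt_apply (i j : Fin 4) (s t : k) (l : Fin 4) :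
    edgePt i j s t l = (if l = i then s else 0) + (if l = j then t else 0) := by
  simp [edgePt, Pi.single_apply]

theorem edgePt_one_zero (i j : Fin 4) : edgePt i j (1 : k) 0 = Pi.single i 1 := by
  simp [edgePt]

theorem edgePt_zero_one (i j : Fin 4) : edgePt i j (0 : k) 1 = Pi.single j 1 := by
  simp [edgePt]

theorem edgePt_comm (i j : Fin 4) (s t : k) : edgePt i j s t = edgePt j i t s := add_comm _ _

theorem edge_support [Infinite k] {i j : Fin 4} (hij : i ≠ j) {g : R4 k}
    (h : ∀ s t, eval (edgePt i j s t) g = 0) {m : Fin 4 →₀ ℕ} (hm : m ∈ g.support) :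
    ∃ l, l ≠ i ∧ l ≠ j ∧ m l ≠ 0 := by
  let ψ : R4 k →ₐ[k] R4 k := aeval fun l => if l = i ∨ l = j then X l else 0
  have hψ : ψ g = 0 := MvPolynomial.funext fun v => by
    rw [eval_aeval', map_zero, ← h (v i) (v j)]
    congr 2
    funext l
    rw [edgePt_apply]
    by_cases h1 : l = i
    · subst h1; simp [hij]
    · by_cases h2 : l = j
      · subst h2; simp [h1]
      · simp [h1, h2]
  have := sub_algHom_mem (I := Ideal.span (X '' {l | l ≠ i ∧ l ≠ j})) ψ (fun l => by
    by_cases h1 : l = i ∨ l = j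
    · simp [ψ, h1]
    · have : (X l : R4 k) ∈ Ideal.span (X '' {l | l ≠ i ∧ l ≠ j}) :=
        Ideal.subset_span ⟨l, not_or.1 h1, rfl⟩
      simpa [ψ, h1] using this) g
  rw [hψ, sub_zero, mem_ideal_span_X_image] at this
  obtain ⟨l, hl, hml⟩ := this m hm
  exact ⟨l, hl.1, hl.2, hml⟩

theorem eval_of_support {ι : Type} [Fintype ι] {g : R4 k} {m : ι → Fin 4 →₀ ℕ}
    (hm : Function.Injective m) (h : ∀ d ∈ g.support, ∃ l, m l = d) (v : Fin 4 → k) :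
    eval v g = ∑ l, coeff (m l) g * ∏ i, v i ^ m l i := by
  classical
  rw [eval_eq']
  rw [← Finset.sum_image (f := fun d => coeff d g * ∏ i, v i ^ d i) (s := Finset.univ) (g := m)
    fun a _ b _ e => hm e]
  refine Finset.sum_subset (fun d hd => ?_) (fun d _ hd => ?_)
  · obtain ⟨l, rfl⟩ := h d hd
    exact Finset.mem_image_of_mem _ (Finset.mem_univ l)
  · rw [notMem_support_iff.1 hd, zero_mul]

theorem degree_of_support {g : R4 k} {n : ℕ} (hg : g.IsHomogeneous n) {d : Fin 4 →₀ ℕ}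
    (hd : d ∈ g.support) : d 0 + d 1 + d 2 + d 3 = n := by
  have := hg (mem_support_iff.1 hd)
  rw [Finsupp.weight_apply, Finsupp.sum_fintype _ _ (by simp)] at this
  simpa [Fin.sum_univ_four] using this

theorem exps_of_support {a b c d : ℕ} (h : a + b + c + d = 3) (h01 : c ≠ 0 ∨ d ≠ 0)
    (h02 : b ≠ 0 ∨ d ≠ 0) (h03 : b ≠ 0 ∨ c ≠ 0) (h12 : a ≠ 0 ∨ d ≠ 0) (h13 : a ≠ 0 ∨ c ≠ 0)
    (h23 : a ≠ 0 ∨ b ≠ 0) :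
    a = 0 ∧ b = 1 ∧ c = 1 ∧ d = 1 ∨ a = 1 ∧ b = 0 ∧ c = 1 ∧ d = 1 ∨
      a = 1 ∧ b = 1 ∧ c = 0 ∧ d = 1 ∨ a = 1 ∧ b = 1 ∧ c = 1 ∧ d = 0 := by
  obtain rfl | ha := Nat.eq_zero_or_pos a
  · left; omega
  obtain rfl | hb := Nat.eq_zero_or_pos b
  · right; left; omega
  obtain rfl | hc := Nat.eq_zero_or_pos c
  · right; right; left; omega
  · right; right; right; omega

theorem cubic_of_edges [Infinite k] {g : R4 k} (hg : g.IsHomogeneous 3)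
    (h : ∀ i j, i < j → ∀ s t, eval (edgePt i j s t) g = 0) :
    ∃ b : Fin 4 → k, ∀ v, eval v g = b 0 * (v 1 * v 2 * v 3) + b 1 * (v 0 * v 2 * v 3) +
      b 2 * (v 0 * v 1 * v 3) + b 3 * (v 0 * v 1 * v 2) := by
  let m : Fin 4 → Fin 4 →₀ ℕ := fun l => Finsupp.equivFunOnFinite.symm fun i => if i = l then 0 else 1
  refine ⟨fun l => coeff (m l) g, fun v => ?_⟩
  rw [eval_of_support (m := m) ?_ ?_]
  · simp [Fin.sum_univ_four, Fin.prod_univ_four, m]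
  · intro a b hab
    by_contra hne
    have := DFunLike.congr_fun hab a
    simp [m, hne] at this
  · intro d hd
    have hdeg := degree_of_support hg hd
    have hs : ∀ i j : Fin 4, i < j → ∃ l, l ≠ i ∧ l ≠ j ∧ d l ≠ 0 :=
      fun i j hij => edge_support hij.ne (h i j hij) hd
    have h01 := hs 0 1 (by decide)
    have h02 := hs 0 2 (by decide)
    have h03 := hs 0 3 (by decide)
    have h12 := hs 1 2 (by decide)
    have h13 := hs 1 3 (by decide)
    have h23 := hs 2 3 (by decide)
    simp [Fin.exists_fin_succ] at h01 h02 h03 h12 h13 h23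
    have := exps_of_support hdeg h01 h02 h03 h12 h13 h23
    rcases this with ⟨a, b, c, e⟩ | ⟨a, b, c, e⟩ | ⟨a, b, c, e⟩ | ⟨a, b, c, e⟩
    · exact ⟨0, by ext i; fin_cases i <;> simp [m, a, b, c, e]⟩
    · exact ⟨1, by ext i; fin_cases i <;> simp [m, a, b, c, e]⟩
    · exact ⟨2, by ext i; fin_cases i <;> simp [m, a, b, c, e]⟩
    · exact ⟨3, by ext i; fin_cases i <;> simp [m, a, b, c, e]⟩

theorem quadric_of_edges [Infinite k] {g : R4 k} (hg : g.IsHomogeneous 2)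
    (h02 : ∀ s t, eval (edgePt 0 2 s t) g = 0) (h03 : ∀ s t, eval (edgePt 0 3 s t) g = 0)
    (h12 : ∀ s t, eval (edgePt 1 2 s t) g = 0) (h13 : ∀ s t, eval (edgePt 1 3 s t) g = 0) :
    ∃ b d : k, ∀ v, eval v g = b * (v 0 * v 1) + d * (v 2 * v 3) := by
  let m : Bool → Fin 4 →₀ ℕ := fun l => Finsupp.equivFunOnFinite.symm
    (if l then ![1, 1, 0, 0] else ![0, 0, 1, 1])
  refine ⟨coeff (m true) g, coeff (m false) g, fun v => ?_⟩
  rw [eval_of_support (m := m) ?_ ?_]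
  · simp [Fin.prod_univ_four, m]
  · intro a b hab
    have := DFunLike.congr_fun hab 0
    cases a <;> cases b <;> simp_all [m]
  · intro d hd
    have hdeg := degree_of_support hg hd
    have h02 := edge_support (by decide) h02 hd
    have h03 := edge_support (by decide) h03 hd
    have h12 := edge_support (by decide) h12 hd
    have h13 := edge_support (by decide) h13 hd
    simp [Fin.exists_fin_succ] at h02 h03 h12 h13
    have : d 0 = 1 ∧ d 1 = 1 ∧ d 2 = 0 ∧ d 3 = 0 ∨ d 0 = 0 ∧ d 1 = 0 ∧ d 2 = 1 ∧ d 3 = 1 := by omega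
    rcases this with ⟨a, b, c, e⟩ | ⟨a, b, c, e⟩
    · exact ⟨true, by ext i; fin_cases i <;> simp [m, a, b, c, e]⟩
    · exact ⟨false, by ext i; fin_cases i <;> simp [m, a, b, c, e]⟩

theorem quad_roots {b c d x y : k} (hxy : x ≠ y) (hx : b * x ^ 2 + c * x + d = 0)
    (hy : b * y ^ 2 + c * y + d = 0) : c = -b * (x + y) ∧ d = b * (x * y) := by
  have h1 : c = -b * (x + y) := mul_left_cancel₀ (sub_ne_zero.2 hxy) (by linear_combination hx - hy)
  exact ⟨h1, by linear_combination hx - x * h1⟩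

theorem cubic_roots {a b c d x y z : k} (hxy : x ≠ y) (hxz : x ≠ z) (hyz : y ≠ z)
    (hx : a * x ^ 3 + b * x ^ 2 + c * x + d = 0) (hy : a * y ^ 3 + b * y ^ 2 + c * y + d = 0)
    (hz : a * z ^ 3 + b * z ^ 2 + c * z + d = 0) :
    b = -a * (x + y + z) ∧ c = a * (x * y + x * z + y * z) ∧ d = -a * (x * y * z) := by
  have e1 : a * (x ^ 2 + x * y + y ^ 2) + b * (x + y) + c = 0 :=
    mul_left_cancel₀ (sub_ne_zero.2 hxy) (by linear_combination hx - hy)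
  have e2 : a * (x ^ 2 + x * z + z ^ 2) + b * (x + z) + c = 0 :=
    mul_left_cancel₀ (sub_ne_zero.2 hxz) (by linear_combination hx - hz)
  have hb : b = -a * (x + y + z) :=
    mul_left_cancel₀ (sub_ne_zero.2 hyz) (by linear_combination e1 - e2)
  have hc : c = a * (x * y + x * z + y * z) := by linear_combination e1 - (x + y) * hb
  exact ⟨hb, hc, by linear_combination hx - x ^ 2 * hb - x * hc⟩

theorem eval_line_quadric {g : R4 k} (hg : g.IsHomogeneous 2) (u w : Fin 4 → k) :
    ∃ B, ∀ s t, eval (s • u + t • w) g = eval u g * s ^ 2 + B * s * t + eval w g * t ^ 2 := by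
  obtain ⟨c, rfl⟩ := homog_two_form hg
  refine ⟨∑ i, ∑ j, (u i * w j + w i * u j) * c i j, fun s t => ?_⟩
  simp only [map_sum, map_mul, eval_X, eval_C, Finset.sum_mul, ← Finset.sum_add_distrib]
  refine Finset.sum_congr rfl fun i _ => Finset.sum_congr rfl fun j _ => ?_
  simp only [Pi.add_apply, Pi.smul_apply, smul_eq_mul]
  ring

/-- Coefficients of a cubic polynomial function vanishing identically. -/
theorem quartic_coeffs [Infinite k] {a b c d e : k}
    (h : ∀ s t : k, a * s ^ 4 + b * s ^ 3 * t + c * s ^ 2 * t ^ 2 + d * s * t ^ 3 + e * t ^ 4 = 0) :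
    a = 0 ∧ b = 0 ∧ c = 0 ∧ d = 0 ∧ e = 0 := by
  have : (Polynomial.C a * Polynomial.X ^ 4 + Polynomial.C b * Polynomial.X ^ 3 +
      Polynomial.C c * Polynomial.X ^ 2 + Polynomial.C d * Polynomial.X + Polynomial.C e) = 0 :=
    Polynomial.funext fun s => by simpa using h s 1
  have h4 := congrArg (Polynomial.coeff · 4) this
  have h3 := congrArg (Polynomial.coeff · 3) this
  have h2 := congrArg (Polynomial.coeff · 2) this
  have h1 := congrArg (Polynomial.coeff · 1) this
  have h0 := congrArg (Polynomial.coeff · 0) this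
  simp [Polynomial.coeff_X, Polynomial.coeff_C, Polynomial.coeff_X_pow] at h0 h1 h2 h3 h4
  exact ⟨h4, h3, h2, h1, h0⟩

/-- A pair of cubics with a linear relation on an edge, vanishing at two points of it. -/
theorem edge_pair [Infinite k] {g h : R4 k} (hg : g.IsHomogeneous 3) (hh : h.IsHomogeneous 3)
    {i j : Fin 4} (hrel : ∀ s t, s * eval (edgePt i j s t) g + t * eval (edgePt i j s t) h = 0)
    {x y : k} (hxy : x ≠ y) (gx : eval (edgePt i j x 1) g = 0) (gy : eval (edgePt i j y 1) g = 0) :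
    eval (Pi.single i 1) g = 0 ∧ eval (Pi.single j 1) h = 0 ∧
      eval (Pi.single j 1) g = -(x * y) * eval (Pi.single i 1) h ∧
      (eval (Pi.single i 1) h = 0 → ∀ s t, eval (edgePt i j s t) g = 0 ∧
        eval (edgePt i j s t) h = 0) := by
  simp only [edgePt] at *
  simp only [eval_line hg, eval_line hh] at *
  obtain ⟨h0, h1, h2, h3, h4⟩ := quartic_coeffs fun s t => (by
    rw [← hrel s t]; ring :
      eval (Pi.single i 1) g * s ^ 4 +
      (lineB g (Pi.single i 1) (Pi.single j 1) + eval (Pi.single i 1) h) * s ^ 3 * t +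
      (lineB g (Pi.single j 1) (Pi.single i 1) + lineB h (Pi.single i 1) (Pi.single j 1))
        * s ^ 2 * t ^ 2 +
      (eval (Pi.single j 1) g + lineB h (Pi.single j 1) (Pi.single i 1)) * s * t ^ 3 +
      eval (Pi.single j 1) h * t ^ 4 = 0)
  simp only [h0, zero_mul, zero_add, one_pow, mul_one] at gx gy
  obtain ⟨e1, e2⟩ := quad_roots hxy gx gy
  refine ⟨h0, h4, by linear_combination e2 + x * y * h1, fun hz s t => ?_⟩
  have b0 : lineB g (Pi.single i 1) (Pi.single j 1) = 0 := by linear_combination h1 - hz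
  rw [b0] at e1 e2
  have e1' : lineB g (Pi.single j 1) (Pi.single i 1) = 0 := by linear_combination e1
  have e2' : eval (Pi.single j 1) g = 0 := by linear_combination e2
  have e3 : lineB h (Pi.single i 1) (Pi.single j 1) = 0 := by linear_combination h2 - e1'
  have e4 : lineB h (Pi.single j 1) (Pi.single i 1) = 0 := by linear_combination h3 - e2'
  simp only [h0, b0, e1', e2', e3, e4, h4, hz]
  simp

theorem edge_two {g : R4 k} (hg : g.IsHomogeneous 3) {i j : Fin 4} {x y : k} (hxy : x ≠ y)
    (hx0 : x ≠ 0) (hy0 : y ≠ 0) (gx : eval (edgePt i j x 1) g = 0) (gy : eval (edgePt i j y 1) g = 0)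
    (hi : eval (Pi.single i 1) g = 0) (hj : eval (Pi.single j 1) g = 0) (s t : k) :
    eval (edgePt i j s t) g = 0 := by
  simp only [edgePt, eval_line hg, hi, hj] at *
  obtain ⟨e1, e2⟩ := quad_roots (b := lineB g (Pi.single i 1) (Pi.single j 1))
    (c := lineB g (Pi.single j 1) (Pi.single i 1)) (d := 0) hxy (by linear_combination gx)
    (by linear_combination gy)
  have b0 := (mul_eq_zero.1 e2.symm).resolve_right (mul_ne_zero hx0 hy0)
  rw [b0] at e1
  rw [b0, e1]
  ring

theorem edge_three {g : R4 k} (hg : g.IsHomogeneous 3) {i j : Fin 4} {ρ : Fin 3 → k}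
    (hρ : Function.Injective ρ) (h : ∀ m, eval (edgePt i j (ρ m) 1) g = 0) :
    eval (Pi.single j 1) g = -(ρ 0 * ρ 1 * ρ 2) * eval (Pi.single i 1) g ∧
      (eval (Pi.single i 1) g = 0 → ∀ s t, eval (edgePt i j s t) g = 0) := by
  simp only [edgePt, eval_line hg, one_pow, mul_one] at *
  obtain ⟨e1, e2, e3⟩ := cubic_roots (hρ.ne (by decide)) (hρ.ne (by decide)) (hρ.ne (by decide))
    (h 0) (h 1) (h 2)
  refine ⟨by linear_combination e3, fun hz s t => ?_⟩
  rw [hz] at e1 e2 e3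
  rw [hz, e1, e2, e3]
  ring

end Edges

section RowCubic

variable {k : Type} [Field k]

theorem edgePt_ne_zero {i j : Fin 4} (hij : i ≠ j) (x : k) : edgePt i j x 1 ≠ 0 := fun h => by
  have := congrFun h j
  rw [edgePt_apply] at this
  simp [hij.symm] at this

theorem edge_roots [IsAlgClosed k] {f : R4 k} (hf : f.IsHomogeneous 3) (F : Frame f) {i j : Fin 4}
    (hij : i ≠ j) : ∃ ρ : Fin 3 → k, Function.Injective ρ ∧ (∀ m, ρ m ≠ 0) ∧
      (∀ m, eval (edgePt i j (ρ m) 1) f = 0) ∧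
      ∀ s t, eval (edgePt i j s t) f = eval (Pi.single i 1) f * ∏ m, (s - ρ m * t) := by
  obtain ⟨ρ, hρ, h⟩ := exists_line_roots hf (F.pt i) (F.line i j hij)
  refine ⟨ρ, hρ, fun m hm => ?_, fun m => ?_, h⟩
  · have := h 0 1
    rw [Finset.prod_eq_zero (Finset.mem_univ m) (by rw [hm]; ring), mul_zero] at this
    exact F.pt j (by rw [← edgePt_zero_one i]; exact this)
  · refine (h _ _).trans ?_
    rw [Finset.prod_eq_zero (Finset.mem_univ m) (by ring), mul_zero]

theorem exists_edge_pair [IsAlgClosed k] {f : R4 k} (hf : f.IsHomogeneous 3) (F : Frame f)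
    {i j : Fin 4} (hij : i ≠ j) (b b' : k) : ∃ x y : k, x ≠ y ∧ x ≠ 0 ∧ y ≠ 0 ∧
      eval (edgePt i j x 1) f = 0 ∧ eval (edgePt i j y 1) f = 0 ∧ x * y ≠ b ∧ x * y ≠ b' := by
  obtain ⟨ρ, hρ, h0, h1, -⟩ := edge_roots hf F hij
  have n01 : ρ 0 ≠ ρ 1 := hρ.ne (by decide)
  have n02 : ρ 0 ≠ ρ 2 := hρ.ne (by decide)
  have n12 : ρ 1 ≠ ρ 2 := hρ.ne (by decide)
  have p1 : ρ 0 * ρ 1 ≠ ρ 0 * ρ 2 := fun h => n12 (mul_left_cancel₀ (h0 0) h)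
  have p2 : ρ 0 * ρ 1 ≠ ρ 1 * ρ 2 := fun h => n02 (mul_left_cancel₀ (h0 1) (by rw [← h, mul_comm]))
  have p3 : ρ 0 * ρ 2 ≠ ρ 1 * ρ 2 := fun h => n01 (mul_right_cancel₀ (h0 2) h)
  by_cases a : ρ 0 * ρ 1 ≠ b ∧ ρ 0 * ρ 1 ≠ b'
  · exact ⟨_, _, n01, h0 0, h0 1, h1 0, h1 1, a⟩
  by_cases c : ρ 0 * ρ 2 ≠ b ∧ ρ 0 * ρ 2 ≠ b'
  · exact ⟨_, _, n02, h0 0, h0 2, h1 0, h1 2, c⟩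
  refine ⟨_, _, n12, h0 1, h0 2, h1 1, h1 2, ?_⟩
  constructor
  · rintro rfl
    rcases not_and_or.1 a with a | a <;> rcases not_and_or.1 c with c | c <;>
      simp only [not_not] at a c
    exacts [p2 a, p2 a, p3 c, p1 (a.trans c.symm)]
  · rintro rfl
    rcases not_and_or.1 a with a | a <;> rcases not_and_or.1 c with c | c <;>
      simp only [not_not] at a c
    exacts [p1 (a.trans c.symm), p3 c, p2 a, p2 a]

theorem exists_ne_zero_ne_one [Infinite k] : ∃ x : k, x ≠ 0 ∧ x ≠ 1 := by
  classical
  obtain ⟨x, hx⟩ := Infinite.exists_notMem_finset ({0, 1} : Finset k)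
  exact ⟨x, by aesop⟩

theorem edge_row_rel' {g : Fin 4 → R4 k} {h : R4 k} (hrel : ∑ i, X i * g i = h) (i j : Fin 4)
    (s t : k) : s * eval (edgePt i j s t) (g i) + t * eval (edgePt i j s t) (g j) =
      eval (edgePt i j s t) h := by
  have := congrArg (eval (edgePt i j s t)) hrel
  simpa only [map_sum, map_mul, eval_X, map_zero, edgePt_apply, add_mul, ite_mul, zero_mul,
    Finset.sum_add_distrib, Finset.sum_ite_eq', Finset.sum_ite_eq, Finset.mem_univ, if_true] using this

theorem edge_row_rel {g : Fin 4 → R4 k} (h : ∑ i, X i * g i = 0) (i j : Fin 4) (s t : k) :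
    s * eval (edgePt i j s t) (g i) + t * eval (edgePt i j s t) (g j) = 0 := by
  rw [edge_row_rel' h, map_zero]

theorem offdiag_eq_zero [Infinite k] {b : Fin 4 → Fin 4 → k}
    (h : ∀ v : Fin 4 → k, ∑ i, v i * (b i 0 * (v 1 * v 2 * v 3) + b i 1 * (v 0 * v 2 * v 3) +
      b i 2 * (v 0 * v 1 * v 3) + b i 3 * (v 0 * v 1 * v 2)) = 0) {i l : Fin 4} (hil : i ≠ l) :
    b i l = 0 := by
  obtain ⟨x, hx0, hx1⟩ := exists_ne_zero_ne_one (k := k)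
  have h1 := h fun m => if m = l then 0 else 1
  have h2 := h fun m => if m = l then 0 else if m = i then x else 1
  refine (mul_eq_zero.1 (?_ : x * (x - 1) * b i l = 0)).resolve_left
    (mul_ne_zero hx0 (sub_ne_zero.2 hx1))
  fin_cases l <;> fin_cases i <;> first | exact absurd rfl hil | skip
  all_goals
    simp [Fin.sum_univ_four] at h1 h2
    simp only [Fin.mk_one, Fin.zero_eta, Fin.reduceFinMk]
    linear_combination h2 - x * h1

theorem row_cubic_core [Infinite k] {g : Fin 4 → R4 k} (hg : ∀ i, (g i).IsHomogeneous 3)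
    (hrel : ∑ i, X i * g i = 0) {ρ σ : Fin 3 → k} (hρ : Function.Injective ρ)
    (hσ : Function.Injective σ) (hρ0 : ∀ m, ρ m ≠ 0) (hσ0 : ∀ m, σ m ≠ 0)
    (h01 : ∀ m i, eval (edgePt 0 1 (ρ m) 1) (g i) = 0)
    (h23 : ∀ m i, eval (edgePt 2 3 (σ m) 1) (g i) = 0)
    {x y : Fin 4 → Fin 4 → k}
    (hxy : ∀ i j, i < 2 → 2 ≤ j → x i j ≠ y i j ∧ x i j ≠ 0 ∧ y i j ≠ 0 ∧
      (∀ l, eval (edgePt i j (x i j) 1) (g l) = 0) ∧ ∀ l, eval (edgePt i j (y i j) 1) (g l) = 0)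
    (hne : x 1 3 * y 1 3 * (x 0 2 * y 0 2) ≠ x 1 2 * y 1 2 * (x 0 3 * y 0 3))
    {p : Fin 4 → k} (hp0 : ∀ i, p i ≠ 0) (hp : ∀ l, eval p (g l) = 0) : ∀ i, g i = 0 := by
  have hr := edge_row_rel hrel
  have t01 := fun i => edge_three (hg i) hρ (h01 · i)
  have t23 := fun i => edge_three (hg i) hσ (h23 · i)
  have hpair : ∀ i j : Fin 4, i < 2 → 2 ≤ j → _ := fun i j hi hj =>
    edge_pair (hg i) (hg j) (hr i j) (hxy i j hi hj).1
      ((hxy i j hi hj).2.2.2.1 i) ((hxy i j hi hj).2.2.2.2 i)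
  obtain ⟨a00, a22, e02, -⟩ := hpair 0 2 (by decide) (by decide)
  obtain ⟨-, a33, e03, -⟩ := hpair 0 3 (by decide) (by decide)
  obtain ⟨a11, -, e12, -⟩ := hpair 1 2 (by decide) (by decide)
  obtain ⟨-, -, e13, -⟩ := hpair 1 3 (by decide) (by decide)
  have R0 : ρ 0 * ρ 1 * ρ 2 ≠ 0 := by simp [hρ0]
  have S0 : σ 0 * σ 1 * σ 2 ≠ 0 := by simp [hσ0]
  set R := ρ 0 * ρ 1 * ρ 2
  set S := σ 0 * σ 1 * σ 2
  have a02 : eval (Pi.single 0 1) (g 2) = 0 := by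
    refine (mul_eq_zero.1 (?_ : R * S * (x 1 3 * y 1 3 * (x 0 2 * y 0 2) -
      x 1 2 * y 1 2 * (x 0 3 * y 0 3)) * _ = 0)).resolve_left
      (mul_ne_zero (mul_ne_zero R0 S0) (sub_ne_zero.2 hne))
    have e1 := (t23 0).1
    have e2 := (t23 1).1
    rw [e02, e03] at e1
    rw [e12, e13, (t01 2).1, (t01 3).1] at e2
    linear_combination -(x 1 3 * y 1 3) * R * e1 - (x 0 3 * y 0 3) * e2
  have z03 : x 0 3 * y 0 3 ≠ 0 :=
    mul_ne_zero (hxy 0 3 (by decide) (by decide)).2.1 (hxy 0 3 (by decide) (by decide)).2.2.1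
  have a03 : eval (Pi.single 0 1) (g 3) = 0 := by
    refine (mul_eq_zero.1 (?_ : (x 0 3 * y 0 3) * _ = 0)).resolve_left z03
    have e1 := (t23 0).1
    rw [e02, e03, a02] at e1
    linear_combination - e1
  have a01 : eval (Pi.single 0 1) (g 1) = 0 := by
    refine (mul_eq_zero.1 (?_ : R * _ = 0)).resolve_left R0
    linear_combination (t01 1).1 - a11
  have A0 : ∀ i, eval (Pi.single 0 1) (g i) = 0 := by
    intro i; fin_cases i; exacts [a00, a01, a02, a03]
  have A1 : ∀ i, eval (Pi.single 1 1) (g i) = 0 := fun i => by rw [(t01 i).1, A0, mul_zero]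
  have A2 : ∀ i, eval (Pi.single 2 1) (g i) = 0 := by
    have a20 : eval (Pi.single 2 1) (g 0) = 0 := by rw [e02, A0, mul_zero]
    have a21 : eval (Pi.single 2 1) (g 1) = 0 := by rw [e12, A1, mul_zero]
    have a23 : eval (Pi.single 2 1) (g 3) = 0 := by
      refine (mul_eq_zero.1 (?_ : S * _ = 0)).resolve_left S0
      linear_combination (t23 3).1 - a33
    intro i; fin_cases i; exacts [a20, a21, a22, a23]
  have A3 : ∀ i, eval (Pi.single 3 1) (g i) = 0 := fun i => by rw [(t23 i).1, A2, mul_zero]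
  have A : ∀ j i, eval (Pi.single j 1) (g i) = 0 := by
    intro j; fin_cases j; exacts [A0, A1, A2, A3]
  have hE : ∀ l i j, i < j → ∀ s t, eval (edgePt i j s t) (g l) = 0 := by
    intro l i j hij
    by_cases h2 : i < 2 ∧ 2 ≤ j
    · obtain ⟨b1, b2, b3, b4, b5⟩ := hxy i j h2.1 h2.2
      exact edge_two (hg l) b1 b2 b3 (b4 l) (b5 l) (A i l) (A j l)
    · obtain ⟨rfl, rfl⟩ | ⟨rfl, rfl⟩ : (i = 0 ∧ j = 1) ∨ (i = 2 ∧ j = 3) := by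
        revert h2 hij; revert i j; decide
      · exact (t01 l).2 (A 0 l)
      · exact (t23 l).2 (A 2 l)
  choose b hb using fun l => cubic_of_edges (hg l) (hE l)
  have hoff : ∀ i l, i ≠ l → b i l = 0 := fun i l => offdiag_eq_zero fun v => by
    have := congrArg (eval v) hrel
    simpa only [map_sum, map_mul, eval_X, map_zero, hb] using this
  intro i
  have hd : b i i = 0 := by
    have := hp i
    rw [hb] at this
    fin_cases i <;> simpa [hoff, hp0] using this
  refine MvPolynomial.funext fun v => ?_
  have hz : ∀ l, b i l = 0 := fun l => by
    by_cases h : i = l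
    · rw [← h, hd]
    · exact hoff i l h
  simp [hb, hz]

theorem exists_point_coords [IsAlgClosed k] {f : R4 k} (hf : f.IsHomogeneous 3)
    (hirr : Irreducible f) : ∃ p, eval p f = 0 ∧ ∀ i, p i ≠ 0 := by
  have hP := prime_span hirr
  obtain ⟨p, hp, h⟩ := exists_point hirr (h := ∏ i, X i) (fun h => by
    obtain ⟨i, -, hi⟩ := (hP.prod_mem_iff).1 h
    exact not_mem_span_of_lt hf (isHomogeneous_X k i) (by norm_num) (X_ne_zero i) hi)
  rw [map_prod, Finset.prod_ne_zero_iff] at h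
  exact ⟨p, hp, fun i => by simpa using h i (Finset.mem_univ i)⟩

theorem row_cubic_base [IsAlgClosed k] {f : R4 k} (hf : f.IsHomogeneous 3) (hirr : Irreducible f)
    (F : Frame f) : ∃ S, S.card ≤ 15 ∧ OnX f S ∧ RelGood (rowRel (k := k)) (Ideal.span {0}) 3 S := by
  classical
  have := IsAlgClosed.instInfinite (K := k)
  obtain ⟨ρ, hρ, hρ0, hρf, -⟩ := edge_roots hf F (i := 0) (j := 1) (by decide)
  obtain ⟨σ, hσ, hσ0, hσf, -⟩ := edge_roots hf F (i := 2) (j := 3) (by decide)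
  obtain ⟨x2, y2, a1, a2, a3, a4, a5, -⟩ := exists_edge_pair hf F (i := 0) (j := 2) (by decide) 0 0
  obtain ⟨x3, y3, b1, b2, b3, b4, b5, -⟩ := exists_edge_pair hf F (i := 0) (j := 3) (by decide) 0 0
  obtain ⟨w2, z2, c1, c2, c3, c4, c5, -⟩ := exists_edge_pair hf F (i := 1) (j := 2) (by decide) 0 0
  obtain ⟨w3, z3, d1, d2, d3, d4, d5, d6, -⟩ := exists_edge_pair hf F (i := 1) (j := 3) (by decide)
    (w2 * z2 * (x3 * y3) / (x2 * y2)) 0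
  obtain ⟨p, hp, hp0⟩ := exists_point_coords hf hirr
  have hxy0 : x2 * y2 ≠ 0 := mul_ne_zero a2 a3
  let P : Fin 15 → Fin 4 → k := ![edgePt 0 1 (ρ 0) 1, edgePt 0 1 (ρ 1) 1, edgePt 0 1 (ρ 2) 1,
    edgePt 2 3 (σ 0) 1, edgePt 2 3 (σ 1) 1, edgePt 2 3 (σ 2) 1, edgePt 0 2 x2 1, edgePt 0 2 y2 1,
    edgePt 0 3 x3 1, edgePt 0 3 y3 1, edgePt 1 2 w2 1, edgePt 1 2 z2 1, edgePt 1 3 w3 1,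
    edgePt 1 3 z3 1, p]
  refine ⟨Finset.univ.image P, Finset.card_image_le.trans (by simp), fun v hv => ?_, ?_⟩
  · obtain ⟨m, -, rfl⟩ := Finset.mem_image.1 hv
    constructor
    · fin_cases m <;> simp only [P] <;>
        first | exact edgePt_ne_zero (by decide) _ | exact fun h => hp0 0 (congrFun h 0)
    · fin_cases m
      exacts [hρf 0, hρf 1, hρf 2, hσf 0, hσf 1, hσf 2, a4, a5, b4, b5, c4, c5, d4, d5, hp]
  · intro g hg hL hv
    have hv' : ∀ m e, eval (P m) (g e) = 0 := fun m e =>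
      hv _ (Finset.mem_image_of_mem _ (Finset.mem_univ m)) e
    have hL' := hL ()
    rw [rowRel_apply, Ideal.mem_span_singleton, zero_dvd_iff] at hL'
    have := row_cubic_core hg hL' hρ hσ hρ0 hσ0
      (fun m i => by fin_cases m; exacts [hv' 0 i, hv' 1 i, hv' 2 i])
      (fun m i => by fin_cases m; exacts [hv' 3 i, hv' 4 i, hv' 5 i])
      (x := fun i j => if i = 0 then if j = 2 then x2 else x3 else if j = 2 then w2 else w3)
      (y := fun i j => if i = 0 then if j = 2 then y2 else y3 else if j = 2 then z2 else z3)
      (fun i j hi hj => by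
        obtain rfl | rfl : i = 0 ∨ i = 1 := by revert hi; revert i; decide
        all_goals obtain rfl | rfl : j = 2 ∨ j = 3 := by revert hj; revert j; decide
        exacts [⟨a1, a2, a3, hv' 6, hv' 7⟩, ⟨b1, b2, b3, hv' 8, hv' 9⟩, ⟨c1, c2, c3, hv' 10, hv' 11⟩,
          ⟨d1, d2, d3, hv' 12, hv' 13⟩])
      (by
        simp only [Fin.reduceEq, if_true, if_false]
        intro h
        exact d6 (by rw [eq_div_iff hxy0]; simpa using h)) hp0 (hv' 14)
    intro e
    rw [this e]
    exact Ideal.zero_mem _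

end RowCubic

section AltCubic

variable {k : Type} [Field k]

theorem alt_cubic_core [Infinite k] {g : Fin 4 × Fin 4 → R4 k} (hg : ∀ e, (g e).IsHomogeneous 3)
    (hrel : ∀ i, ∑ j, X j * g (i, j) = 0) (hdiag : ∀ i, g (i, i) = 0)
    (hanti : ∀ i j, g (i, j) + g (j, i) = 0) {x y : Fin 4 → Fin 4 → k}
    (hxy : ∀ i j : Fin 4, i < j → x i j ≠ y i j ∧ x i j ≠ 0 ∧ y i j ≠ 0 ∧
      (∀ l, eval (edgePt i j (x i j) 1) (g l) = 0) ∧ ∀ l, eval (edgePt i j (y i j) 1) (g l) = 0)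
    (hne : ∀ a b c : Fin 4, a < b → b < c →
      x a c * y a c ≠ x a b * y a b * (x b c * y b c)) : ∀ e, g e = 0 := by
  have hpair : ∀ c i j : Fin 4, i < j → _ := fun c i j hij =>
    edge_pair (hg (c, i)) (hg (c, j)) (edge_row_rel (hrel c) i j) (hxy i j hij).1
      ((hxy i j hij).2.2.2.1 (c, i)) ((hxy i j hij).2.2.2.2 (c, i))
  have hA : ∀ a i j : Fin 4, eval (Pi.single a 1) (g (i, j)) + eval (Pi.single a 1) (g (j, i)) = 0 :=
    fun a i j => by rw [← map_add, hanti, map_zero]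
  have hface : ∀ a b c : Fin 4, a < b → b < c → eval (Pi.single a 1) (g (b, c)) = 0 ∧
      eval (Pi.single b 1) (g (a, c)) = 0 ∧ eval (Pi.single c 1) (g (a, b)) = 0 := by
    intro a b c hab hbc
    have e1 := (hpair c a b hab).2.2.1
    have e2 := (hpair b a c (hab.trans hbc)).2.2.1
    have e3 := (hpair a b c hbc).2.2.1
    have h1 : eval (Pi.single a 1) (g (b, c)) = 0 := by
      refine (mul_eq_zero.1 (?_ : (x a c * y a c - x a b * y a b * (x b c * y b c)) * _ = 0)).resolve_left
        (sub_ne_zero.2 (hne a b c hab hbc))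
      linear_combination e2 - hA c a b + e3 - x b c * y b c * hA b a c + x b c * y b c * e1 -
        x b c * y b c * (x a b * y a b) * hA a b c
    have h2 : eval (Pi.single b 1) (g (a, c)) = 0 := by
      linear_combination hA b a c - e1 + x a b * y a b * hA a b c - x a b * y a b * h1
    refine ⟨h1, h2, ?_⟩
    rw [e3, h2, mul_zero]
  have hV : ∀ a i j : Fin 4, eval (Pi.single a 1) (g (i, j)) = 0 := by
    have hneg : ∀ {a i j : Fin 4}, eval (Pi.single a 1) (g (j, i)) = 0 →
        eval (Pi.single a 1) (g (i, j)) = 0 := fun {a i j} h => by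
      linear_combination hA a i j - h
    have hself : ∀ a c : Fin 4, eval (Pi.single a 1) (g (c, a)) = 0 := by
      intro a c
      obtain ⟨d, hd⟩ := exists_ne a
      rcases hd.lt_or_gt with h | h
      · exact (hpair c d a h).2.1
      · exact (hpair c a d h).1
    intro a i j
    obtain rfl | hai := eq_or_ne a i
    · exact hneg (hself a j)
    obtain rfl | haj := eq_or_ne a j
    · exact hself a i
    obtain rfl | hij := eq_or_ne i j
    · rw [hdiag, map_zero]
    rcases hai.lt_or_gt with h1 | h1 <;> rcases haj.lt_or_gt with h2 | h2 <;>
      rcases hij.lt_or_gt with h3 | h3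
    · exact (hface a i j h1 h3).1
    · exact hneg (hface a j i h2 h3).1
    · exact absurd (h1.trans h3) h2.not_gt
    · exact hneg (hface j a i h2 h1).2.1
    · exact (hface i a j h1 h2).2.1
    · exact absurd (h2.trans h3) h1.not_gt
    · exact (hface i j a h3 h2).2.2
    · exact hneg (hface j i a h3 h1).2.2
  have hE : ∀ l i j, i < j → ∀ s t, eval (edgePt i j s t) (g l) = 0 := by
    intro l i j hij
    obtain ⟨b1, b2, b3, b4, b5⟩ := hxy i j hij
    exact edge_two (hg l) b1 b2 b3 (b4 l) (b5 l) (hV i _ _) (hV j _ _)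
  choose b hb using fun l => cubic_of_edges (hg l) (hE l)
  have hoff : ∀ c i l, i ≠ l → b (c, i) l = 0 := fun c i l => 
    offdiag_eq_zero (b := fun i => b (c, i)) fun v => by
      have := congrArg (eval v) (hrel c)
      simpa only [map_sum, map_mul, eval_X, map_zero, hb] using this
  have hd : ∀ c l, c ≠ l → b (c, l) l = 0 := by
    intro c l hcl
    have := congrArg (eval fun m => if m = l then 0 else 1) (hanti c l)
    rw [map_add, hb, hb, map_zero] at this
    have h2 : b (c, l) l + b (l, c) l = 0 := by
      revert this
      fin_cases l <;> simp
    rw [hoff l c l hcl, add_zero] at h2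
    exact h2
  rintro ⟨c, i⟩
  obtain rfl | hci := eq_or_ne c i
  · exact hdiag c
  refine MvPolynomial.funext fun v => ?_
  have hz : ∀ l, b (c, i) l = 0 := fun l => by
    by_cases h : i = l
    · rw [← h, hd c i hci]
    · exact hoff c i l h
  simp [hb, hz]

theorem alt_cubic_base [IsAlgClosed k] {f : R4 k} (hf : f.IsHomogeneous 3) (F : Frame f) :
    ∃ S, S.card ≤ 12 ∧ OnX f S ∧ RelGood (altRel (k := k)) (Ideal.span {0}) 3 S := by
  classical
  have := IsAlgClosed.instInfinite (K := k)
  obtain ⟨x01, y01, a1, a2, a3, a4, a5, -⟩ := exists_edge_pair hf F (i := 0) (j := 1) (by decide) 0 0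
  obtain ⟨x12, y12, b1, b2, b3, b4, b5, -⟩ := exists_edge_pair hf F (i := 1) (j := 2) (by decide) 0 0
  obtain ⟨x23, y23, c1, c2, c3, c4, c5, -⟩ := exists_edge_pair hf F (i := 2) (j := 3) (by decide) 0 0
  obtain ⟨x02, y02, d1, d2, d3, d4, d5, d6, -⟩ := exists_edge_pair hf F (i := 0) (j := 2) (by decide)
    (x01 * y01 * (x12 * y12)) 0
  obtain ⟨x13, y13, e1, e2, e3, e4, e5, e6, -⟩ := exists_edge_pair hf F (i := 1) (j := 3) (by decide)
    (x12 * y12 * (x23 * y23)) 0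
  obtain ⟨x03, y03, f1, f2, f3, f4, f5, f6, f7⟩ := exists_edge_pair hf F (i := 0) (j := 3) (by decide)
    (x01 * y01 * (x13 * y13)) (x02 * y02 * (x23 * y23))
  let P : Fin 12 → Fin 4 → k := ![edgePt 0 1 x01 1, edgePt 0 1 y01 1, edgePt 1 2 x12 1,
    edgePt 1 2 y12 1, edgePt 2 3 x23 1, edgePt 2 3 y23 1, edgePt 0 2 x02 1, edgePt 0 2 y02 1,
    edgePt 1 3 x13 1, edgePt 1 3 y13 1, edgePt 0 3 x03 1, edgePt 0 3 y03 1]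
  refine ⟨Finset.univ.image P, Finset.card_image_le.trans (by simp), fun v hv => ?_, ?_⟩
  · obtain ⟨m, -, rfl⟩ := Finset.mem_image.1 hv
    constructor
    · fin_cases m <;> exact edgePt_ne_zero (by decide) _
    · fin_cases m
      exacts [a4, a5, b4, b5, c4, c5, d4, d5, e4, e5, f4, f5]
  · intro g hg hL hv
    have hv' : ∀ m e, eval (P m) (g e) = 0 := fun m e =>
      hv _ (Finset.mem_image_of_mem _ (Finset.mem_univ m)) e
    simp only [Ideal.mem_span_singleton, zero_dvd_iff] at hL ⊢
    refine alt_cubic_core hg (fun i => ?_) (fun i => ?_) (fun i j => ?_)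
      (x := ![![0, x01, x02, x03], ![0, 0, x12, x13], ![0, 0, 0, x23], 0])
      (y := ![![0, y01, y02, y03], ![0, 0, y12, y13], ![0, 0, 0, y23], 0])
      (fun i j hij => ?_) (fun i j l hij hjl => ?_)
    · rw [← altRel_row g]; exact hL _
    · rw [← altRel_diag g]; exact hL _
    · rw [← altRel_add g]; exact hL _
    · fin_cases i <;> fin_cases j <;> first | exact absurd hij (by decide) | skip
      exacts [⟨a1, a2, a3, hv' 0, hv' 1⟩, ⟨d1, d2, d3, hv' 6, hv' 7⟩, ⟨f1, f2, f3, hv' 10, hv' 11⟩,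
        ⟨b1, b2, b3, hv' 2, hv' 3⟩, ⟨e1, e2, e3, hv' 8, hv' 9⟩, ⟨c1, c2, c3, hv' 4, hv' 5⟩]
    · fin_cases i <;> fin_cases j <;> first | exact absurd hij (by decide) | skip
      all_goals fin_cases l <;> first | exact absurd hjl (by decide) | skip
      exacts [d6, f6, f7, e6]

end AltCubic

section Quadric

variable {k : Type} [Field k]

theorem edge_quad {g : R4 k} (hg : g.IsHomogeneous 2) {i j : Fin 4} {x y : k} (hxy : x ≠ y)
    (gx : eval (edgePt i j x 1) g = 0) (gy : eval (edgePt i j y 1) g = 0) :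
    eval (Pi.single j 1) g = x * y * eval (Pi.single i 1) g ∧
      (eval (Pi.single i 1) g = 0 → ∀ s t, eval (edgePt i j s t) g = 0) := by
  obtain ⟨B, hB⟩ := eval_line_quadric hg (Pi.single i 1) (Pi.single j 1)
  simp only [edgePt] at *
  simp only [hB] at *
  obtain ⟨e1, e2⟩ := quad_roots (b := eval (Pi.single i 1) g) (c := B)
    (d := eval (Pi.single j 1) g) hxy (by linear_combination gx) (by linear_combination gy)
  refine ⟨by linear_combination e2, fun h s t => ?_⟩
  rw [h] at e1 e2
  rw [h, e1, e2]
  ring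

theorem edge_quad_one {g : R4 k} (hg : g.IsHomogeneous 2) {i j : Fin 4} {σ : k}
    (h : eval (edgePt i j σ 1) g = 0) (s t : k) : σ * eval (edgePt i j s t) g =
      (s - σ * t) * (σ * eval (Pi.single i 1) g * s - eval (Pi.single j 1) g * t) := by
  obtain ⟨B, hB⟩ := eval_line_quadric hg (Pi.single i 1) (Pi.single j 1)
  simp only [edgePt] at *
  rw [hB] at h ⊢
  linear_combination s * t * h

theorem row_quadric_core [Infinite k] {f : R4 k} (hpt : ∀ i, eval (Pi.single i 1) f ≠ 0)
    {g : Fin 4 → R4 k} (hg : ∀ i, (g i).IsHomogeneous 2) {c : k}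
    (hrel : ∑ i, X i * g i = C c * f) {x2 y2 x3 y3 z2 w2 σ τ τ' : k}
    (a1 : x2 ≠ y2) (a2 : x2 * y2 ≠ 0) (a3 : ∀ l, eval (edgePt 0 2 x2 1) (g l) = 0)
    (a4 : ∀ l, eval (edgePt 0 2 y2 1) (g l) = 0)
    (b1 : x3 ≠ y3) (b2 : x3 * y3 ≠ 0) (b3 : ∀ l, eval (edgePt 0 3 x3 1) (g l) = 0)
    (b4 : ∀ l, eval (edgePt 0 3 y3 1) (g l) = 0)
    (c1 : z2 ≠ w2) (c2 : z2 * w2 ≠ 0) (c3 : ∀ l, eval (edgePt 1 2 z2 1) (g l) = 0)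
    (c4 : ∀ l, eval (edgePt 1 2 w2 1) (g l) = 0)
    (d0 : σ ≠ 0) (d1 : ∀ l, eval (edgePt 1 3 σ 1) (g l) = 0) (d2 : σ ≠ τ) (d3 : σ ≠ τ') (d4 : τ ≠ τ')
    (d5 : eval (edgePt 1 3 τ 1) f = 0) (d6 : eval (edgePt 1 3 τ' 1) f = 0)
    (d7 : x3 * y3 * (z2 * w2) ≠ σ * τ * (x2 * y2)) (d8 : x3 * y3 * (z2 * w2) ≠ σ * τ' * (x2 * y2)) :
    ∀ i, g i = 0 := by
  have q02 := fun l => edge_quad (hg l) a1 (a3 l) (a4 l)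
  have q03 := fun l => edge_quad (hg l) b1 (b3 l) (b4 l)
  have q12 := fun l => edge_quad (hg l) c1 (c3 l) (c4 l)
  have hdiag : ∀ i, eval (Pi.single i 1) (g i) = c * eval (Pi.single i 1) f := fun i => by
    have := edge_row_rel' hrel i 0 1 0
    rw [edgePt_one_zero] at this
    simpa using this
  have hA : ∀ l, x2 * y2 * eval (Pi.single 3 1) (g l) =
      x3 * y3 * (z2 * w2) * eval (Pi.single 1 1) (g l) := fun l => by
    linear_combination x2 * y2 * (q03 l).1 - x3 * y3 * (q02 l).1 + x3 * y3 * (q12 l).1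
  have hτ : ∀ τ, σ ≠ τ → eval (edgePt 1 3 τ 1) f = 0 → x3 * y3 * (z2 * w2) ≠ σ * τ * (x2 * y2) →
      τ * eval (Pi.single 1 1) (g 1) + eval (Pi.single 1 1) (g 3) = 0 := by
    intro τ h1 h2 h3
    have := edge_row_rel' hrel 1 3 τ 1
    rw [map_mul, h2, mul_zero] at this
    have e1 := edge_quad_one (hg 1) (d1 1) τ 1
    have e3 := edge_quad_one (hg 3) (d1 3) τ 1
    refine (mul_eq_zero.1 (?_ : (τ - σ) * (σ * τ * (x2 * y2) - x3 * y3 * (z2 * w2)) * _ = 0)).resolve_left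
      (mul_ne_zero (sub_ne_zero.2 h1.symm) (sub_ne_zero.2 h3.symm))
    linear_combination x2 * y2 * σ * this - x2 * y2 * τ * e1 - x2 * y2 * e3 +
      (τ - σ) * (τ * hA 1 + hA 3)
  have h11 : eval (Pi.single 1 1) (g 1) = 0 := by
    refine (mul_eq_zero.1 (?_ : (τ - τ') * _ = 0)).resolve_left (sub_ne_zero.2 d4)
    linear_combination hτ τ d2 d5 d7 - hτ τ' d3 d6 d8
  have hc : c = 0 := by
    have := hdiag 1
    rw [h11] at this
    exact (mul_eq_zero.1 this.symm).resolve_right (hpt 1)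
  simp only [hc, zero_mul] at hdiag
  have hA0 : ∀ l, eval (Pi.single 0 1) (g l) = 0 := by
    intro l
    fin_cases l
    · exact hdiag 0
    · have e1 := (q12 1).1
      rw [hdiag 1, mul_zero, (q02 1).1] at e1
      exact (mul_eq_zero.1 e1).resolve_left a2
    · have e1 := (q02 2).1
      rw [hdiag 2] at e1
      exact (mul_eq_zero.1 e1.symm).resolve_left a2
    · have e1 := (q03 3).1
      rw [hdiag 3] at e1
      exact (mul_eq_zero.1 e1.symm).resolve_left b2
  have hA1 : ∀ l, eval (Pi.single 1 1) (g l) = 0 := fun l => by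
    have e1 := (q12 l).1
    rw [(q02 l).1, hA0, mul_zero] at e1
    exact (mul_eq_zero.1 e1.symm).resolve_left c2
  have hA3 : ∀ l, eval (Pi.single 3 1) (g l) = 0 := fun l => by rw [(q03 l).1, hA0, mul_zero]
  choose b d hbd using fun l => quadric_of_edges (hg l) ((q02 l).2 (hA0 l)) ((q03 l).2 (hA0 l))
    ((q12 l).2 (hA1 l)) (fun s t => by
      have := edge_quad_one (hg l) (d1 l) s t
      rw [hA1, hA3] at this
      simpa [d0] using this)
  have hv : ∀ v : Fin 4 → k, ∑ i, v i * (b i * (v 0 * v 1) + d i * (v 2 * v 3)) = 0 := fun v => by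
    have := congrArg (eval v) hrel
    simpa only [map_sum, map_mul, eval_X, map_zero, hbd, hc, zero_mul] using this
  obtain ⟨x, hx0, hx1⟩ := exists_ne_zero_ne_one (k := k)
  have hx : x * (x - 1) ≠ 0 := mul_ne_zero hx0 (sub_ne_zero.2 hx1)
  have e1 := hv ![1, 1, 0, 0]
  have e2 := hv ![x, 1, 0, 0]
  have e3 := hv ![1, 1, 1, 0]
  have e4 := hv ![1, 1, 0, 1]
  have e5 := hv ![0, 0, 1, 1]
  have e6 := hv ![0, 0, x, 1]
  have e7 := hv ![1, 0, 1, 1]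
  have e8 := hv ![0, 1, 1, 1]
  simp [Fin.sum_univ_four] at e1 e2 e3 e4 e5 e6 e7 e8
  have z0 : b 0 = 0 := (mul_eq_zero.1 (by linear_combination e2 - x * e1 :
    x * (x - 1) * b 0 = 0)).resolve_left hx
  have z1 : b 1 = 0 := by linear_combination e1 - z0
  have z2 : b 2 = 0 := by linear_combination e3 - e1
  have z3 : b 3 = 0 := by linear_combination e4 - e1
  have y2 : d 2 = 0 := (mul_eq_zero.1 (by linear_combination e6 - x * e5 :
    x * (x - 1) * d 2 = 0)).resolve_left hx
  have y3 : d 3 = 0 := by linear_combination e5 - y2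
  have y0 : d 0 = 0 := by linear_combination e7 - e5
  have y1 : d 1 = 0 := by linear_combination e8 - e5
  intro i
  refine MvPolynomial.funext fun v => ?_
  rw [hbd]
  fin_cases i <;> simp [*]

theorem span_pair_form {f p : R4 k} (hf : f.IsHomogeneous 3) (hp : p ∈ Ideal.span {f, X 0 * X 1})
    (h3 : p.IsHomogeneous 3) :
    ∃ (c : k) (n : Fin 4 → k), p = C c * f + X 0 * X 1 * ∑ i, X i * C (n i) := by
  obtain ⟨A, B, hAB⟩ := Ideal.mem_span_pair.1 hp
  have hq : (X 0 * X 1 : R4 k).IsHomogeneous 2 := (isHomogeneous_X _ _).mul (isHomogeneous_X _ _)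
  obtain ⟨c, hc⟩ := homog_zero (homogeneousComponent_isHomogeneous 0 A)
  obtain ⟨n, hn⟩ := homog_one_form (homogeneousComponent_isHomogeneous 1 B)
  refine ⟨c, n, ?_⟩
  rw [← homogeneousComponent_eq_self h3, ← hAB, mul_comm A, mul_comm B, map_add, ← hn, ← hc,
    ← homogComp_mul hq, mul_comm _ f, ← homogComp_mul hf]

theorem row_quadric_base [IsAlgClosed k] {f : R4 k} (hf : f.IsHomogeneous 3) (F : Frame f) :
    ∃ S, S.card ≤ 7 ∧ OnX f S ∧ (∀ v ∈ S, v 0 * v 1 = 0) ∧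
      RelGood (rowRel (k := k)) (Ideal.span {f, X 0 * X 1}) 2 S := by
  classical
  have := IsAlgClosed.instInfinite (K := k)
  obtain ⟨x2, y2, a1, a2, a3, a4, a5, -⟩ := exists_edge_pair hf F (i := 0) (j := 2) (by decide) 0 0
  obtain ⟨x3, y3, b1, b2, b3, b4, b5, -⟩ := exists_edge_pair hf F (i := 0) (j := 3) (by decide) 0 0
  obtain ⟨z2, w2, c1, c2, c3, c4, c5, -⟩ := exists_edge_pair hf F (i := 1) (j := 2) (by decide) 0 0
  have a6 := mul_ne_zero a2 a3
  obtain ⟨σ, τ, τ', d0, d1, d2, d3, d4, d5, d6, d7, d8⟩ : ∃ σ τ τ' : k, σ ≠ 0 ∧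
      eval (edgePt 1 3 σ 1) f = 0 ∧ σ ≠ τ ∧ σ ≠ τ' ∧ τ ≠ τ' ∧ eval (edgePt 1 3 τ 1) f = 0 ∧
      eval (edgePt 1 3 τ' 1) f = 0 ∧ x3 * y3 * (z2 * w2) ≠ σ * τ * (x2 * y2) ∧
      x3 * y3 * (z2 * w2) ≠ σ * τ' * (x2 * y2) := by
    obtain ⟨ρ, hρ, h0, h1, -⟩ := edge_roots hf F (i := 1) (j := 3) (by decide)
    have n01 : ρ 0 ≠ ρ 1 := hρ.ne (by decide)
    have n02 : ρ 0 ≠ ρ 2 := hρ.ne (by decide)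
    have n12 : ρ 1 ≠ ρ 2 := hρ.ne (by decide)
    by_cases a : x3 * y3 * (z2 * w2) = ρ 0 * ρ 1 * (x2 * y2)
    · refine ⟨ρ 2, ρ 0, ρ 1, h0 2, h1 2, n02.symm, n12.symm, n01, h1 0, h1 1, ?_, ?_⟩ <;>
        rw [a] <;> refine fun h => ?_ <;> replace h := mul_right_cancel₀ a6 h
      · exact n12 (mul_left_cancel₀ (h0 0) (h.trans (mul_comm _ _)))
      · exact n02 (mul_right_cancel₀ (h0 1) h)
    by_cases c : x3 * y3 * (z2 * w2) = ρ 0 * ρ 2 * (x2 * y2)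
    · refine ⟨ρ 1, ρ 0, ρ 2, h0 1, h1 1, n01.symm, n12, n02, h1 0, h1 2, ?_, ?_⟩
      · rwa [mul_comm (ρ 1)]
      · rw [c]
        exact fun h => n01 (mul_right_cancel₀ (h0 2) (mul_right_cancel₀ a6 h))
    exact ⟨ρ 0, ρ 1, ρ 2, h0 0, h1 0, n01, n02, n12, h1 1, h1 2, a, c⟩
  let P : Fin 7 → Fin 4 → k := ![edgePt 0 2 x2 1, edgePt 0 2 y2 1,
    edgePt 0 3 x3 1, edgePt 0 3 y3 1, edgePt 1 2 z2 1, edgePt 1 2 w2 1, edgePt 1 3 σ 1]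
  have hP01 : ∀ m, P m 0 * P m 1 = 0 := by
    intro m; fin_cases m <;> simp [P, edgePt_apply]
  refine ⟨Finset.univ.image P, Finset.card_image_le.trans (by simp), fun v hv => ?_, fun v hv => ?_, ?_⟩
  · obtain ⟨m, -, rfl⟩ := Finset.mem_image.1 hv
    constructor
    · fin_cases m <;> exact edgePt_ne_zero (by decide) _
    · fin_cases m
      exacts [a4, a5, b4, b5, c4, c5, d1]
  · obtain ⟨m, -, rfl⟩ := Finset.mem_image.1 hv
    exact hP01 m
  · intro g hg hL hv
    have hv' : ∀ m e, eval (P m) (g e) = 0 := fun m e =>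
      hv _ (Finset.mem_image_of_mem _ (Finset.mem_univ m)) e
    have hL' := hL ()
    rw [rowRel_apply] at hL'
    have h3 : (∑ i, X i * g i).IsHomogeneous 3 :=
      IsHomogeneous.sum _ _ _ fun i _ => (isHomogeneous_X k i).mul (hg i)
    obtain ⟨c, n, hcn⟩ := span_pair_form hf hL' h3
    have hq : ∀ i, (C (n i) * (X 0 * X 1) : R4 k).IsHomogeneous 2 := fun i =>
      ((isHomogeneous_X k 0).mul (isHomogeneous_X k 1)).C_mul (n i)
    have hrel : ∑ i, X i * (g i - C (n i) * (X 0 * X 1)) = C c * f := by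
      simp only [mul_sub, Finset.sum_sub_distrib, hcn, Finset.mul_sum]
      rw [sub_eq_iff_eq_add]
      exact congrArg _ (Finset.sum_congr rfl fun i _ => by ring)
    have hz : ∀ m l, eval (P m) (g l - C (n l) * (X 0 * X 1)) = 0 := fun m l => by
      rw [map_sub, hv', map_mul, map_mul, eval_X, eval_X, hP01, mul_zero, sub_zero]
    have key := row_quadric_core F.pt (fun i => (hg i).sub (hq i)) hrel a1 a6 (hz 0) (hz 1) b1
      (mul_ne_zero b2 b3) (hz 2) (hz 3) c1 (mul_ne_zero c2 c3) (hz 4) (hz 5) d0 (hz 6) d2 d3 d4 d5 d6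
      d7 d8
    intro e
    rw [sub_eq_zero.1 (key e)]
    exact Ideal.mul_mem_left _ _ (Ideal.subset_span (by simp))

end Quadric

section AltLift

variable {k : Type} [Field k]

theorem exists_strict {J : Ideal (R4 k)} {s : ℕ} {S : Finset (Fin 4 → k)}
    {g : Fin 4 × Fin 4 → R4 k} (hg : ∀ e, (g e).IsHomogeneous s) (hL : ∀ c, altRel g c ∈ J)
    (hv : ∀ v ∈ S, ∀ e, eval v (g e) = 0) :
    ∃ h : Fin 4 × Fin 4 → R4 k, (∀ e, (h e).IsHomogeneous s) ∧ (∀ v ∈ S, ∀ e, eval v (h e) = 0) ∧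
      (∀ e, g e - h e ∈ J) ∧ (∀ i, h (i, i) = 0) ∧ (∀ i j, h (i, j) + h (j, i) = 0) ∧
      ∀ i, ∑ j, X j * h (i, j) ∈ J := by
  let h : Fin 4 × Fin 4 → R4 k := fun e => if e.1 < e.2 then g e else
    if e.2 < e.1 then - g (e.2, e.1) else 0
  have hJ : ∀ e, g e - h e ∈ J := by
    rintro ⟨i, j⟩
    simp only [h]
    split_ifs with h1 h2
    · simp
    · rw [sub_neg_eq_add, ← altRel_add g i j]
      exact hL _
    · obtain rfl : i = j := le_antisymm (not_lt.1 h2) (not_lt.1 h1)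
      rw [sub_zero, ← altRel_diag g i]
      exact hL _
  refine ⟨h, fun e => ?_, fun v hvS e => ?_, hJ, fun i => by simp [h], fun i j => ?_, fun i => ?_⟩
  · simp only [h]
    split_ifs
    exacts [hg e, (hg _).neg, isHomogeneous_zero _ _ _]
  · simp only [h]
    split_ifs
    exacts [hv v hvS e, by rw [map_neg, hv v hvS, neg_zero], map_zero _]
  · rcases lt_trichotomy i j with h1 | rfl | h1
    · simp [h, h1, h1.not_gt]
    · simp [h]
    · simp [h, h1, h1.not_gt]
  · have : ∑ j, X j * h (i, j) = ∑ j, X j * g (i, j) - ∑ j, X j * (g (i, j) - h (i, j)) := by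
      rw [← Finset.sum_sub_distrib]
      exact Finset.sum_congr rfl fun j _ => by ring
    rw [this, ← altRel_row g]
    exact J.sub_mem (hL _) (J.sum_mem fun j _ => J.mul_mem_left _ (hJ _))

theorem sum_rows_eq_zero {h : Fin 4 × Fin 4 → R4 k} (hd : ∀ i, h (i, i) = 0)
    (ha : ∀ i j, h (i, j) + h (j, i) = 0) : ∑ i, X i * ∑ j, X j * h (i, j) = 0 := by
  have h10 := ha 0 1
  have h20 := ha 0 2
  have h30 := ha 0 3
  have h21 := ha 1 2
  have h31 := ha 1 3
  have h32 := ha 2 3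
  simp only [Fin.sum_univ_four, hd]
  linear_combination X 0 * X 1 * h10 + X 0 * X 2 * h20 + X 0 * X 3 * h30 + X 1 * X 2 * h21 +
    X 1 * X 3 * h31 + X 2 * X 3 * h32

theorem alternating_of_sum_eq_zero {n : Fin 4 → Fin 4 → k}
    (h : (∑ i, X i * ∑ j, X j * C (n i j) : R4 k) = 0) :
    (∀ i, n i i = 0) ∧ ∀ i j, n i j + n j i = 0 := by
  have hv : ∀ v : Fin 4 → k, ∑ i, v i * ∑ j, v j * n i j = 0 := fun v => by
    have := congrArg (eval v) h
    simpa using this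
  have hd : ∀ i, n i i = 0 := fun i => by
    have := hv (Pi.single i 1)
    simpa [Pi.single_apply] using this
  refine ⟨hd, fun i j => ?_⟩
  obtain rfl | hij := eq_or_ne i j
  · rw [hd, add_zero]
  · have := hv (edgePt i j 1 1)
    simp only [edgePt_apply, add_mul, ite_mul, one_mul, zero_mul, Finset.sum_add_distrib,
      Finset.sum_ite_eq', Finset.mem_univ, if_true, hd] at this
    linear_combination this

theorem alt_lift {J : Ideal (R4 k)} {s : ℕ} {S : Finset (Fin 4 → k)} {q : R4 k}
    (hq : q.IsHomogeneous s) (hq0 : q ≠ 0) (hqS : ∀ v ∈ S, eval v q = 0) (hqJ : q ∈ J)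
    (hcore : RelGood (altRel (k := k)) (Ideal.span {0}) s S) {h : Fin 4 × Fin 4 → R4 k}
    (hh : ∀ e, (h e).IsHomogeneous s) (hv : ∀ v ∈ S, ∀ e, eval v (h e) = 0)
    (hd : ∀ i, h (i, i) = 0) (ha : ∀ i j, h (i, j) + h (j, i) = 0) {n : Fin 4 → Fin 4 → k}
    (hrow : ∀ i, ∑ j, X j * h (i, j) = q * ∑ j, X j * C (n i j)) (e : Fin 4 × Fin 4) : h e ∈ J := by
  obtain ⟨nd, na⟩ := alternating_of_sum_eq_zero (n := n) (by
    have := sum_rows_eq_zero hd ha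
    simp only [hrow, mul_left_comm _ q, ← Finset.mul_sum] at this
    exact (mul_eq_zero.1 this).resolve_left hq0)
  have key := hcore (fun e => h e - C (n e.1 e.2) * q) (fun e => (hh e).sub (hq.C_mul _)) (by
    rintro (i | i | ⟨i, j⟩)
    · rw [altRel_row, Ideal.mem_span_singleton, zero_dvd_iff]
      simp only [mul_sub, Finset.sum_sub_distrib, hrow, Finset.mul_sum]
      rw [sub_eq_zero]
      exact Finset.sum_congr rfl fun i _ => by ring
    · rw [altRel_diag, hd, nd]; simp
    · rw [altRel_add, Ideal.mem_span_singleton, zero_dvd_iff]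
      have : (C (n i j) + C (n j i) : R4 k) = 0 := by rw [← C_add, na, C_0]
      linear_combination ha i j - q * this) (fun v hvS e => by
    rw [map_sub, hv v hvS, map_mul, hqS v hvS, mul_zero, sub_zero]) e
  rw [Ideal.mem_span_singleton, zero_dvd_iff, sub_eq_zero] at key
  rw [key]
  exact J.mul_mem_left _ hqJ

theorem alt_base_three {f : R4 k} (hf : f.IsHomogeneous 3) (hf0 : f ≠ 0)
    {S : Finset (Fin 4 → k)} (hS : OnX f S)
    (hcore : RelGood (altRel (k := k)) (Ideal.span {0}) 3 S) :
    RelGood (altRel (k := k)) (Ideal.span {f}) 3 S := by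
  intro g hg hL hv e
  obtain ⟨h, hh, hhv, hgh, hd, ha, hr⟩ := exists_strict hg hL hv
  have hn : ∀ i, ∃ n : Fin 4 → k, ∑ j, X j * h (i, j) = f * ∑ j, X j * C (n j) := fun i => by
    obtain ⟨q, hq, e⟩ := mem_span_homog (n := 1) hf (IsHomogeneous.sum _ _ _ fun j _ => by
      rw [Nat.add_comm]
      exact (isHomogeneous_X k j).mul (hh (i, j))) (hr i)
    obtain ⟨n, hn⟩ := homog_one_form hq
    exact ⟨n, by rw [e, hn]⟩
  choose n hn using hn
  have := alt_lift hf hf0 (fun v hv => (hS v hv).2) (Ideal.mem_span_singleton_self f) hcore hh hhv hd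
    ha hn e
  simpa using add_mem (hgh e) this

theorem row_base_three {f : R4 k} (hf : f.IsHomogeneous 3)
    {S : Finset (Fin 4 → k)} (hS : OnX f S)
    (hcore : RelGood (rowRel (k := k)) (Ideal.span {0}) 3 S) :
    RelGood (rowRel (k := k)) (Ideal.span {f}) 3 S := by
  intro g hg hL hv e
  have hL' := hL ()
  rw [rowRel_apply] at hL'
  obtain ⟨q, hq, hqe⟩ := mem_span_homog (n := 1) hf (IsHomogeneous.sum _ _ _ fun j _ => by
      rw [Nat.add_comm]
      exact (isHomogeneous_X k j).mul (hg j)) hL'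
  obtain ⟨n, rfl⟩ := homog_one_form hq
  have key := hcore (fun e => g e - C (n e) * f) (fun e => (hg e).sub (hf.C_mul _)) (fun _ => by
    rw [rowRel_apply, Ideal.mem_span_singleton, zero_dvd_iff]
    simp only [mul_sub, Finset.sum_sub_distrib, hqe, Finset.mul_sum]
    rw [sub_eq_zero]
    exact Finset.sum_congr rfl fun i _ => by ring) (fun v hvS e => by
    rw [map_sub, hv v hvS, map_mul, (hS v hvS).2, mul_zero, sub_zero]) e
  rw [Ideal.mem_span_singleton, zero_dvd_iff, sub_eq_zero] at key
  rw [key]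
  exact Ideal.mul_mem_left _ _ (Ideal.mem_span_singleton_self f)

end AltLift

section AltQuadric

variable {k : Type} [Field k]

theorem quadric_of_vertices {g : R4 k} (hg : g.IsHomogeneous 2)
    (h : ∀ i, eval (Pi.single i 1) g = 0) (v : Fin 4 → k) : eval v g =
      v 0 * v 1 * eval (edgePt 0 1 1 1) g + v 0 * v 2 * eval (edgePt 0 2 1 1) g +
      v 0 * v 3 * eval (edgePt 0 3 1 1) g + v 1 * v 2 * eval (edgePt 1 2 1 1) g +
      v 1 * v 3 * eval (edgePt 1 3 1 1) g + v 2 * v 3 * eval (edgePt 2 3 1 1) g := by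
  obtain ⟨c, rfl⟩ := homog_two_form hg
  have hc : ∀ i, c i i = 0 := fun i => by simpa [Pi.single_apply] using h i
  simp [Fin.sum_univ_four, edgePt_apply, hc]
  ring

theorem edge_mem_of_lt {i j a b a' b' : Fin 4} (hij : i ≠ j) (hab : a < b) (h1 : a ≠ i) (h2 : a ≠ j)
    (h3 : b ≠ i) (h4 : b ≠ j) (hab' : a' < b') (h : a' ≠ a ∨ b' ≠ b) :
    a' = i ∨ a' = j ∨ b' = i ∨ b' = j := by
  decide +revert

theorem edge_sum_eq {q : Fin 4 → Fin 4 → k} {a b : Fin 4} (hab : a < b)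
    (hz : ∀ a' b', a' < b' → a' ≠ a ∨ b' ≠ b → q a' b' = 0) :
    q 0 1 + q 0 2 + q 0 3 + q 1 2 + q 1 3 + q 2 3 = q a b := by
  have f1 := hz 0 1 (by decide)
  have f2 := hz 0 2 (by decide)
  have f3 := hz 0 3 (by decide)
  have f4 := hz 1 2 (by decide)
  have f5 := hz 1 3 (by decide)
  have f6 := hz 2 3 (by decide)
  clear hz
  fin_cases a <;> fin_cases b <;> first | exact absurd hab (by decide) | skip
  · rw [f2 (by decide), f3 (by decide), f4 (by decide), f5 (by decide), f6 (by decide)]; simp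
  · rw [f1 (by decide), f3 (by decide), f4 (by decide), f5 (by decide), f6 (by decide)]; simp
  · rw [f1 (by decide), f2 (by decide), f4 (by decide), f5 (by decide), f6 (by decide)]; simp
  · rw [f1 (by decide), f2 (by decide), f3 (by decide), f5 (by decide), f6 (by decide)]; simp
  · rw [f1 (by decide), f2 (by decide), f3 (by decide), f4 (by decide), f6 (by decide)]; simp
  · rw [f1 (by decide), f2 (by decide), f3 (by decide), f4 (by decide), f5 (by decide)]; simp

theorem alt_frame_core [Infinite k] {g : Fin 4 × Fin 4 → R4 k} (hg : ∀ e, (g e).IsHomogeneous 2)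
    (hrel : ∀ i, ∑ j, X j * g (i, j) = 0) (hdiag : ∀ i, g (i, i) = 0)
    (hanti : ∀ i j, g (i, j) + g (j, i) = 0) (hv : ∀ i e, eval (Pi.single i 1) (g e) = 0)
    {w : Fin 4 → k} (hw : ∀ i, w i ≠ 0) (hgw : ∀ e, eval w (g e) = 0) : ∀ e, g e = 0 := by
  have hedge : ∀ c a b, a ≠ b → eval (edgePt a b 1 1) (g (c, a)) = 0 := by
    intro c a b hab
    have hline : ∀ e s t, eval (edgePt a b s t) (g e) = s * t * eval (edgePt a b 1 1) (g e) := by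
      intro e s t
      obtain ⟨B, hB⟩ := eval_line_quadric (hg e) (Pi.single a 1) (Pi.single b 1)
      simp only [edgePt, hB, hv]
      ring
    obtain ⟨x, hx0, hx1⟩ := exists_ne_zero_ne_one (k := k)
    have e1 := edge_row_rel (hrel c) a b 1 1
    have e2 := edge_row_rel (hrel c) a b x 1
    rw [hline, hline (c, b)] at e2
    refine (mul_eq_zero.1 (?_ : (x * (x - 1)) * _ = 0)).resolve_left
      (mul_ne_zero hx0 (sub_ne_zero.2 hx1))
    linear_combination e2 - x * e1
  have hedge' : ∀ c a b, a ≠ b → eval (edgePt a b 1 1) (g (a, c)) = 0 := fun c a b hab => by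
    have := congrArg (eval (edgePt a b 1 1)) (hanti a c)
    rw [map_add, hedge c a b hab, add_zero, map_zero] at this
    exact this
  have hzero : ∀ i j, i ≠ j → ∀ a b, a ≠ b → (a = i ∨ a = j ∨ b = i ∨ b = j) →
      eval (edgePt a b 1 1) (g (i, j)) = 0 := by
    rintro i j - a b hab (rfl | rfl | rfl | rfl)
    · exact hedge' _ _ _ hab
    · exact hedge _ _ _ hab
    · rw [edgePt_comm]; exact hedge' _ _ _ hab.symm
    · rw [edgePt_comm]; exact hedge _ _ _ hab.symm
  rintro ⟨i, j⟩
  obtain rfl | hij := eq_or_ne i j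
  · exact hdiag i
  have hq := quadric_of_vertices (hg (i, j)) (fun l => hv l _)
  have hz := hzero i j hij
  have hqw := hq w
  rw [hgw] at hqw
  refine MvPolynomial.funext fun v => ?_
  rw [hq, map_zero]
  have key : ∀ a b : Fin 4, a < b → eval (edgePt a b 1 1) (g (i, j)) = 0 := by
    intro a b hab
    by_cases h : a = i ∨ a = j ∨ b = i ∨ b = j
    · exact hz a b hab.ne h
    · refine (mul_eq_zero.1 (?_ : (w a * w b) * _ = 0)).resolve_left (mul_ne_zero (hw a) (hw b))
      push Not at h
      obtain ⟨h1, h2, h3, h4⟩ := h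
      rw [← edge_sum_eq (q := fun a b => w a * w b * eval (edgePt a b 1 1) (g (i, j))) hab
        fun a' b' hab' h => ?_]
      · exact hqw.symm
      · rw [hz a' b' hab'.ne (edge_mem_of_lt hij hab h1 h2 h3 h4 hab' h), mul_zero]
  simp [key]

theorem alt_frame_good [Infinite k] {w : Fin 4 → k} (hw : ∀ i, w i ≠ 0) {S : Finset (Fin 4 → k)}
    (hS : ∀ i, Pi.single i 1 ∈ S) (hwS : w ∈ S) :
    RelGood (altRel (k := k)) (Ideal.span {0}) 2 S := by
  intro g hg hL hv
  simp only [Ideal.mem_span_singleton, zero_dvd_iff] at hL ⊢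
  exact alt_frame_core hg (fun i => by rw [← altRel_row g]; exact hL _)
    (fun i => by rw [← altRel_diag g]; exact hL _) (fun i j => by rw [← altRel_add g]; exact hL _)
    (fun i e => hv _ (hS i) e) hw fun e => hv _ hwS e

theorem alt_edge_good [Infinite k] {α β γ δ ε : k} (h1 : β + ε * α ≠ 0) (h2 : α * δ - β * γ ≠ 0)
    (h3 : δ + ε * γ ≠ 0) {T : Finset (Fin 4 → k)} (t1 : edgePt 2 1 α 1 ∈ T) (t2 : edgePt 3 1 β 1 ∈ T)
    (t3 : edgePt 2 0 γ 1 ∈ T) (t4 : edgePt 3 0 δ 1 ∈ T) (t5 : edgePt 3 2 ε 1 ∈ T) :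
    RelGood (altRel (k := k)) (Ideal.span {0}) 2 T := by
  classical
  let D : Matrix (Fin 4) (Fin 4) k := !![0, 0, 1, 1; 1, 1, 0, 0; α, 0, γ, 0; 0, β, 0, δ]
  have hD : D.det = -(α * δ - β * γ) := by
    simp [D, Matrix.det_succ_row_zero, Fin.sum_univ_succ, Fin.succAbove]
    ring
  have hu : IsUnit D.det := by rw [hD]; exact (neg_ne_zero.2 h2).isUnit
  obtain ⟨r, hr⟩ : ∃ r, (α * δ - β * γ) * r = 1 := ⟨_, mul_inv_cancel₀ h2⟩
  have hr0 : r ≠ 0 := right_ne_zero_of_mul_eq_one hr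
  let w : Fin 4 → k := ![(δ + ε * γ) * r, -((δ + ε * γ) * r), -((β + ε * α) * r), (β + ε * α) * r]
  have hw : ∀ i, w i ≠ 0 := by
    intro i
    fin_cases i
    exacts [mul_ne_zero h3 hr0, neg_ne_zero.2 (mul_ne_zero h3 hr0), neg_ne_zero.2 (mul_ne_zero h1 hr0),
      mul_ne_zero h1 hr0]
  have := transferable_altRel D⁻¹ D (Matrix.mul_nonsing_inv D hu) (Matrix.nonsing_inv_mul D hu)
    (0 : R4 k) 2 (insert w (Finset.univ.image fun i => Pi.single i 1)) T ?_
    (alt_frame_good hw (by simp) (by simp))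
  · simpa using this
  · intro v hv
    rw [Finset.mem_insert, Finset.mem_image] at hv
    rcases hv with rfl | ⟨i, -, rfl⟩
    · convert t5 using 1
      funext i
      fin_cases i <;> simp [D, w, Matrix.mulVec, dotProduct, Fin.sum_univ_four, edgePt_apply]
      · linear_combination hr
      · linear_combination ε * hr
    · rw [Matrix.mulVec_single_one]
      fin_cases i
      · convert t1 using 1; funext i; fin_cases i <;> simp [D, edgePt_apply]
      · convert t2 using 1; funext i; fin_cases i <;> simp [D, edgePt_apply]
      · convert t3 using 1; funext i; fin_cases i <;> simp [D, edgePt_apply]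
      · convert t4 using 1; funext i; fin_cases i <;> simp [D, edgePt_apply]

theorem exists_avoid_two {α : Type} {ρ : Fin 3 → α} (hρ : Function.Injective ρ) (b b' : α) :
    ∃ m, ρ m ≠ b ∧ ρ m ≠ b' := by
  classical
  obtain ⟨x, hx, hx'⟩ := Finset.exists_mem_notMem_of_card_lt_card (s := {b, b'})
    (t := Finset.univ.image ρ) (by
      rw [Finset.card_image_of_injective _ hρ]
      exact lt_of_le_of_lt Finset.card_le_two (by simp))
  obtain ⟨m, -, rfl⟩ := Finset.mem_image.1 hx
  exact ⟨m, by simpa using hx'⟩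

theorem alt_quadric_base [IsAlgClosed k] {f : R4 k} (hf : f.IsHomogeneous 3) (F : Frame f) :
    ∃ S, S.card ≤ 5 ∧ OnX f S ∧ (∀ v ∈ S, v 0 * v 1 = 0) ∧
      RelGood (altRel (k := k)) (Ideal.span {f, X 0 * X 1}) 2 S := by
  classical
  have := IsAlgClosed.instInfinite (K := k)
  obtain ⟨α, -, -, hα, -, a1, -⟩ := exists_edge_pair hf F (i := 2) (j := 1) (by decide) 0 0
  obtain ⟨γ, -, -, hγ, -, c1, -⟩ := exists_edge_pair hf F (i := 2) (j := 0) (by decide) 0 0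
  obtain ⟨ε, -, -, hε, -, e1, -⟩ := exists_edge_pair hf F (i := 3) (j := 2) (by decide) 0 0
  obtain ⟨β, hβ, b1⟩ : ∃ β, β + ε * α ≠ 0 ∧ eval (edgePt 3 1 β 1) f = 0 := by
    obtain ⟨x, y, hxy, -, -, hx, hy, -⟩ := exists_edge_pair hf F (i := 3) (j := 1) (by decide) 0 0
    by_cases h : x + ε * α = 0
    · exact ⟨y, fun h' => hxy (add_right_cancel (h.trans h'.symm)), hy⟩
    · exact ⟨x, h, hx⟩
  obtain ⟨δ, hδ, hδ', d1⟩ : ∃ δ, α * δ - β * γ ≠ 0 ∧ δ + ε * γ ≠ 0 ∧ eval (edgePt 3 0 δ 1) f = 0 := by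
    obtain ⟨ρ, hρ, -, h1, -⟩ := edge_roots hf F (i := 3) (j := 0) (by decide)
    obtain ⟨m, hm, hm'⟩ := exists_avoid_two hρ (β * γ / α) (-(ε * γ))
    refine ⟨ρ m, fun h => hm ?_, fun h => hm' (by linear_combination h), h1 m⟩
    rw [eq_div_iff hα]
    linear_combination h
  let P : Fin 5 → Fin 4 → k := ![edgePt 2 1 α 1, edgePt 3 1 β 1, edgePt 2 0 γ 1, edgePt 3 0 δ 1,
    edgePt 3 2 ε 1]
  have hP : ∀ m, P m ∈ Finset.univ.image P := fun m => Finset.mem_image_of_mem _ (Finset.mem_univ m)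
  have hP01 : ∀ v ∈ Finset.univ.image P, v 0 * v 1 = 0 := by
    intro v hv
    obtain ⟨m, -, rfl⟩ := Finset.mem_image.1 hv
    fin_cases m <;> simp [P, edgePt_apply]
  refine ⟨Finset.univ.image P, Finset.card_image_le.trans (by simp), fun v hv => ?_, hP01, ?_⟩
  · obtain ⟨m, -, rfl⟩ := Finset.mem_image.1 hv
    constructor
    · fin_cases m <;> exact edgePt_ne_zero (by decide) _
    · fin_cases m
      exacts [a1, b1, c1, d1, e1]
  · intro g hg hL hv e
    obtain ⟨h, hh, hhv, hgh, hd, ha, hr⟩ := exists_strict hg hL hv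
    have hn : ∀ i, ∃ (c : k) (n : Fin 4 → k),
        ∑ j, X j * h (i, j) = C c * f + X 0 * X 1 * ∑ j, X j * C (n j) := fun i =>
      span_pair_form hf (hr i) (IsHomogeneous.sum _ _ _ fun j _ => (isHomogeneous_X k j).mul (hh (i, j)))
    choose c n hn using hn
    have hc : ∀ i, c i = 0 := fun i => by
      have := congrArg (eval (Pi.single i 1)) (sum_rows_eq_zero hd ha)
      simp only [hn] at this
      have h01 : (Pi.single i 1 : Fin 4 → k) 0 * (Pi.single i 1 : Fin 4 → k) 1 = 0 := by
        fin_cases i <;> simp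
      simp only [map_sum, map_mul, map_add, eval_X, eval_C, h01, zero_mul, add_zero, map_zero] at this
      simpa [Pi.single_apply, F.pt i] using this
    have hqJ : X 0 * X 1 ∈ Ideal.span {f, X 0 * X 1} := Ideal.subset_span (by simp)
    have := alt_lift ((isHomogeneous_X k 0).mul (isHomogeneous_X k 1))
      (mul_ne_zero (X_ne_zero _) (X_ne_zero _))
      (fun v hv => by rw [map_mul, eval_X, eval_X, hP01 v hv])
      hqJ (alt_edge_good hβ hδ hδ' (hP 0) (hP 1) (hP 2) (hP 3) (hP 4)) hh hhv
      hd ha (n := n) (fun i => by rw [hn, hc, C_0, zero_mul, zero_add]) e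
    simpa using add_mem (hgh e) this

end AltQuadric

section Existence

variable {k : Type} [Field k]

/-- A surface equation for which the transfer and frame arguments apply. -/
structure CubicEq (f : R4 k) : Prop where
  homog : f.IsHomogeneous 3
  irred : Irreducible f
  discr : ∃ u w, (lineCubic f u w).discr ≠ 0

theorem cubicEq_of_smooth [IsAlgClosed k] (S : SmoothCubicSurface k) : CubicEq S.f :=
  ⟨S.homog, S.irred, exists_discr_ne_zero S.homog S.irred S.smooth⟩

theorem transfer_back {ι κ : Type} {L : (ι → R4 k) →ₗ[R4 k] (κ → R4 k)} (hL : Transferable L)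
    {E D : Matrix (Fin 4) (Fin 4) k} (h : D * E = 1) (h' : E * D = 1) {f : R4 k} {s : ℕ}
    {T : Finset (Fin 4 → k)} (hT : OnX (linChange E f) T)
    (hg : RelGood L (Ideal.span {linChange E f}) s T) :
    ∃ S, S.card ≤ T.card ∧ OnX f S ∧ RelGood L (Ideal.span {f}) s S := by
  classical
  have hf : linChange D (linChange E f) = f := linChange_linChange h' f
  refine ⟨T.image E.mulVec, Finset.card_image_le, ?_, ?_⟩
  · simpa only [hf] using onX_linChange h hT
  · simpa only [hf] using hL D E h' h (linChange E f) s T (T.image E.mulVec)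
      (fun v hv => Finset.mem_image_of_mem _ hv) hg

theorem good_step [IsAlgClosed k] {ι κ : Type} [Fintype ι]
    {L : (ι → R4 k) →ₗ[R4 k] (κ → R4 k)} (hL : Transferable L) {b : ℕ}
    (hbase : ∀ f : R4 k, f.IsHomogeneous 3 → Frame f → ∃ S, S.card ≤ b ∧ OnX f S ∧
      (∀ v ∈ S, v 0 * v 1 = 0) ∧ RelGood L (Ideal.span {f, X 0 * X 1}) 2 S)
    {f : R4 k} (H : CubicEq f) {s : ℕ} {S : Finset (Fin 4 → k)} (hS : OnX f S)
    (hg : RelGood L (Ideal.span {f}) s S) :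
    ∃ S', S'.card ≤ S.card + (b + 6 * s) ∧ OnX f S' ∧ RelGood L (Ideal.span {f}) (s + 2) S' := by
  classical
  obtain ⟨E, D, h', h, F, hD⟩ := exists_frame H.irred.ne_zero H.discr S fun v hv => (hS v hv).1
  obtain ⟨T, hT1, hT2, hT3, hT4⟩ := hbase _ (linChange_homog E H.homog) F
  obtain ⟨T', hT1', hT2', hT3', hT4'⟩ := degree_steps (linChange_homog E H.homog) F hT2 hT3 hT4 s
  rw [Nat.add_comm 2] at hT4'
  obtain ⟨U, hU1, hU2, hU3⟩ := quadric_step (linChange_homog E H.homog)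
    (linChange_irreducible h h' H.irred) (onX_linChange h' hS) hT2' (fun v hv => by
      obtain ⟨w, hw, rfl⟩ := Finset.mem_image.1 hv
      exact mul_ne_zero (hD w hw 0) (hD w hw 1))
    (hL E D h h' f s S _ (fun v hv => Finset.mem_image_of_mem _ hv) hg) hT4'
  obtain ⟨V, hV1, hV2, hV3⟩ := transfer_back hL h h' hU2 hU3
  have := Finset.card_image_le (s := S) (f := D.mulVec)
  exact ⟨V, by lia, hV2, hV3⟩

theorem good_three [IsAlgClosed k] {ι κ : Type}
    {L : (ι → R4 k) →ₗ[R4 k] (κ → R4 k)} (hL : Transferable L) {b : ℕ}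
    (hbase : ∀ f : R4 k, f.IsHomogeneous 3 → f ≠ 0 → Irreducible f → Frame f → ∃ S, S.card ≤ b ∧
      OnX f S ∧ RelGood L (Ideal.span {f}) 3 S) {f : R4 k} (H : CubicEq f) :
    ∃ S, S.card ≤ b ∧ OnX f S ∧ RelGood L (Ideal.span {f}) 3 S := by
  obtain ⟨E, D, h', h, F, -⟩ := exists_frame H.irred.ne_zero H.discr ∅ (by simp)
  have hirr := linChange_irreducible h h' H.irred
  obtain ⟨T, hT1, hT2, hT3⟩ := hbase _ (linChange_homog E H.homog) hirr.ne_zero hirr F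
  obtain ⟨V, hV1, hV2, hV3⟩ := transfer_back hL h h' hT2 hT3
  exact ⟨V, by lia, hV2, hV3⟩

theorem row_zero_of_homog_zero {f : R4 k} (hf : f.IsHomogeneous 3) {g : Fin 4 → R4 k}
    (hg : ∀ i, (g i).IsHomogeneous 0) (h : ∑ i, X i * g i ∈ Ideal.span {f}) (i : Fin 4) : g i = 0 := by
  have h0 := eq_zero_of_mem_span_homog hf (IsHomogeneous.sum _ _ _ fun i _ =>
    (isHomogeneous_X k i).mul (hg i)) (by norm_num) h
  obtain ⟨c, hc⟩ := homog_zero (hg i)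
  have := congrArg (eval (Pi.single i 1)) h0
  simp [Pi.single_apply, hc] at this
  rw [hc, this, C_0]

theorem exists_row_good [IsAlgClosed k] {f : R4 k} (H : CubicEq f) (s : ℕ) (hs : s ≠ 1) :
    ∃ S, 2 * S.card ≤ 3 * s ^ 2 + s ∧ OnX f S ∧ RelGood (rowRel (k := k)) (Ideal.span {f}) s S := by
  induction s using Nat.strong_induction_on with
  | _ s ih =>
    obtain rfl | rfl | ⟨m, rfl, hm⟩ : s = 0 ∨ s = 3 ∨ ∃ m, s = m + 2 ∧ m ≠ 1 := by
      rcases s with _ | _ | m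
      · exact .inl rfl
      · exact absurd rfl hs
      · by_cases h : m = 1
        · exact .inr (.inl (by lia))
        · exact .inr (.inr ⟨m, rfl, h⟩)
    · refine ⟨∅, by simp, by simp [OnX], fun g hg hL _ i => ?_⟩
      have := hL ()
      rw [rowRel_apply] at this
      rw [row_zero_of_homog_zero H.homog hg this]
      exact Ideal.zero_mem _
    · obtain ⟨S, h1, h2, h3⟩ := good_three transferable_rowRel (b := 15)
        (fun f hf _ hirr F => by
          obtain ⟨S, h1, h2, h3⟩ := row_cubic_base hf hirr F
          exact ⟨S, h1, h2, row_base_three hf h2 h3⟩) H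
      exact ⟨S, by norm_num; lia, h2, h3⟩
    · obtain ⟨S, h1, h2, h3⟩ := ih m (by lia) hm
      obtain ⟨T, h4, h5, h6⟩ := good_step transferable_rowRel (fun f hf F => row_quadric_base hf F)
        H h2 h3
      exact ⟨T, by nlinarith, h5, h6⟩

theorem exists_alt_good [IsAlgClosed k] {f : R4 k} (H : CubicEq f) (s : ℕ) (hs : s ≠ 1) :
    ∃ S, 2 * S.card + s ≤ 3 * s ^ 2 ∧ OnX f S ∧
      RelGood (altRel (k := k)) (Ideal.span {f}) s S := by
  induction s using Nat.strong_induction_on with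
  | _ s ih =>
    obtain rfl | rfl | ⟨m, rfl, hm⟩ : s = 0 ∨ s = 3 ∨ ∃ m, s = m + 2 ∧ m ≠ 1 := by
      rcases s with _ | _ | m
      · exact .inl rfl
      · exact absurd rfl hs
      · by_cases h : m = 1
        · exact .inr (.inl (by lia))
        · exact .inr (.inr ⟨m, rfl, h⟩)
    · refine ⟨∅, by simp, by simp [OnX], fun g hg hL _ e => ?_⟩
      have := hL (.inl e.1)
      rw [altRel_row] at this
      rw [show g e = _ from row_zero_of_homog_zero H.homog (fun j => hg (e.1, j)) this e.2]
      exact Ideal.zero_mem _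
    · obtain ⟨S, h1, h2, h3⟩ := good_three transferable_altRel (b := 12)
        (fun f hf hf0 _ F => by
          obtain ⟨S, h1, h2, h3⟩ := alt_cubic_base hf F
          exact ⟨S, h1, h2, alt_base_three hf hf0 h2 h3⟩) H
      exact ⟨S, by norm_num; lia, h2, h3⟩
    · obtain ⟨S, h1, h2, h3⟩ := ih m (by lia) hm
      obtain ⟨T, h4, h5, h6⟩ := good_step transferable_altRel (fun f hf F => alt_quadric_base hf F)
        H h2 h3
      exact ⟨T, by nlinarith, h5, h6⟩

end Existence

section Dimension

variable {k : Type} [Field k]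

variable (k) in
/-- Forms of degree `n` in four variables. -/
abbrev Forms (n : ℕ) : Type := homogeneousSubmodule (Fin 4) k n

instance (n : ℕ) : FiniteDimensional k (Forms k n) :=
  Module.Finite.iff_fg.2 (homogeneousSubmodule_fg (Fin 4) k n)

theorem finrank_forms (n : ℕ) : Module.finrank k (Forms k n) = (n + 3).choose 3 := by
  have hset : {d : Fin 4 →₀ ℕ | d.degree = n} = ↑(Finset.univ.finsuppAntidiag (ι := Fin 4) n) := by
    ext d
    simp [Finsupp.degree_eq_sum]
  change Module.finrank k ↥(homogeneousSubmodule (Fin 4) k n) = _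
  rw [homogeneousSubmodule_eq_finsupp_supported, hset]
  change Module.finrank k (restrictSupport k
    (↑(Finset.univ.finsuppAntidiag (ι := Fin 4) n) : Set (Fin 4 →₀ ℕ))) = _
  rw [Module.finrank_eq_card_basis (basisRestrictSupport k
    (↑(Finset.univ.finsuppAntidiag (ι := Fin 4) n) : Set (Fin 4 →₀ ℕ)))]
  rw [← Nat.card_eq_fintype_card, Nat.card_coe_set_eq, Set.ncard_coe_finset, Finset.card_finsuppAntidiag_nat_eq_choose]
  simp only [Finset.card_univ, Fintype.card_fin]
  rw [show 4 + n - 1 = n + 3 by lia, Nat.choose_symm_add]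

/-- Multiplication by a form. -/
noncomputable def mulForm {d : ℕ} {f : R4 k} (hf : f.IsHomogeneous d) (n : ℕ) :
    Forms k n →ₗ[k] Forms k (n + d) :=
  ((LinearMap.mulRight k f).comp (homogeneousSubmodule (Fin 4) k n).subtype).codRestrict _
    fun g => (g.2 : IsHomogeneous _ _).mul hf

theorem mulForm_coe {d : ℕ} {f : R4 k} (hf : f.IsHomogeneous d) (n : ℕ) (g : Forms k n) :
    (mulForm hf n g : R4 k) = g * f := rfl

theorem mulForm_injective {d : ℕ} {f : R4 k} (hf : f.IsHomogeneous d) (hf0 : f ≠ 0) (n : ℕ) :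
    Function.Injective (mulForm hf n) := fun _ _ h =>
  Subtype.ext (mul_right_cancel₀ hf0 (congrArg Subtype.val h))

/-- Evaluation of forms at a vector. -/
noncomputable def evForm (n : ℕ) (v : Fin 4 → k) : Forms k n →ₗ[k] k :=
  (aeval v : R4 k →ₐ[k] k).toLinearMap.comp (homogeneousSubmodule (Fin 4) k n).subtype

theorem evForm_apply (n : ℕ) (v : Fin 4 → k) (g : Forms k n) :
    evForm n v g = eval v (g : R4 k) := by
  simp [evForm, aeval_eq_eval]

theorem choose_three (n : ℕ) : 6 * (n + 3).choose 3 = (n + 1) * (n + 2) * (n + 3) := by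
  induction n with
  | zero => rfl
  | succ n ih =>
    have h2 : 2 * (n + 3).choose 2 = (n + 2) * (n + 3) := by
      have := Nat.triangle_succ (n + 2)
      rw [Nat.choose_two_right]
      rw [Nat.mul_div_cancel' (Nat.even_mul_pred_self _).two_dvd]
      simp; ring
    rw [show n + 1 + 3 = (n + 3) + 1 by rfl, Nat.choose_succ_succ]
    nlinarith

theorem PXcubic_eq (t : ℕ) : 2 * PXcubic t = 3 * (t * (t + 1)) + 2 := by
  have := (Nat.even_mul_succ_self t).two_dvd
  unfold PXcubic
  lia

theorem finrank_forms_succ (t : ℕ) :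
    Module.finrank k (Forms k (t + 3)) = Module.finrank k (Forms k t) + PXcubic (t + 3) := by
  rw [finrank_forms, finrank_forms]
  have h1 := choose_three t
  have h2 := choose_three (t + 3)
  have h3 := PXcubic_eq (t + 3)
  nlinarith

theorem exists_vanishing_good [IsAlgClosed k] {f : R4 k} (hf : f.IsHomogeneous 3)
    (hirr : Irreducible f) (s : ℕ) : ∃ S : Finset (Fin 4 → k), S.card ≤ PXcubic (s + 3) ∧ OnX f S ∧
      ∀ g : R4 k, g.IsHomogeneous (s + 3) → (∀ v ∈ S, eval v g = 0) → g ∈ Ideal.span {f} := by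
  classical
  let W := LinearMap.range (mulForm hf s)
  have hW : Module.finrank k W = Module.finrank k (Forms k s) :=
    LinearMap.finrank_range_of_inj (mulForm_injective hf hirr.ne_zero s)
  have hWf : ∀ g : Forms k (s + 3), g ∈ W ↔ (g : R4 k) ∈ Ideal.span {f} := by
    intro g
    constructor
    · rintro ⟨q, rfl⟩
      exact Ideal.mul_mem_left _ _ (Ideal.mem_span_singleton_self f)
    · intro h
      obtain ⟨q, hq, e⟩ := mem_span_homog hf g.2 h
      exact ⟨⟨q, hq⟩, Subtype.ext (by rw [mulForm_coe, e, mul_comm])⟩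
  have key : ∀ m (K : Submodule k (Forms k (s + 3))), W ≤ K →
      Module.finrank k K ≤ Module.finrank k W + m → ∃ S : Finset (Fin 4 → k), S.card ≤ m ∧ OnX f S ∧
        ∀ g ∈ K, (∀ v ∈ S, eval v (g : R4 k) = 0) → g ∈ W := by
    intro m
    induction m with
    | zero =>
      intro K hK hm
      exact ⟨∅, by simp, by simp [OnX], fun g hg _ => by rwa [Submodule.eq_of_le_of_finrank_le hK hm]⟩
    | succ m ih =>
      intro K hK hm
      by_cases hKW : K ≤ W
      · exact ⟨∅, by simp, by simp [OnX], fun g hg _ => hKW hg⟩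
      obtain ⟨g, hgK, hgW⟩ := Set.not_subset.1 hKW
      obtain ⟨p, hp, hpg⟩ := exists_point hirr fun h => hgW ((hWf g).2 h)
      obtain ⟨S, h1, h2, h3⟩ := ih (K ⊓ LinearMap.ker (evForm _ p)) (le_inf hK (by
        rintro _ ⟨q, rfl⟩
        rw [LinearMap.mem_ker, evForm_apply, mulForm_coe, map_mul, hp, mul_zero])) (by
        have hlt : K ⊓ LinearMap.ker (evForm _ p) < K := lt_of_le_of_ne inf_le_left fun e => hpg (by
          rw [← e] at hgK
          rw [← evForm_apply]
          exact hgK.2)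
        have := Submodule.finrank_lt_finrank_of_lt hlt
        lia)
      refine ⟨insert p S, (Finset.card_insert_le _ _).trans (by lia), ?_, fun g hg hv => ?_⟩
      · intro v hv
        rcases Finset.mem_insert.1 hv with rfl | hv
        · refine ⟨fun h0 => hpg ?_, hp⟩
          have := eval_smul_homog (g.2 : IsHomogeneous _ _) 0 v
          rw [zero_smul, zero_pow (by lia), zero_mul] at this
          rwa [h0]
        · exact h2 v hv
      · exact h3 g ⟨hg, LinearMap.mem_ker.2 (by
          rw [evForm_apply]
          exact hv _ (Finset.mem_insert_self _ _))⟩ fun v h => hv v (Finset.mem_insert_of_mem h)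
  obtain ⟨S, h1, h2, h3⟩ := key (PXcubic (s + 3)) ⊤ le_top (by
    rw [finrank_top, finrank_forms_succ, hW])
  exact ⟨S, h1, h2, fun g hg hv => (hWf ⟨g, hg⟩).1 (h3 ⟨g, hg⟩ trivial hv)⟩

end Dimension

section Openness

variable {k : Type} [Field k] {f : R4 k} {t : ℕ}

/-- A property of `t`-tuples of vectors holds on a nonempty basic open subset of the `t`-fold
product of the cone over the surface. -/
def OpenProp (f : R4 k) (t : ℕ) (P : (Fin t → Fin 4 → k) → Prop) : Prop :=
  ∃ G : MvPolynomial (Fin t × Fin 4) k,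
    (∃ v : Fin t → Fin 4 → k, (∀ i, eval (v i) f = 0) ∧ eval (fun q => v q.1 q.2) G ≠ 0) ∧
    ∀ v : Fin t → Fin 4 → k, (∀ i, eval (v i) f = 0) → eval (fun q => v q.1 q.2) G ≠ 0 → P v

theorem eval_eq_zero_of_mem {p : R4 k} {x : Fin 4 → k} (hx : eval x f = 0)
    (h : p ∈ Ideal.span {f}) : eval x p = 0 := by
  obtain ⟨q, rfl⟩ := Ideal.mem_span_singleton.1 h
  rw [map_mul, hx, zero_mul]

theorem polyFun_update (G : MvPolynomial (Fin t × Fin 4) k) (w : Fin t → Fin 4 → k) (i : Fin t) :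
    PolyFun fun x : Fin 4 → k => eval (fun q => Function.update w i x q.1 q.2) G := by
  refine PolyFun.eval G fun q => ?_
  by_cases h : q.1 = i
  · subst h
    simpa using PolyFun.coord (k := k) q.2
  · simpa [h] using PolyFun.const (σ := Fin 4) (w q.1 q.2)

theorem exists_common_point [IsAlgClosed k] (hirr : Irreducible f)
    {G₁ G₂ : MvPolynomial (Fin t × Fin 4) k}
    (h₁ : ∃ v : Fin t → Fin 4 → k, (∀ i, eval (v i) f = 0) ∧ eval (fun q => v q.1 q.2) G₁ ≠ 0)
    (h₂ : ∃ v : Fin t → Fin 4 → k, (∀ i, eval (v i) f = 0) ∧ eval (fun q => v q.1 q.2) G₂ ≠ 0) :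
    ∃ v : Fin t → Fin 4 → k, (∀ i, eval (v i) f = 0) ∧ eval (fun q => v q.1 q.2) G₁ ≠ 0 ∧
      eval (fun q => v q.1 q.2) G₂ ≠ 0 := by
  have key : ∀ A : Finset (Fin t), ∃ w₁ w₂ : Fin t → Fin 4 → k,
      (∀ i, eval (w₁ i) f = 0) ∧ (∀ i, eval (w₂ i) f = 0) ∧ eval (fun q => w₁ q.1 q.2) G₁ ≠ 0 ∧
      eval (fun q => w₂ q.1 q.2) G₂ ≠ 0 ∧ ∀ i ∈ A, w₁ i = w₂ i := by
    intro A
    induction A using Finset.induction_on with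
    | empty =>
      obtain ⟨w₁, a₁, b₁⟩ := h₁
      obtain ⟨w₂, a₂, b₂⟩ := h₂
      exact ⟨w₁, w₂, a₁, a₂, b₁, b₂, by simp⟩
    | insert i A hi ih =>
      obtain ⟨w₁, w₂, a₁, a₂, b₁, b₂, hA⟩ := ih
      obtain ⟨p₁, hp₁⟩ := polyFun_update G₁ w₁ i
      obtain ⟨p₂, hp₂⟩ := polyFun_update G₂ w₂ i
      have n₁ : p₁ ∉ Ideal.span {f} := fun h => b₁ (by
        simpa [hp₁] using eval_eq_zero_of_mem (a₁ i) h)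
      have n₂ : p₂ ∉ Ideal.span {f} := fun h => b₂ (by
        simpa [hp₂] using eval_eq_zero_of_mem (a₂ i) h)
      obtain ⟨x, hx, hpx⟩ := exists_point hirr fun h =>
        ((prime_span hirr).mem_or_mem h).elim n₁ n₂
      rw [map_mul, hp₁, hp₂] at hpx
      refine ⟨Function.update w₁ i x, Function.update w₂ i x, fun j => ?_, fun j => ?_,
        left_ne_zero_of_mul hpx, right_ne_zero_of_mul hpx, fun j hj => ?_⟩
      · by_cases h : j = i
        · subst h; simpa using hx
        · simpa [h] using a₁ j
      · by_cases h : j = i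
        · subst h; simpa using hx
        · simpa [h] using a₂ j
      · by_cases h : j = i
        · subst h; simp
        · simpa [h] using hA j ((Finset.mem_insert.1 hj).resolve_left h)
  obtain ⟨w₁, w₂, a₁, -, b₁, b₂, hA⟩ := key Finset.univ
  obtain rfl : w₁ = w₂ := funext fun i => hA i (Finset.mem_univ i)
  exact ⟨w₁, a₁, b₁, b₂⟩

namespace OpenProp

variable {P Q : (Fin t → Fin 4 → k) → Prop}

theorem of_polyFun {F : (Fin t → Fin 4 → k) → k}
    (hF : PolyFun fun x : Fin t × Fin 4 → k => F fun i e => x (i, e)) {v₀ : Fin t → Fin 4 → k}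
    (hv₀ : ∀ i, eval (v₀ i) f = 0) (h₀ : F v₀ ≠ 0)
    (h : ∀ v : Fin t → Fin 4 → k, (∀ i, eval (v i) f = 0) → F v ≠ 0 → P v) : OpenProp f t P := by
  obtain ⟨G, hG⟩ := hF
  exact ⟨G, ⟨v₀, hv₀, by rwa [hG]⟩, fun v hv hGv => h v hv (by rwa [hG] at hGv)⟩

theorem mono (hP : OpenProp f t P) (h : ∀ v : Fin t → Fin 4 → k, (∀ i, eval (v i) f = 0) →
    P v → Q v) : OpenProp f t Q := by
  obtain ⟨G, hG, hGP⟩ := hP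
  exact ⟨G, hG, fun v hv hv' => h v hv (hGP v hv hv')⟩

theorem of_forall [IsAlgClosed k] (hirr : Irreducible f) (h : ∀ v, P v) : OpenProp f t P := by
  obtain ⟨x, hx, -⟩ := exists_point hirr (h := 1) fun h => by
    exact (prime_span hirr).ne_top ((Ideal.eq_top_iff_one _).2 h)
  exact of_polyFun (F := fun _ => 1) (PolyFun.const 1) (v₀ := fun _ => x) (fun _ => hx)
    one_ne_zero fun v _ _ => h v

theorem and [IsAlgClosed k] (hirr : Irreducible f) (hP : OpenProp f t P) (hQ : OpenProp f t Q) :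
    OpenProp f t fun v => P v ∧ Q v := by
  obtain ⟨G, hG, hGP⟩ := hP
  obtain ⟨H, hH, hHQ⟩ := hQ
  obtain ⟨v, hv, h₁, h₂⟩ := exists_common_point hirr hG hH
  refine ⟨G * H, ⟨v, hv, by rw [map_mul]; exact mul_ne_zero h₁ h₂⟩, fun w hw h => ?_⟩
  rw [map_mul] at h
  exact ⟨hGP w hw (left_ne_zero_of_mul h), hHQ w hw (right_ne_zero_of_mul h)⟩

theorem forall_mem [IsAlgClosed k] (hirr : Irreducible f) {α : Type} (A : Finset α)
    {P : α → (Fin t → Fin 4 → k) → Prop} (h : ∀ a, OpenProp f t (P a)) :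
    OpenProp f t fun v => ∀ a ∈ A, P a v := by
  classical
  induction A using Finset.induction_on with
  | empty => exact of_forall hirr fun v => by simp
  | insert a A ha ih => exact ((h a).and hirr ih).mono fun v _ hv => by simpa using hv

theorem linearIndependent {m : ℕ} {N : Type} [Fintype N]
    {A : (Fin t → Fin 4 → k) → Fin m → N → k}
    (hA : ∀ a b, PolyFun fun x : Fin t × Fin 4 → k => A (fun i e => x (i, e)) a b)
    {v₀ : Fin t → Fin 4 → k} (hv₀ : ∀ i, eval (v₀ i) f = 0) (h₀ : LinearIndependent k (A v₀)) :
    OpenProp f t fun v => LinearIndependent k (A v) := by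
  classical
  obtain ⟨φ, hφ⟩ := LinearMap.exists_leftInverse_of_injective (Fintype.linearCombination k (A v₀))
    (LinearMap.ker_eq_bot.2 (linearIndependent_iff_injective_fintypeLinearCombination.1 h₀))
  have hφ' : ∀ a, φ (A v₀ a) = Pi.single a 1 := fun a => by
    have := LinearMap.congr_fun hφ (Pi.single a 1)
    simpa using this
  refine of_polyFun (F := fun v => (Matrix.of fun a b => φ (A v a) b).det) (PolyFun.det ?_) hv₀ ?_
    fun v _ hdet => ?_
  · intro a b
    simp only [Matrix.of_apply]
    have : ∀ y : N → k, φ y b = ∑ c, y c * φ (fun j => if c = j then 1 else 0) b := fun y => by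
      conv_lhs => rw [LinearMap.pi_apply_eq_sum_univ φ y]
      simp [Finset.sum_apply]
    rw [show (fun x : Fin t × Fin 4 → k => φ (A (fun i e => x (i, e)) a) b) = _ from
      funext fun x => this _]
    exact PolyFun.sum _ fun c => (hA a c).mul (PolyFun.const _)
  · have : (Matrix.of fun a b => φ (A v₀ a) b) = 1 := by
      ext a b
      rw [Matrix.of_apply, hφ', Matrix.one_apply, Pi.single_apply]
      simp [eq_comm]
    simp [this]
  · have := Matrix.linearIndependent_rows_of_det_ne_zero hdet
    exact LinearIndependent.of_comp φ this

theorem inf_ker_le {V : Type} [AddCommGroup V] [Module k V] [FiniteDimensional k V] {N : Type}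
    [Fintype N] {E : (Fin t → Fin 4 → k) → V →ₗ[k] (N → k)}
    (hE : ∀ x b, PolyFun fun y : Fin t × Fin 4 → k => E (fun i e => y (i, e)) x b)
    {W₀ W : Submodule k V} (hW : W₀ ≤ W)
    (hW₀ : ∀ v : Fin t → Fin 4 → k, (∀ i, eval (v i) f = 0) → W₀ ≤ LinearMap.ker (E v))
    {v₀ : Fin t → Fin 4 → k} (hv₀ : ∀ i, eval (v₀ i) f = 0)
    (h₀ : W ⊓ LinearMap.ker (E v₀) ≤ W₀) :
    OpenProp f t fun v => W ⊓ LinearMap.ker (E v) ≤ W₀ := by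
  obtain ⟨W₁, hd⟩ := Submodule.exists_isCompl W₀
  let b := Module.finBasis k ↥(W ⊓ W₁)
  have hb : LinearIndependent k fun a => E v₀ (b a : V) := by
    rw [Fintype.linearIndependent_iff]
    intro c hc
    have hx : ((∑ a, c a • b a : ↥(W ⊓ W₁)) : V) = 0 := by
      set x := ∑ a, c a • b a with hx
      have h1 : E v₀ (x : V) = 0 := by
        rw [← hc, hx]
        simp
      exact Submodule.disjoint_def.1 hd.disjoint _ (h₀ ⟨x.2.1, h1⟩) x.2.2
    exact Fintype.linearIndependent_iff.1 b.linearIndependent c (Subtype.ext hx)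
  refine (linearIndependent (A := fun v a => E v (b a : V)) (fun a c => hE _ _) hv₀ hb).mono
    fun v hv hli x hx => ?_
  obtain ⟨y, hy, z, hz, rfl⟩ := Submodule.mem_sup.1 (hd.sup_eq_top ▸ Submodule.mem_top (x := x))
  have hzW : z ∈ W ⊓ W₁ := ⟨by simpa using W.sub_mem hx.1 (hW hy), hz⟩
  have hEz : E v z = 0 := by
    have := LinearMap.mem_ker.1 hx.2
    rwa [map_add, LinearMap.mem_ker.1 (hW₀ v hv hy), zero_add] at this
  have hz0 : z = 0 := by
    have hrep := b.sum_repr ⟨z, hzW⟩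
    have h1 : ∑ a, b.repr ⟨z, hzW⟩ a • E v (b a : V) = 0 := by
      rw [← hEz]
      conv_rhs => rw [show z = ((⟨z, hzW⟩ : ↥(W ⊓ W₁)) : V) from rfl, ← hrep]
      rw [Submodule.coe_sum, map_sum]
      simp only [Submodule.coe_smul, map_smul]
    have h2 := Fintype.linearIndependent_iff.1 hli _ h1
    have : (⟨z, hzW⟩ : ↥(W ⊓ W₁)) = 0 := by
      rw [← hrep]
      exact Finset.sum_eq_zero fun a _ => by rw [h2, zero_smul]
    exact congrArg Subtype.val this
  rwa [hz0, add_zero]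

end OpenProp

end Openness

section General

variable {k : Type} [Field k] {f : R4 k} {t : ℕ}

theorem polyFun_coord (i : Fin t) (e : Fin 4) :
    PolyFun fun x : Fin t × Fin 4 → k => (fun i e => x (i, e) : Fin t → Fin 4 → k) i e :=
  PolyFun.coord (i, e)

theorem open_coord_ne_zero [IsAlgClosed k] (hf : f.IsHomogeneous 3) (hirr : Irreducible f)
    (i : Fin t) : OpenProp f t fun v => v i ≠ 0 := by
  obtain ⟨p, hp, hp0⟩ := exists_point_coords hf hirr
  exact OpenProp.of_polyFun (F := fun v => v i 0) (polyFun_coord i 0) (v₀ := fun _ => p)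
    (fun _ => hp) (hp0 0) fun v _ hv h => hv (by rw [h]; rfl)

theorem open_minor_ne_zero [IsAlgClosed k] (hf : f.IsHomogeneous 3) (hirr : Irreducible f)
    {i j : Fin t} (hij : i ≠ j) :
    OpenProp f t fun v => v i 0 * v j 1 - v j 0 * v i 1 ≠ 0 := by
  obtain ⟨p, hp, hp0⟩ := exists_point_coords hf hirr
  have hne : linForm (![-p 1, p 0, 0, 0] : Fin 4 → k) ≠ 0 := linForm_ne_zero (i := 1) (by
    simpa using hp0 0)
  obtain ⟨q, hq, hq0⟩ := exists_point hirr
    (not_mem_span_of_lt hf (linForm_homog _) (by lia) hne)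
  rw [eval_linForm] at hq0
  refine OpenProp.of_polyFun (F := fun v => v i 0 * v j 1 - v j 0 * v i 1)
    (((polyFun_coord i 0).mul (polyFun_coord j 1)).sub
      ((polyFun_coord j 0).mul (polyFun_coord i 1))) (v₀ := fun a => if a = i then p else q)
    (fun a => by split_ifs <;> assumption) ?_ fun v _ hv => hv
  simp only [if_true, if_neg hij.symm]
  intro h
  refine hq0 ?_
  simp only [Fin.sum_univ_four, Matrix.cons_val]
  linear_combination h

/-- Evaluation of a tuple of forms at a tuple of vectors. -/
noncomputable def evTuple (ι : Type) (n : ℕ) (v : Fin t → Fin 4 → k) :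
    (ι → Forms k n) →ₗ[k] (Fin t × ι → k) :=
  LinearMap.pi fun q => (evForm n (v q.1)).comp (LinearMap.proj q.2)

theorem evTuple_apply {ι : Type} {n : ℕ} (v : Fin t → Fin 4 → k) (g : ι → Forms k n)
    (q : Fin t × ι) : evTuple ι n v g q = eval (v q.1) (g q.2 : R4 k) :=
  evForm_apply _ _ _

theorem polyFun_evTuple {ι : Type} {n : ℕ} (g : ι → Forms k n) (q : Fin t × ι) :
    PolyFun fun x : Fin t × Fin 4 → k => evTuple ι n (fun i e => x (i, e)) g q := by
  simp only [evTuple_apply]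
  exact PolyFun.eval _ fun e => PolyFun.coord (q.1, e)

theorem mem_ker_evTuple {ι : Type} {n : ℕ} {v : Fin t → Fin 4 → k} {g : ι → Forms k n} :
    g ∈ LinearMap.ker (evTuple ι n v) ↔ ∀ i e, eval (v i) (g e : R4 k) = 0 := by
  rw [LinearMap.mem_ker, funext_iff]
  simp only [evTuple_apply, Prod.forall, Pi.zero_apply]

/-- The tuples of forms of degree `n` satisfying the linear relations `L` modulo `J`. -/
def relForms {ι κ : Type} (L : (ι → R4 k) →ₗ[R4 k] (κ → R4 k)) (J : Ideal (R4 k)) (n : ℕ) :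
    Submodule k (ι → Forms k n) where
  carrier := {g | ∀ c, L (fun e => (g e : R4 k)) c ∈ J}
  zero_mem' c := by
    change L 0 c ∈ J
    rw [map_zero]
    exact J.zero_mem
  add_mem' {g h} hg hh c := by
    change L ((fun e => (g e : R4 k)) + fun e => (h e : R4 k)) c ∈ J
    rw [map_add]
    exact J.add_mem (hg c) (hh c)
  smul_mem' a g hg c := by
    have : (fun e => ((a • g) e : R4 k)) = (C a : R4 k) • fun e => (g e : R4 k) := by
      ext1 e
      simp [smul_eq_C_mul]
    change L (fun e => ((a • g) e : R4 k)) c ∈ J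
    rw [this, map_smul]
    exact J.mul_mem_left _ (hg c)

theorem exists_padding [IsAlgClosed k] (hf : f.IsHomogeneous 3) (hirr : Irreducible f)
    {S : Finset (Fin 4 → k)} (hS : OnX f S) (ht : S.card ≤ t) :
    ∃ v : Fin t → Fin 4 → k, (∀ i, v i ≠ 0 ∧ eval (v i) f = 0) ∧ ∀ x ∈ S, ∃ i, v i = x := by
  obtain ⟨p, hp, hp0⟩ := exists_point_coords hf hirr
  refine ⟨fun i => if h : (i : ℕ) < S.card then S.equivFin.symm ⟨i, h⟩ else p, fun i => ?_,
    fun x hx => ⟨⟨S.equivFin ⟨x, hx⟩, by lia⟩, by simp⟩⟩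
  dsimp only
  split_ifs with h
  · exact hS _ (S.equivFin.symm ⟨i, h⟩).2
  · exact ⟨fun h => hp0 0 (by rw [h]; rfl), hp⟩

theorem open_relGood [IsAlgClosed k] (hf : f.IsHomogeneous 3) (hirr : Irreducible f)
    {ι κ : Type} [Fintype ι] (L : (ι → R4 k) →ₗ[R4 k] (κ → R4 k)) (n : ℕ)
    {S : Finset (Fin 4 → k)} (hS : OnX f S) (ht : S.card ≤ t)
    (hgood : RelGood L (Ideal.span {f}) n S) :
    OpenProp f t fun v => ∀ g : ι → R4 k, (∀ e, (g e).IsHomogeneous n) →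
      (∀ c, L g c ∈ Ideal.span {f}) → (∀ i e, eval (v i) (g e) = 0) → ∀ e, g e ∈ Ideal.span {f} := by
  obtain ⟨v₀, hv₀, hSv⟩ := exists_padding hf hirr hS ht
  refine (OpenProp.inf_ker_le (E := fun v => evTuple ι n v) (W := relForms L (Ideal.span {f}) n)
    (W₀ := relForms LinearMap.id (Ideal.span {f}) n) (fun g q => polyFun_evTuple g q)
    (fun g hg => map_mem_of_mem L hg) (fun v hv g hg => mem_ker_evTuple.2 fun i e =>
      eval_eq_zero_of_mem (hv i) (hg e)) (v₀ := v₀) (fun i => (hv₀ i).2) ?_).mono ?_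
  · rintro g ⟨hg, hg0⟩
    refine hgood _ (fun e => (g e).2) hg fun x hx e => ?_
    obtain ⟨i, rfl⟩ := hSv x hx
    exact mem_ker_evTuple.1 hg0 i e
  · intro v _ hW g hg hL h0
    exact hW (x := fun e => ⟨g e, hg e⟩) ⟨hL, mem_ker_evTuple.2 h0⟩

end General

section Tangent

variable {k : Type} [Field k] {f : R4 k} {t : ℕ}

/-- Tuples of vectors orthogonal to the given tuple, index by index. -/
noncomputable def pairing (v : Fin t → Fin 4 → k) : (Fin t × Fin 4 → k) →ₗ[k] (Fin t → k) :=
  LinearMap.pi fun i => ∑ e, v i e • LinearMap.proj (i, e)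

theorem pairing_apply (v : Fin t → Fin 4 → k) (c : Fin t × Fin 4 → k) (i : Fin t) :
    pairing v c i = ∑ e, v i e * c (i, e) := by
  simp [pairing]

theorem finrank_ker_pairing {v : Fin t → Fin 4 → k} (hv : ∀ i, v i ≠ 0) :
    Module.finrank k (LinearMap.ker (pairing v)) = 3 * t := by
  classical
  have hs : LinearMap.range (pairing v) = ⊤ := by
    refine LinearMap.range_eq_top.2 fun y => ?_
    choose e he using fun i => Function.ne_iff.1 (hv i)
    refine ⟨fun q => if q.2 = e q.1 then y q.1 / v q.1 (e q.1) else 0, funext fun i => ?_⟩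
    rw [pairing_apply]
    simp only [mul_ite, mul_zero, Finset.sum_ite_eq', Finset.mem_univ, if_true]
    exact mul_div_cancel₀ _ (he i)
  have := LinearMap.finrank_range_add_finrank_ker (pairing v)
  rw [hs, finrank_top] at this
  simp only [Module.finrank_fintype_fun_eq_card, Fintype.card_prod, Fintype.card_fin] at this
  lia

theorem row_le_pairing {n : ℕ} {v : Fin t → Fin 4 → k} (hv : ∀ i, eval (v i) f = 0)
    {g : Fin 4 → Forms k n} (hg : g ∈ relForms rowRel (Ideal.span {f}) n) :
    evTuple (Fin 4) n v g ∈ LinearMap.ker (pairing v) := by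
  refine LinearMap.mem_ker.2 (funext fun i => ?_)
  have := eval_eq_zero_of_mem (hv i) (hg ())
  rw [rowRel_apply, map_sum] at this
  simpa [pairing_apply, evTuple_apply] using this

theorem finrank_relForms_id (hf : f.IsHomogeneous 3) (p : ℕ) :
    Module.finrank k (relForms (ι := Fin 4) LinearMap.id (Ideal.span {f}) (p + 3)) ≤
      4 * Module.finrank k (Forms k p) := by
  have hle : relForms (ι := Fin 4) LinearMap.id (Ideal.span {f}) (p + 3) ≤
      LinearMap.range ((mulForm hf p).compLeft (Fin 4)) := by
    intro g hg
    choose q hq e using fun i => mem_span_homog hf (g i).2 (hg i)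
    exact ⟨fun i => ⟨q i, hq i⟩, funext fun i => Subtype.ext (by
      rw [LinearMap.compLeft_apply, Function.comp_apply, mulForm_coe, e, mul_comm])⟩
  refine (Submodule.finrank_mono hle).trans ((LinearMap.finrank_range_le _).trans ?_)
  rw [Module.finrank_pi_fintype]
  simp

theorem finrank_relForms_row (hf : f.IsHomogeneous 3) (hf0 : f ≠ 0) (p : ℕ) :
    4 * Module.finrank k (Forms k (p + 3)) ≤
      Module.finrank k (relForms rowRel (Ideal.span {f}) (p + 3)) + PXcubic (p + 4) := by
  let μ : (Fin 4 → Forms k (p + 3)) →ₗ[k] Forms k (p + 1 + 3) :=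
    ∑ j, ((LinearMap.mulLeft k (X j : R4 k)).comp (homogeneousSubmodule (Fin 4) k (p + 3)).subtype
      |>.codRestrict (homogeneousSubmodule (Fin 4) k (p + 1 + 3)) (fun g => by
        have := (isHomogeneous_X k j).mul (g.2 : IsHomogeneous _ _)
        rwa [show 1 + (p + 3) = p + 1 + 3 by lia] at this)).comp (LinearMap.proj j)
  have hμ : ∀ g, (μ g : R4 k) = ∑ j, X j * (g j : R4 k) := fun g => by
    simp only [μ, LinearMap.sum_apply, AddSubmonoidClass.coe_finsetSum]
    rfl
  let ν := (LinearMap.range (mulForm hf (p + 1))).mkQ.comp μ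
  have hker : LinearMap.ker ν ≤ relForms rowRel (Ideal.span {f}) (p + 3) := by
    intro g hg c
    rw [LinearMap.mem_ker, LinearMap.comp_apply, Submodule.mkQ_apply,
      Submodule.Quotient.mk_eq_zero] at hg
    obtain ⟨q, hq⟩ := hg
    rw [rowRel_apply, ← hμ, ← hq]
    exact Ideal.mul_mem_left _ _ (Ideal.mem_span_singleton_self f)
  have h1 := Submodule.finrank_mono hker
  have h2 := LinearMap.finrank_range_add_finrank_ker ν
  have h3 := Submodule.finrank_le (LinearMap.range ν)
  have h4 := Submodule.finrank_quotient_add_finrank (LinearMap.range (mulForm hf (p + 1)))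
  rw [LinearMap.finrank_range_of_inj (mulForm_injective hf hf0 (p + 1)), finrank_forms_succ] at h4
  rw [Module.finrank_pi_fintype] at h2
  simp only [Finset.sum_const, Finset.card_univ, Fintype.card_fin, smul_eq_mul] at h2
  rw [show p + 4 = p + 1 + 3 by lia]
  lia

theorem exists_row_range_eq [IsAlgClosed k] (H : CubicEq f) (p n : ℕ)
    (hn : 2 * n = 3 * (p + 3) ^ 2 + (p + 3)) :
    ∃ w : Fin n → Fin 4 → k, (∀ i, w i ≠ 0 ∧ eval (w i) f = 0) ∧
      LinearMap.range ((evTuple (Fin 4) (p + 3) w).domRestrict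
        (relForms rowRel (Ideal.span {f}) (p + 3))) = LinearMap.ker (pairing w) := by
  obtain ⟨S, hcard, hS, hgood⟩ := exists_row_good H (p + 3) (by lia)
  obtain ⟨w, hw, hSw⟩ := exists_padding H.homog H.irred hS (t := n) (by lia)
  let K := relForms rowRel (Ideal.span {f}) (p + 3)
  let E : K →ₗ[k] (Fin n × Fin 4 → k) := (evTuple (Fin 4) (p + 3) w).domRestrict K
  have hrange : LinearMap.range E = LinearMap.ker (pairing w) := by
    refine Submodule.eq_of_le_of_finrank_le ?_ ?_
    · rintro _ ⟨g, rfl⟩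
      exact row_le_pairing (fun i => (hw i).2) g.2
    · rw [finrank_ker_pairing fun i => (hw i).1]
      have h1 := LinearMap.finrank_range_add_finrank_ker (K := k) (V := K) (V₂ := Fin n × Fin 4 → k) E
      have h2 : Module.finrank k (LinearMap.ker E) ≤
          4 * Module.finrank k (Forms k p) := by
        refine le_trans ?_ (finrank_relForms_id H.homog p)
        rw [← Submodule.finrank_map_subtype_eq]
        refine Submodule.finrank_mono ?_
        rintro _ ⟨g, hg, rfl⟩
        refine hgood _ (fun e => (g.1 e).2) g.2 fun x hx e => ?_
        obtain ⟨i, rfl⟩ := hSw x hx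
        exact mem_ker_evTuple.1 (LinearMap.mem_ker.1 hg) i e
      have h3 := finrank_relForms_row H.homog H.irred.ne_zero p
      have h4 := finrank_forms_succ (k := k) p
      have h5 := PXcubic_eq (p + 3)
      have h6 := PXcubic_eq (p + 4)
      change _ = Module.finrank k K at h1
      change _ ≤ Module.finrank k K + _ at h3
      nlinarith
  exact ⟨w, hw, hrange⟩

theorem exists_row_lift [IsAlgClosed k] (H : CubicEq f) (p : ℕ)
    (ht : 2 * t ≤ 3 * (p + 3) ^ 2 + (p + 3)) :
    ∃ v₀ : Fin t → Fin 4 → k, (∀ i, v₀ i ≠ 0 ∧ eval (v₀ i) f = 0) ∧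
      ∀ c ∈ LinearMap.ker (pairing v₀), ∃ g ∈ relForms rowRel (Ideal.span {f}) (p + 3),
        evTuple (Fin 4) (p + 3) v₀ g = c := by
  obtain ⟨n, hn⟩ : ∃ n, 2 * n = 3 * (p + 3) ^ 2 + (p + 3) := by
    obtain ⟨m, hm⟩ := (Nat.even_mul_succ_self (p + 3)).two_dvd
    exact ⟨m + (p + 3) ^ 2, by nlinarith⟩
  have htn : t ≤ n := by lia
  obtain ⟨w, hw, hrange⟩ := exists_row_range_eq H p n hn
  let v₀ : Fin t → Fin 4 → k := fun i => w (Fin.castLE htn i)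
  refine ⟨v₀, fun i => hw _, fun c hc => ?_⟩
  let c' : Fin n × Fin 4 → k := fun q => if h : (q.1 : ℕ) < t then c (⟨q.1, h⟩, q.2) else 0
  have hc' : c' ∈ LinearMap.ker (pairing w) := by
    refine LinearMap.mem_ker.2 (funext fun i => ?_)
    rw [pairing_apply]
    by_cases h : (i : ℕ) < t
    · have := congrFun (LinearMap.mem_ker.1 hc) ⟨i, h⟩
      rw [pairing_apply] at this
      simpa [c', h, v₀] using this
    · simp [c', h]
  rw [← hrange] at hc'
  obtain ⟨g, hg⟩ := hc'
  refine ⟨g, g.2, funext fun q => ?_⟩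
  have := congrFun hg (Fin.castLE htn q.1, q.2)
  rw [LinearMap.domRestrict_apply, evTuple_apply] at this
  rw [evTuple_apply]
  simpa [c', v₀] using this

theorem open_row_surjective [IsAlgClosed k] (H : CubicEq f) (p : ℕ)
    (ht : 2 * t ≤ 3 * (p + 3) ^ 2 + (p + 3)) :
    OpenProp f t fun v => (∀ i, v i ≠ 0) → ∀ c : Fin t → Fin 4 → k,
      (∀ i, ∑ e, v i e * c i e = 0) → ∃ g : Fin 4 → R4 k, (∀ e, (g e).IsHomogeneous (p + 3)) ∧
        ∑ e, X e * g e ∈ Ideal.span {f} ∧ ∀ i e, eval (v i) (g e) = c i e := by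
  obtain ⟨v₀, hw, hlift⟩ := exists_row_lift H p ht
  let K := relForms rowRel (Ideal.span {f}) (p + 3)
  have hr : Module.finrank k (LinearMap.ker (pairing v₀)) = 3 * t :=
    finrank_ker_pairing fun i => (hw i).1
  let b := Module.finBasisOfFinrankEq k _ hr
  choose G hGK hG using fun a => hlift (b a) (b a).2
  have hb : LinearIndependent k fun a => evTuple (Fin 4) (p + 3) v₀ (G a) := by
    rw [show (fun a => evTuple (Fin 4) (p + 3) v₀ (G a)) =
      (LinearMap.ker (pairing v₀)).subtype ∘ b from funext hG]
    exact b.linearIndependent.map' _ (Submodule.ker_subtype _)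
  refine (OpenProp.linearIndependent (A := fun v a => evTuple (Fin 4) (p + 3) v (G a))
    (fun a q => polyFun_evTuple _ _) (fun i => (hw i).2) hb).mono fun v hv hli hv0 c hc => ?_
  have hspan : Submodule.span k (Set.range fun a => evTuple (Fin 4) (p + 3) v (G a)) =
      LinearMap.ker (pairing v) := by
    refine Submodule.eq_of_le_of_finrank_le ?_ ?_
    · rw [Submodule.span_le]
      rintro _ ⟨a, rfl⟩
      exact row_le_pairing hv (hGK a)
    · rw [finrank_ker_pairing hv0, finrank_span_eq_card hli, Fintype.card_fin]
  have hcm : (fun q => c q.1 q.2) ∈ LinearMap.ker (pairing v) :=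
    LinearMap.mem_ker.2 (funext fun i => by rw [pairing_apply]; exact hc i)
  rw [← hspan, Submodule.mem_span_range_iff_exists_fun] at hcm
  obtain ⟨y, hy⟩ := hcm
  have hmem : ∑ a, y a • G a ∈ K := Submodule.sum_mem _ fun a _ => K.smul_mem _ (hGK a)
  refine ⟨fun e => ((∑ a, y a • G a) e : Forms k (p + 3)), fun e => ((∑ a, y a • G a) e).2, ?_, ?_⟩
  · have := hmem ()
    rwa [rowRel_apply] at this
  · intro i e
    rw [← evTuple_apply v _ (i, e), map_sum]
    simp only [map_smul]
    rw [hy]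

end Tangent

section Resolution

variable {k : Type} [Field k] {f : R4 k} {I : Ideal (R4 k)} {r : ℕ}

/-- An ideal containing the cubic form `f`, whose elements of degree below `r` are multiples
of `f`. -/
structure LowDeg (f : R4 k) (I : Ideal (R4 k)) (r : ℕ) : Prop where
  homog : f.IsHomogeneous 3
  mem : f ∈ I
  le : 4 ≤ r
  low : ∀ n < r, ∀ g : R4 k, g.IsHomogeneous n → g ∈ I → g ∈ Ideal.span {f}

theorem entry_eq_zero {d e : ℕ} {q : R4 k} (h : EntryOk k d e q) (hde : d ≤ e) : q = 0 := by
  obtain ⟨rfl | ⟨c, rfl, hc⟩, h0⟩ := h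
  · rfl
  obtain rfl : c = 0 := by lia
  obtain ⟨x, rfl⟩ := homog_zero hc
  rw [coeff_zero_C] at h0
  rw [h0, map_zero]

theorem entry_linear {d e : ℕ} {q : R4 k} (h : EntryOk k d e q) (hde : d = e + 1) :
    ∃ m : Fin 4 → k, q = ∑ a, X a * C (m a) := by
  obtain ⟨rfl | ⟨c, rfl, hc⟩, -⟩ := h
  · exact ⟨0, by simp⟩
  obtain rfl : c = 1 := by lia
  exact homog_one_form hc

theorem coeff_zero_of_homog {n : ℕ} {u : R4 k} (hu : u.IsHomogeneous n) (hn : n ≠ 0) :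
    coeff 0 u = 0 := hu.coeff_eq_zero (by simpa using hn.symm)

theorem coeff_zero_mul (p q : R4 k) : coeff 0 (p * q) = coeff 0 p * coeff 0 q := by
  simp only [← constantCoeff_eq, map_mul]

theorem coeff_zero_eq_zero_of_sum {n : ℕ} {w : R4 k} {u M : Fin n → R4 k}
    (h : w = ∑ i, u i * M i) (hM : ∀ i, coeff 0 (M i) = 0) : coeff 0 w = 0 := by
  rw [h, coeff_sum]
  exact Finset.sum_eq_zero fun i _ => by rw [coeff_zero_mul, hM, mul_zero]

end Resolution
end MRC

namespace Res3Body
open MRC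

variable {k : Type} [Field k] {f : R4 k} {I : Ideal (R4 k)} {r : ℕ}

variable {n1 n2 n3 : ℕ} {d1 : Fin n1 → ℕ} {d2 : Fin n2 → ℕ} {d3 : Fin n3 → ℕ}
  {g : Fin n1 → R4 k} {M2 : Fin n2 → Fin n1 → R4 k} {M3 : Fin n3 → Fin n2 → R4 k}

theorem generates (hR : Res3Body k ⊥ I d1 d2 d3 g M2 M3) {x : R4 k} (hx : x ∈ I) :
    ∃ w : Fin n1 → R4 k, x = ∑ j, w j * g j := by
  obtain ⟨w, hw⟩ := hR.2.1 x hx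
  exact ⟨w, sub_eq_zero.1 (Ideal.mem_bot.1 hw)⟩

theorem coeff_syzygy (hR : Res3Body k ⊥ I d1 d2 d3 g M2 M3) {w : Fin n1 → R4 k}
    (hw : ∑ j, w j * g j = 0) (j : Fin n1) : coeff 0 (w j) = 0 := by
  obtain ⟨-, -, h, -, h', -⟩ := hR
  obtain ⟨u, hu⟩ := (h' w).1 (Ideal.mem_bot.2 hw)
  exact coeff_zero_eq_zero_of_sum (hu j) fun i => (h i j).2

theorem coeff_second_syzygy (hR : Res3Body k ⊥ I d1 d2 d3 g M2 M3) {u : Fin n2 → R4 k}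
    (hu : ∀ j, ∑ i, u i * M2 i j = 0) (i : Fin n2) : coeff 0 (u i) = 0 := by
  obtain ⟨-, -, -, h, -, h', -⟩ := hR
  obtain ⟨t, ht⟩ := (h' u).1 hu
  exact coeff_zero_eq_zero_of_sum (ht i) fun l => (h l i).2

theorem row_relation (hR : Res3Body k ⊥ I d1 d2 d3 g M2 M3) (i : Fin n2) :
    ∑ j, M2 i j * g j = 0 := by
  obtain ⟨-, -, -, -, h, -⟩ := hR
  exact Ideal.mem_bot.1 ((h (M2 i)).2 ⟨Pi.single i 1, fun j => by simp [Pi.single_apply]⟩)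

theorem second_row_relation (hR : Res3Body k ⊥ I d1 d2 d3 g M2 M3) (l : Fin n3) (j : Fin n1) :
    ∑ i, M3 l i * M2 i j = 0 := by
  obtain ⟨-, -, -, -, -, h, -⟩ := hR
  exact (h (M3 l)).2 ⟨Pi.single l 1, fun i => by simp [Pi.single_apply]⟩ j

theorem row_ne_zero (hR : Res3Body k ⊥ I d1 d2 d3 g M2 M3) (i : Fin n2) : ∃ j, M2 i j ≠ 0 := by
  by_contra! h
  have := hR.coeff_second_syzygy (u := Pi.single i 1) (fun j => by simp [Pi.single_apply, h]) i
  simp at this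

theorem second_row_ne_zero (hR : Res3Body k ⊥ I d1 d2 d3 g M2 M3) (l : Fin n3) :
    ∃ i, M3 l i ≠ 0 := by
  by_contra! h
  obtain ⟨-, -, -, -, -, -, h'⟩ := hR
  have := congrFun (h' (Pi.single l 1) fun i => by simp [Pi.single_apply, h]) l
  simp at this

theorem coeff_of_eq_mul (hR : Res3Body k ⊥ I d1 d2 d3 g M2 M3) (hf : f ∈ I) {w : Fin n1 → R4 k}
    {u : R4 k} (hw : ∑ j, w j * g j = f * u) (hu : coeff 0 u = 0) (j : Fin n1) :
    coeff 0 (w j) = 0 := by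
  obtain ⟨y, hy⟩ := hR.generates hf
  have := hR.coeff_syzygy (w := fun j => w j - u * y j) (by
    simp only [sub_mul, Finset.sum_sub_distrib, mul_assoc, ← Finset.mul_sum]
    rw [hw, ← hy, mul_comm, sub_self]) j
  rwa [coeff_sub, coeff_zero_mul, hu, zero_mul, sub_zero] at this

theorem low_generator (hR : Res3Body k ⊥ I d1 d2 d3 g M2 M3) (hL : LowDeg f I r) {j : Fin n1}
    (hj : d1 j < r) : ∃ c : R4 k, g j = f * c ∧ coeff 0 c ≠ 0 := by
  obtain ⟨c, hc⟩ := Ideal.mem_span_singleton.1 (hL.low _ hj _ (hR.1 j).2 (hR.1 j).1)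
  refine ⟨c, hc, fun h0 => ?_⟩
  have := hR.coeff_of_eq_mul hL.mem (w := Pi.single j 1) (u := c)
    (by simpa [Pi.single_apply] using hc) h0 j
  simp at this

theorem low_generator_unique (hR : Res3Body k ⊥ I d1 d2 d3 g M2 M3) (hL : LowDeg f I r)
    {j j' : Fin n1} (hj : d1 j < r) (hj' : d1 j' < r) : j = j' := by
  by_contra hne
  obtain ⟨c, hc, -⟩ := hR.low_generator hL hj
  obtain ⟨c', hc', h0⟩ := hR.low_generator hL hj'
  have := hR.coeff_syzygy (w := Pi.single j c' - Pi.single j' c) (by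
    simp [Pi.single_apply, sub_mul, Finset.sum_sub_distrib]
    rw [hc, hc']; ring) j
  simp [hne] at this
  exact h0 this

theorem low_relation_eq_zero (hR : Res3Body k ⊥ I d1 d2 d3 g M2 M3) (hL : LowDeg f I r)
    {w : Fin n1 → R4 k} (hw : ∑ j, w j * g j = 0) (h : ∀ j, r ≤ d1 j → w j = 0) (j : Fin n1) :
    w j = 0 := by
  by_cases hj : r ≤ d1 j
  · exact h j hj
  rw [not_le] at hj
  rw [Finset.sum_eq_single j (fun j' _ hne => by
    rw [h j' (by by_contra! h'; exact hne (hR.low_generator_unique hL h' hj)), zero_mul])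
    (by simp)] at hw
  refine (mul_eq_zero.1 hw).resolve_right fun h0 => ?_
  have := hR.coeff_syzygy (w := Pi.single j 1) (by simpa [Pi.single_apply] using h0) j
  simp at this

theorem homog_scalar (hR : Res3Body k ⊥ I d1 d2 d3 g M2 M3) {a : Fin n1 → k}
    (ha : ∀ j, d1 j ≠ r → a j = 0) : (∑ j, C (a j) * g j).IsHomogeneous r := by
  refine IsHomogeneous.sum _ _ _ fun j _ => ?_
  by_cases hj : d1 j = r
  · have := (isHomogeneous_C (Fin 4) (a j)).mul (hR.1 j).2
    rwa [zero_add, hj] at this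
  · rw [ha j hj, map_zero, zero_mul]
    exact isHomogeneous_zero _ _ _

theorem mem_scalar (hR : Res3Body k ⊥ I d1 d2 d3 g M2 M3) (a : Fin n1 → k) :
    ∑ j, C (a j) * g j ∈ I :=
  I.sum_mem fun j _ => I.mul_mem_left _ (hR.1 j).1

theorem scalar_combination (hR : Res3Body k ⊥ I d1 d2 d3 g M2 M3) (hL : LowDeg f I r)
    {a : Fin n1 → k} (ha : ∀ j, d1 j ≠ r → a j = 0)
    (h : ∑ j, C (a j) * g j ∈ Ideal.span {f}) (j : Fin n1) : a j = 0 := by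
  have hom := hR.homog_scalar ha
  obtain ⟨u, hu, e⟩ := mem_span_homog (n := r - 3) hL.homog (by
    rwa [Nat.sub_add_cancel (by have := hL.le; lia)]) h
  simpa using hR.coeff_of_eq_mul hL.mem e (coeff_zero_of_homog hu (by have := hL.le; lia)) j

end Res3Body

namespace MRC

section Conditions

variable {k : Type} [Field k]

/-- Row vectors of forms in `I` of degree `r` orthogonal to the variables modulo `f` vanish
modulo `f`. -/
def RowInjective (f : R4 k) (I : Ideal (R4 k)) (r : ℕ) : Prop :=
  ∀ G : Fin 4 → R4 k, (∀ e, (G e).IsHomogeneous r) → (∀ e, G e ∈ I) →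
    (∀ c, rowRel G c ∈ Ideal.span {f}) → ∀ e, G e ∈ Ideal.span {f}

/-- Alternating matrices of forms in `I` of degree `r` annihilating the variables modulo `f` vanish
modulo `f`. -/
def AltInjective (f : R4 k) (I : Ideal (R4 k)) (r : ℕ) : Prop :=
  ∀ G : Fin 4 × Fin 4 → R4 k, (∀ e, (G e).IsHomogeneous r) → (∀ e, G e ∈ I) →
    (∀ c, altRel G c ∈ Ideal.span {f}) → ∀ e, G e ∈ Ideal.span {f}

/-- Modulo `f`, the forms in `I` of degree `r` generate those of degree `r + 1`. -/
def RowSurjective (f : R4 k) (I : Ideal (R4 k)) (r : ℕ) : Prop :=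
  ∀ g : R4 k, g.IsHomogeneous (r + 1) → g ∈ I → ∃ G : Fin 4 → R4 k,
    (∀ e, (G e).IsHomogeneous r) ∧ (∀ e, G e ∈ I) ∧ g - ∑ e, X e * G e ∈ Ideal.span {f}

theorem alternating_of_quadratic_eq_zero {B : Fin 4 → Fin 4 → k}
    (h : ∑ a, ∑ b, X a * (X b * C (B a b)) = (0 : R4 k)) (a b : Fin 4) :
    B a a = 0 ∧ B a b + B b a = 0 := by
  have hc : ∀ v : Fin 4 → k, ∑ a, ∑ b, v a * (v b * B a b) = 0 := fun v => by
    simpa using congrArg (eval v) h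
  have hd : ∀ a, B a a = 0 := fun a => by
    simpa [Pi.single_apply] using hc (Pi.single a 1)
  refine ⟨hd a, ?_⟩
  have := hc (Pi.single a 1 + Pi.single b 1)
  rw [add_comm]
  simpa [Pi.single_apply, add_mul, mul_add, Finset.sum_add_distrib, hd] using this

end Conditions
end MRC

namespace Res3Body
open MRC

variable {k : Type} [Field k] {f : R4 k} {I : Ideal (R4 k)} {r : ℕ} {n1 n2 n3 : ℕ}
  {d1 : Fin n1 → ℕ} {d2 : Fin n2 → ℕ} {d3 : Fin n3 → ℕ}
  {g : Fin n1 → R4 k} {M2 : Fin n2 → Fin n1 → R4 k} {M3 : Fin n3 → Fin n2 → R4 k}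

theorem generator_degree_ne (hR : Res3Body k ⊥ I d1 d2 d3 g M2 M3) (hL : LowDeg f I r)
    (hS : RowSurjective f I r) (l : Fin n1) : d1 l ≠ r + 1 := by
  intro hl
  have hgl := (hR.1 l).2
  rw [hl] at hgl
  obtain ⟨G, hG, u, hu, e⟩ : ∃ G : Fin 4 → R4 k, (∀ e, G e ∈ I) ∧ ∃ u : R4 k,
      u.IsHomogeneous (r + 1 - 3) ∧ g l - ∑ e, X e * G e = f * u := by
    obtain ⟨G, hGr, hG, hgG⟩ := hS _ hgl (hR.1 l).1
    have := hL.le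
    have hh : (g l - ∑ e, X e * G e).IsHomogeneous (r + 1 - 3 + 3) := by
      rw [show r + 1 - 3 + 3 = 1 + r by lia]
      exact (add_comm r 1 ▸ hgl).sub
        (IsHomogeneous.sum _ _ _ fun e _ => (isHomogeneous_X k e).mul (hGr e))
    exact ⟨G, hG, mem_span_homog hL.homog hh hgG⟩
  choose w hw using fun a => hR.generates (hG a)
  have := hR.coeff_of_eq_mul hL.mem (w := fun j => (if j = l then 1 else 0) - ∑ a, X a * w a j) (by
    rw [← e]
    simp only [sub_mul, Finset.sum_sub_distrib, Finset.sum_mul]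
    rw [Finset.sum_comm]
    simp only [hw, Finset.mul_sum, mul_assoc]
    simp) (coeff_zero_of_homog hu (by have := hL.le; lia)) l
  simp [coeff_sum, coeff_zero_mul] at this

/-- The sum of the terms of a relation over the generators of degree `r` is a multiple of `f`, if no
generator of larger degree is involved. -/
theorem sum_top_mem (hR : Res3Body k ⊥ I d1 d2 d3 g M2 M3) (hL : LowDeg f I r)
    {w : Fin n1 → R4 k} (hw : ∑ j, w j * g j = 0) (h : ∀ j, r < d1 j → w j = 0) :
    ∑ j, (if d1 j = r then w j * g j else 0) ∈ Ideal.span {f} := by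
  have : ∑ j, (if d1 j = r then w j * g j else 0) =
      -∑ j, (if d1 j = r then 0 else w j * g j) := by
    rw [eq_neg_iff_add_eq_zero, ← Finset.sum_add_distrib]
    refine Eq.trans ?_ hw
    exact Finset.sum_congr rfl fun j _ => by split_ifs <;> simp
  rw [this]
  refine neg_mem (Ideal.sum_mem _ fun j _ => ?_)
  split_ifs with hj
  · exact zero_mem _
  rcases lt_or_gt_of_ne hj with hj | hj
  · exact Ideal.mul_mem_left _ _ (hL.low _ hj _ (hR.1 j).2 (hR.1 j).1)
  · rw [h j hj, zero_mul]
    exact zero_mem _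

theorem relation_degree_gt (hR : Res3Body k ⊥ I d1 d2 d3 g M2 M3) (hL : LowDeg f I r)
    (i : Fin n2) : r < d2 i := by
  by_contra! hi
  obtain ⟨j, hj⟩ := hR.row_ne_zero i
  obtain ⟨-, -, h, -⟩ := id hR
  exact hj (hR.low_relation_eq_zero hL (hR.row_relation i)
    (fun j hj => entry_eq_zero (h i j) (hi.trans hj)) j)

theorem exists_linear_entries (hR : Res3Body k ⊥ I d1 d2 d3 g M2 M3) {i : Fin n2}
    (hi : d2 i = r + 1) : ∃ m : Fin n1 → Fin 4 → k, (∀ j, d1 j = r → M2 i j = ∑ b, X b * C (m j b)) ∧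
      ∀ j, d1 j ≠ r → m j = 0 := by
  obtain ⟨-, -, h, -⟩ := hR
  have : ∀ j, ∃ m : Fin 4 → k, (d1 j = r → M2 i j = ∑ b, X b * C (m b)) ∧ (d1 j ≠ r → m = 0) := by
    intro j
    by_cases hj : d1 j = r
    · obtain ⟨m, hm⟩ := entry_linear (h i j) (by rw [hi, hj])
      exact ⟨m, fun _ => hm, fun h => absurd hj h⟩
    · exact ⟨0, fun h => absurd h hj, fun _ => rfl⟩
  choose m h1 h2 using this
  exact ⟨m, h1, h2⟩

theorem relation_degree_ne (hR : Res3Body k ⊥ I d1 d2 d3 g M2 M3) (hL : LowDeg f I r)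
    (hA : RowInjective f I r) (i : Fin n2) : d2 i ≠ r + 1 := by
  intro hi
  obtain ⟨m, hm, hm0⟩ := hR.exists_linear_entries hi
  have hgt : ∀ j, r < d1 j → M2 i j = 0 := fun j hj => by
    obtain ⟨-, -, h, -⟩ := hR
    exact entry_eq_zero (h i j) (by lia)
  have hG : ∀ a, ∑ j, C (m j a) * g j ∈ Ideal.span {f} := by
    refine hA (fun a => ∑ j, C (m j a) * g j)
      (fun a => hR.homog_scalar fun j hj => by rw [hm0 j hj]; rfl)
      (fun a => hR.mem_scalar _) fun _ => ?_
    rw [rowRel_apply]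
    convert hR.sum_top_mem hL (hR.row_relation i) hgt using 1
    simp only [Finset.mul_sum]
    rw [Finset.sum_comm]
    refine Finset.sum_congr rfl fun j _ => ?_
    split_ifs with hj
    · rw [hm j hj, Finset.sum_mul]
      exact Finset.sum_congr rfl fun b _ => by ring
    · simp [hm0 j hj]
  have hm' : ∀ j a, m j a = 0 := fun j a =>
    hR.scalar_combination hL (a := fun j => m j a) (fun j hj => by rw [hm0 j hj]; rfl) (hG a) j
  obtain ⟨j, hj⟩ := hR.row_ne_zero i
  refine hj (hR.low_relation_eq_zero hL (hR.row_relation i) (fun j hj => ?_) j)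
  rcases hj.eq_or_lt with hj | hj
  · rw [hm j hj.symm]
    simp [hm']
  · exact hgt j hj

theorem second_relation_degree_ne (hR : Res3Body k ⊥ I d1 d2 d3 g M2 M3) (hL : LowDeg f I r)
    (hC : AltInjective f I r) (l : Fin n3) : d3 l ≠ r + 2 := by
  intro hl
  obtain ⟨-, -, hM2, hM3, -⟩ := id hR
  have hp : ∀ i, ∃ p : Fin 4 → k, M3 l i = ∑ a, X a * C (p a) ∧ (d2 i ≠ r + 1 → p = 0) := by
    intro i
    by_cases hi : d2 i = r + 1
    · obtain ⟨p, hp⟩ := entry_linear (hM3 l i) (by rw [hl, hi])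
      exact ⟨p, hp, fun h => absurd hi h⟩
    · refine ⟨0, ?_, fun _ => rfl⟩
      rw [entry_eq_zero (hM3 l i) (by have := hR.relation_degree_gt hL i; lia)]
      simp
  choose p hp hp0 using hp
  have hm : ∀ i, ∃ m : Fin n1 → Fin 4 → k,
      (d2 i = r + 1 → ∀ j, d1 j = r → M2 i j = ∑ b, X b * C (m j b)) ∧
      ∀ j, d1 j ≠ r → m j = 0 := by
    intro i
    by_cases hi : d2 i = r + 1
    · obtain ⟨m, h1, h2⟩ := hR.exists_linear_entries hi
      exact ⟨m, fun _ => h1, h2⟩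
    · exact ⟨0, fun h => absurd h hi, fun _ _ => rfl⟩
  choose m hm hm0 using hm
  let B : Fin n1 → Fin 4 → Fin 4 → k := fun j a b => ∑ i, p i a * m i j b
  have hB0 : ∀ j, d1 j ≠ r → ∀ a b, B j a b = 0 := fun j hj a b =>
    Finset.sum_eq_zero fun i _ => by rw [hm0 i j hj, Pi.zero_apply, mul_zero]
  let w : Fin 4 → Fin n1 → R4 k := fun a j => ∑ i, C (p i a) * M2 i j
  have hwB : ∀ a j, d1 j = r → w a j = ∑ b, X b * C (B j a b) := by
    intro a j hj
    simp only [w, B, map_sum, Finset.mul_sum]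
    rw [Finset.sum_comm]
    refine Finset.sum_congr rfl fun i _ => ?_
    by_cases hi : d2 i = r + 1
    · rw [hm i hi j hj, Finset.mul_sum]
      exact Finset.sum_congr rfl fun b _ => by rw [map_mul]; ring
    · simp [hp0 i hi]
  have hwgt : ∀ a j, r < d1 j → w a j = 0 := by
    intro a j hj
    refine Finset.sum_eq_zero fun i _ => ?_
    by_cases hi : d2 i = r + 1
    · rw [entry_eq_zero (hM2 i j) (by lia), mul_zero]
    · simp [hp0 i hi]
  have hw : ∀ a, ∑ j, w a j * g j = 0 := by
    intro a
    simp only [w, Finset.sum_mul, mul_assoc]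
    rw [Finset.sum_comm]
    simp only [← Finset.mul_sum, hR.row_relation, mul_zero, Finset.sum_const_zero]
  have hBalt : ∀ j a b, B j a a = 0 ∧ B j a b + B j b a = 0 := by
    intro j a b
    by_cases hj : d1 j = r
    · refine alternating_of_quadratic_eq_zero ?_ a b
      rw [← hR.second_row_relation l j]
      simp only [← Finset.mul_sum, ← hwB _ j hj, w, hp]
      simp only [Finset.mul_sum, Finset.sum_mul, mul_assoc]
      rw [Finset.sum_comm]
    · simp [hB0 j hj]
  have hG : ∀ e : Fin 4 × Fin 4, ∑ j, C (B j e.1 e.2) * g j ∈ Ideal.span {f} := by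
    refine hC (fun e => ∑ j, C (B j e.1 e.2) * g j)
      (fun e => hR.homog_scalar fun j hj => hB0 j hj _ _) (fun e => hR.mem_scalar _) fun c => ?_
    rcases c with a | a | ⟨a, b⟩
    · rw [altRel_row]
      convert hR.sum_top_mem hL (hw a) (hwgt a) using 1
      simp only [Finset.mul_sum]
      rw [Finset.sum_comm]
      refine Finset.sum_congr rfl fun j _ => ?_
      split_ifs with hj
      · rw [hwB a j hj, Finset.sum_mul]
        exact Finset.sum_congr rfl fun b _ => by ring
      · simp [hB0 j hj]
    · rw [altRel_diag]
      simp [hBalt _ a a]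
    · rw [altRel_add, ← Finset.sum_add_distrib]
      simp [← add_mul, ← map_add, hBalt _ a b]
  have hB : ∀ j a b, B j a b = 0 := fun j a b =>
    hR.scalar_combination hL (a := fun j => B j a b) (fun j hj => hB0 j hj a b) (hG (a, b)) j
  have hw0 : ∀ a j, w a j = 0 := fun a => hR.low_relation_eq_zero hL (hw a) fun j hj => by
    rcases hj.eq_or_lt with hj | hj
    · rw [hwB a j hj.symm]
      simp [hB]
    · exact hwgt a j hj
  obtain ⟨i, hi⟩ := hR.second_row_ne_zero l
  refine hi ?_
  rw [hp]
  refine Finset.sum_eq_zero fun a _ => ?_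
  have := hR.coeff_second_syzygy (u := fun i => C (p i a)) (hw0 a) i
  rw [coeff_zero_C] at this
  rw [this, map_zero, mul_zero]

end Res3Body

namespace MRC

section Assembly

variable {k : Type} [Field k] {f : R4 k} {r t : ℕ}

/-- The vectors `v i` represent the points `Z i`. -/
def Represents (v : Fin t → Fin 4 → k) (Z : Fin t → P3 k) : Prop :=
  ∀ i, ∃ hv : v i ≠ 0, Projectivization.mk k (v i) hv = Z i

theorem vanishesAt_mk_iff {g : R4 k} {n : ℕ} (hg : g.IsHomogeneous n) {x : Fin 4 → k} (hx : x ≠ 0) :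
    VanishesAt k g (Projectivization.mk k x hx) ↔ eval x g = 0 := by
  refine ⟨fun h => h x hx rfl, fun h w hw hwx => ?_⟩
  obtain ⟨c, rfl⟩ := (Projectivization.mk_eq_mk_iff' k w x hw hx).1 hwx
  rw [eval_smul_homog hg, h, mul_zero]

theorem mem_pointsIdeal_iff {v : Fin t → Fin 4 → k} {Z : Fin t → P3 k} (hv : Represents v Z)
    {g : R4 k} {n : ℕ} (hg : g.IsHomogeneous n) :
    g ∈ pointsIdeal k (Set.range Z) ↔ ∀ i, eval (v i) g = 0 := by
  change (∀ p ∈ Set.range Z, VanishesAt k g p) ↔ _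
  rw [Set.forall_mem_range]
  refine forall_congr' fun i => ?_
  obtain ⟨hi, h⟩ := hv i
  rw [← h, vanishesAt_mk_iff hg]

theorem lowDeg_pointsIdeal (hf : f.IsHomogeneous 3) (hirr : Irreducible f) (hr : 4 ≤ r)
    {v : Fin t → Fin 4 → k} {Z : Fin t → P3 k} (hv : Represents v Z) (hvf : ∀ i, eval (v i) f = 0)
    (h : ∀ g : R4 k, g.IsHomogeneous (r - 1) → (∀ i, eval (v i) g = 0) → g ∈ Ideal.span {f}) :
    LowDeg f (pointsIdeal k (Set.range Z)) r where
  homog := hf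
  mem := (mem_pointsIdeal_iff hv hf).2 hvf
  le := hr
  low n hn g hg hgI := by
    have hgv := (mem_pointsIdeal_iff hv hg).1 hgI
    have hX : (X 0 : R4 k) ∉ Ideal.span {f} :=
      not_mem_span_of_lt hf (isHomogeneous_X k 0) (by norm_num) (X_ne_zero 0)
    have := h (X 0 ^ (r - 1 - n) * g) (by
      have := ((isHomogeneous_X k (0 : Fin 4)).pow (r - 1 - n)).mul hg
      rwa [show 1 * (r - 1 - n) + n = r - 1 by lia] at this) fun i => by
        rw [map_mul, hgv, mul_zero]
    have hp := prime_span hirr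
    exact (hp.mem_or_mem this).resolve_left fun h => hX (hp.mem_of_pow_mem _ h)

theorem rowSurjective_pointsIdeal {v : Fin t → Fin 4 → k} {Z : Fin t → P3 k} (hv : Represents v Z)
    (h : ∀ c : Fin t → Fin 4 → k, (∀ i, ∑ e, v i e * c i e = 0) →
      ∃ g : Fin 4 → R4 k, (∀ e, (g e).IsHomogeneous r) ∧
        ∑ e, X e * g e ∈ Ideal.span {f} ∧ ∀ i e, eval (v i) (g e) = c i e) :
    RowSurjective f (pointsIdeal k (Set.range Z)) r := by
  intro g hg hgI
  have hgv := (mem_pointsIdeal_iff hv hg).1 hgI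
  obtain ⟨q, hq, rfl⟩ := homog_succ_decomp hg
  obtain ⟨s, hs, hsf, hsv⟩ := h (fun i e => eval (v i) (q e)) fun i => by
    simpa using hgv i
  refine ⟨fun e => q e - s e, fun e => (hq e).sub (hs e), fun e => ?_, ?_⟩
  · refine (mem_pointsIdeal_iff hv ((hq e).sub (hs e))).2 fun i => ?_
    rw [map_sub, hsv, sub_self]
  · simpa [mul_sub] using hsf

theorem generalPointsSatisfy_of_openProp [IsAlgClosed k] (S : SmoothCubicSurface k)
    {P : (Fin t → Fin 4 → k) → Prop} {Q : (Fin t → P3 k) → Prop} (hP : OpenProp S.f t P)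
    (h : ∀ v Z, Represents v Z → (∀ i, eval (v i) S.f = 0) → P v → Q Z) :
    GeneralPointsSatisfy k S t Q := by
  have h0 := OpenProp.forall_mem (t := t) S.irred Finset.univ
    fun i : Fin t => open_coord_ne_zero S.homog S.irred i
  have h1 := OpenProp.forall_mem (t := t) S.irred Finset.univ.offDiag
    (P := fun p v => v p.1 0 * v p.2 1 - v p.2 0 * v p.1 1 ≠ 0 ∨ p.1 = p.2)
    fun p : Fin t × Fin t => by
      by_cases hp : p.1 = p.2
      · exact OpenProp.of_forall S.irred fun v => Or.inr hp
      · exact (open_minor_ne_zero S.homog S.irred hp).mono fun v _ h => Or.inl h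
  obtain ⟨G, ⟨v, hv, hG⟩, hGP⟩ := (h0.and S.irred h1).and S.irred hP
  refine ⟨G, ?_, ?_⟩
  · obtain ⟨⟨hv0, hm⟩, -⟩ := hGP v hv hG
    have hv0' : ∀ i, v i ≠ 0 := fun i => hv0 i (Finset.mem_univ i)
    refine ⟨fun i => Projectivization.mk k (v i) (hv0' i), ⟨fun i j hij => ?_, fun i => ?_⟩,
      v, fun i => ⟨hv0' i, rfl⟩, hG⟩
    · by_contra hne
      obtain ⟨c, hc⟩ := (Projectivization.mk_eq_mk_iff' k _ _ (hv0' i) (hv0' j)).1 hij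
      refine (hm (i, j) (by simpa using hne)).elim (fun h => h ?_) hne
      simp only [← hc, Pi.smul_apply, smul_eq_mul]
      ring
    · exact (vanishesAt_mk_iff S.homog _).2 (hv i)
  · rintro Z ⟨-, hZ⟩ ⟨w, hw, hGw⟩
    have hwf : ∀ i, eval (w i) S.f = 0 := fun i => by
      obtain ⟨hi, h⟩ := hw i
      exact hZ i _ hi h
    exact h w Z hw hwf (hGP w hwf hGw).2

/-- Either there are no relations of degree `r + 1`, or there are no generators of that degree. -/
theorem betti_mul_eq_zero {I : Ideal (R4 k)} (hL : LowDeg f I r) (hA : AltInjective f I r)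
    (hRS : RowInjective f I r ∨ RowSurjective f I r) {n1 n2 n3 : ℕ} {d1 : Fin n1 → ℕ}
    {d2 : Fin n2 → ℕ} {d3 : Fin n3 → ℕ} (h : HasMinFreeRes3 k ⊥ I d1 d2 d3) (i : ℕ) :
    bettiCount d1 d2 d3 (i + 1) (r - 1) * bettiCount d1 d2 d3 i r = 0 := by
  obtain ⟨g, M2, M3, hR⟩ := h
  have hr := hL.le
  rcases i with - | - | - | i
  · have : r ≠ 0 := by lia
    simp [bettiCount, this]
  · rcases hRS with hRS | hRS
    · have : ∀ i, d2 i ≠ 2 + (r - 1) := fun i h => hR.relation_degree_ne hL hRS i (by lia)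
      simp [bettiCount, this]
    · have : ∀ i, d1 i ≠ 1 + r := fun i h => hR.generator_degree_ne hL hRS i (by lia)
      simp [bettiCount, this]
  · have : ∀ i, d3 i ≠ 3 + (r - 1) := fun i h => hR.second_relation_degree_ne hL hA i (by lia)
    simp [bettiCount, this]
  · simp [bettiCount]

theorem relInjective_pointsIdeal {ι κ : Type} (L : (ι → R4 k) →ₗ[R4 k] (κ → R4 k))
    {v : Fin t → Fin 4 → k} {Z : Fin t → P3 k} (hv : Represents v Z)
    (h : ∀ g : ι → R4 k, (∀ e, (g e).IsHomogeneous r) → (∀ c, L g c ∈ Ideal.span {f}) →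
      (∀ i e, eval (v i) (g e) = 0) → ∀ e, g e ∈ Ideal.span {f})
    (G : ι → R4 k) (hG : ∀ e, (G e).IsHomogeneous r) (hGI : ∀ e, G e ∈ pointsIdeal k (Set.range Z))
    (hL : ∀ c, L G c ∈ Ideal.span {f}) (e : ι) : G e ∈ Ideal.span {f} :=
  h G hG hL (fun i e => (mem_pointsIdeal_iff hv (hG e)).1 (hGI e) i) e

theorem open_vanishing [IsAlgClosed k] (hf : f.IsHomogeneous 3) (hirr : Irreducible f) (hr : 4 ≤ r)
    (ht : PXcubic (r - 1) ≤ t) :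
    OpenProp f t fun v => ∀ g : R4 k, g.IsHomogeneous (r - 1) → (∀ i, eval (v i) g = 0) →
      g ∈ Ideal.span {f} := by
  obtain ⟨s, rfl⟩ := Nat.exists_eq_add_of_le' hr
  obtain ⟨S, hS, hSX, hSg⟩ := exists_vanishing_good hf hirr s
  refine (open_relGood hf hirr (0 : (Unit → R4 k) →ₗ[R4 k] (Unit → R4 k)) (s + 3) hSX (hS.trans ht)
    fun g hg _ hgS e => hSg _ (hg e) fun v hv => hgS v hv e).mono fun v _ h g hg hgv => ?_
  exact h (fun _ => g) (fun _ => hg) (fun _ => zero_mem _) (fun i _ => hgv i) ()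

theorem general_betti_mul_eq_zero [IsAlgClosed k] (S : SmoothCubicSurface k) (hr : 4 ≤ r)
    (ht : PXcubic (r - 1) ≤ t) (htr : 2 * t ≤ 3 * r ^ 2 + r ∨ 3 * r ^ 2 + r ≤ 2 * t)
    (htA : 3 * r ^ 2 ≤ 2 * t + r) :
    GeneralPointsSatisfy k S t (fun Z =>
      ∀ (n1 n2 n3 : ℕ) (d1 : Fin n1 → ℕ) (d2 : Fin n2 → ℕ) (d3 : Fin n3 → ℕ),
        HasMinFreeRes3 k ⊥ (pointsIdeal k (Set.range Z)) d1 d2 d3 →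
        ∀ i : ℕ, bettiCount d1 d2 d3 (i + 1) (r - 1) * bettiCount d1 d2 d3 i r = 0) := by
  have H := cubicEq_of_smooth S
  have hV := open_vanishing (t := t) S.homog S.irred hr ht
  obtain ⟨A, hA, hAX, hAg⟩ := exists_alt_good H r (by lia)
  have hA := open_relGood (t := t) S.homog S.irred altRel r hAX (by lia) hAg
  rcases htr with htr | htr
  · obtain ⟨p, rfl⟩ := Nat.exists_eq_add_of_le' (show 3 ≤ r by lia)
    refine generalPointsSatisfy_of_openProp S
      ((hV.and S.irred hA).and S.irred (open_row_surjective H p htr)) ?_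
    rintro v Z hv hvf ⟨⟨hV, hA⟩, hB⟩ n1 n2 n3 d1 d2 d3 hd
    exact betti_mul_eq_zero (lowDeg_pointsIdeal S.homog S.irred hr hv hvf hV)
      (relInjective_pointsIdeal altRel hv hA)
      (.inr (rowSurjective_pointsIdeal hv (hB fun i => (hv i).1))) hd
  · obtain ⟨B, hB, hBX, hBg⟩ := exists_row_good H r (by lia)
    refine generalPointsSatisfy_of_openProp S ((hV.and S.irred hA).and S.irred
      (open_relGood (t := t) S.homog S.irred rowRel r hBX (by lia) hBg)) ?_
    rintro v Z hv hvf ⟨⟨hV, hA⟩, hB⟩ n1 n2 n3 d1 d2 d3 hd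
    exact betti_mul_eq_zero (lowDeg_pointsIdeal S.homog S.irred hr hv hvf hV)
      (relInjective_pointsIdeal altRel hv hA) (.inl (relInjective_pointsIdeal rowRel hv hB)) hd

theorem eq_of_PXcubic_bounds {a z : ℕ} (ha : 1 ≤ a) (h1 : 3 * (a * (a - 1) / 2) + a ≤ z)
    (h2 : z ≤ 3 * (a * (a - 1) / 2) + 2 * a + 1) (hr : 1 ≤ r) (hr1 : PXcubic (r - 1) ≤ z)
    (hr2 : z < PXcubic r) : r = a := by
  obtain ⟨b, rfl⟩ := Nat.exists_eq_add_of_le' ha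
  obtain ⟨s, rfl⟩ := Nat.exists_eq_add_of_le' hr
  have hs := PXcubic_eq s
  have hs1 := PXcubic_eq (s + 1)
  have hb : 2 * ((b + 1) * b / 2) = (b + 1) * b := by
    rw [mul_comm (b + 1)]
    exact Nat.two_mul_div_two_of_even (Nat.even_mul_succ_self b)
  simp only [Nat.add_sub_cancel] at *
  rcases lt_trichotomy s b with h | h | h
  · nlinarith
  · rw [h]
  · nlinarith

theorem two_mul_choose_form {a : ℕ} (ha : 1 ≤ a) :
    2 * (3 * (a * (a - 1) / 2)) + 3 * a = 3 * a ^ 2 := by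
  obtain ⟨b, rfl⟩ := Nat.exists_eq_add_of_le' ha
  have hb : 2 * ((b + 1) * b / 2) = (b + 1) * b := by
    rw [mul_comm (b + 1)]
    exact Nat.two_mul_div_two_of_even (Nat.even_mul_succ_self b)
  simp only [Nat.add_sub_cancel]
  nlinarith

end Assembly
end MRC

/-- The Minimal Resolution Conjecture holds on a smooth cubic surface `X ⊂ ℙ³`
for general sets of `z` points, for `z = m(a), n(a), o(a), p(a)` and every `a ≥ 1`: if
`P_X(r-1) ≤ z < P_X(r)` (with `r ≥ reg(X) + 1 = 4`), then for a general set `Z` of `z` points on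
`X`, every graded minimal free resolution of `I_Z` satisfies
`b_{i+1,r-1}(Z) · b_{i,r}(Z) = 0` for all `i`. -/
theorem mrc_cubic_holds (k : Type) [Field k] [IsAlgClosed k]
    (S : SmoothCubicSurface k) (a : ℕ) (ha : 1 ≤ a) (z : ℕ)
    (hz : z = (3 * (a * (a - 1) / 2) + a) ∨ z = (3 * (a * (a - 1) / 2) + 2 * a) ∨ z = (3 * (a * (a - 1) / 2) + a + 1) ∨ z = (3 * (a * (a - 1) / 2) + 2 * a + 1))
    (r : ℕ) (hr : 4 ≤ r) (hr1 : PXcubic (r - 1) ≤ z) (hr2 : z < PXcubic r) :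
    GeneralPointsSatisfy k S z (fun Z =>
      ∀ (n1 n2 n3 : ℕ) (d1 : Fin n1 → ℕ) (d2 : Fin n2 → ℕ) (d3 : Fin n3 → ℕ),
        HasMinFreeRes3 k ⊥ (pointsIdeal k (Set.range Z)) d1 d2 d3 →
        ∀ i : ℕ, bettiCount d1 d2 d3 (i + 1) (r - 1) * bettiCount d1 d2 d3 i r = 0) := by
  obtain rfl := MRC.eq_of_PXcubic_bounds ha (by lia) (by lia) (by lia) hr1 hr2
  have := MRC.two_mul_choose_form ha
  exact MRC.general_betti_mul_eq_zero S hr hr1 (by lia) (by lia)
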